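/- For every β with 1 < β < 4/3 there exists a constant C, depending only on β, V_F, V_E, g_L, g_in, a and σ_E (but not on q), with the following property: for every classical stationary solution p of the voltage–conductance equation with p > 0 on (0,V_F)×[0,∞), and every q ≥ 4/3 such that d_q := ∫_Ω (g + g_L)²·p(v,g)^q dv dg < ∞ and such that p^q, g²·p^q and ∂_g(p^q) decay to 0 as g → ∞ uniformly in v, one has ∫_Ω (g + g_L)²·p(v,g)^{βq} dv dg ≤ C·q^β·(d_q)^β. -/

import Mathlib

open Real MeasureTheory Set Filter

noncomputable section

/-- The voltage flux `J(v,g) = -g_L v + g (V_E - v)`. -/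
def Jflux (VE gL v g : ℝ) : ℝ := -gL * v + g * (VE - v)

/-- The Maxwellian `M(g) = exp(-(g - g_in)^2 / (2a))`. -/
def Mw (gin a g : ℝ) : ℝ := Real.exp (-(g - gin) ^ 2 / (2 * a))

/-- A classical stationary solution of the voltage-conductance equation:
`p : (0,V_F) × [0,∞) → [0,∞)`, C¹ in `v` (with continuous boundary extension) and
C² in `g` up to `g = 0`, satisfying the stationary equation, the no-flux boundary
condition at `g = 0`, the `v`-boundary conditions changing type at `g_F = g_L V_F/(V_E - V_F)`,
the normalization, and decay (uniform in `v`) of `p`, `g² p`, `∂_g p` as `g → ∞`. -/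
structure StatSol (VF VE gL gin a σE : ℝ) (p : ℝ → ℝ → ℝ) : Prop where
  nonneg : ∀ v ∈ Ioo 0 VF, ∀ g ∈ Ici (0:ℝ), 0 ≤ p v g
  cont_v : ∀ g ∈ Ici (0:ℝ), ContinuousOn (fun v => p v g) (Icc 0 VF)
  diff_v : ∀ v ∈ Ioo 0 VF, ∀ g ∈ Ioi (0:ℝ), DifferentiableAt ℝ (fun v' => p v' g) v
  smooth_g : ∀ v ∈ Ioo 0 VF, ContDiffOn ℝ 2 (fun g => p v g) (Ici 0)
  pde : ∀ v ∈ Ioo 0 VF, ∀ g ∈ Ioi (0:ℝ),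
    deriv (fun v' => Jflux VE gL v' g * p v' g) v
      + deriv (fun g' => ((gin - g') / σE) * p v g') g
      - (a / σE) * deriv (deriv (fun g' => p v g')) g = 0
  bc_g : ∀ v ∈ Ioo 0 VF, (0 - gin) * p v 0 + a * deriv (fun g' => p v g') 0 = 0
  bc_v_low : ∀ g ∈ Ioo 0 (gL * VF / (VE - VF)),
    Jflux VE gL 0 g * p 0 g = 0 ∧ Jflux VE gL VF g * p VF g = 0
  bc_v_high : ∀ g ∈ Ici (gL * VF / (VE - VF)),
    Jflux VE gL 0 g * p 0 g = Jflux VE gL VF g * p VF g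
  normalized : ∫ v in Ioo 0 VF, ∫ g in Ioi (0:ℝ), p v g = 1
  decay : ∀ ε > 0, ∃ G : ℝ, ∀ g ∈ Ici G, ∀ v ∈ Ioo 0 VF,
    p v g < ε ∧ g ^ 2 * p v g < ε ∧ |deriv (fun g' => p v g') g| < ε

/-! ### The system in pointwise form -/

structure Sys (VF VE gL gin α κ : ℝ) (p pg pgg pv : ℝ → ℝ → ℝ) : Prop where
  hVF : 0 < VF
  hVE : VF < VE
  hgL : 0 < gL
  hgin : 0 < gin
  hα : 0 < α
  hκ : 0 < κ
  nonneg : ∀ v g, 0 ≤ p v g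
  pos : ∀ v ∈ Ioo 0 VF, ∀ g, 0 ≤ g → 0 < p v g
  contv : ∀ g, Continuous (fun v => p v g)
  meas : Measurable (Function.uncurry p)
  measpg : Measurable (Function.uncurry pg)
  contg : ∀ v ∈ Ioo 0 VF, Continuous (p v)
  contpg : ∀ v ∈ Ioo 0 VF, ContinuousOn (pg v) (Ici 0)
  contpgg : ∀ v ∈ Ioo 0 VF, ContinuousOn (pgg v) (Ici 0)
  hpg : ∀ v ∈ Ioo 0 VF, ∀ g, 0 ≤ g → HasDerivWithinAt (p v) (pg v g) (Ici 0) g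
  hpgg : ∀ v ∈ Ioo 0 VF, ∀ g, 0 ≤ g → HasDerivWithinAt (pg v) (pgg v g) (Ici 0) g
  hpv : ∀ v ∈ Ioo 0 VF, ∀ g, 0 < g → HasDerivAt (fun v' => p v' g) (pv v g) v
  pde : ∀ v ∈ Ioo 0 VF, ∀ g, 0 < g → Jflux VE gL v g * pv v g
    = α * pgg v g + κ * (g - gin) * pg v g + (g + gL + κ) * p v g
  bc : ∀ v ∈ Ioo 0 VF, α * pg v 0 = κ * gin * p v 0

/-- zero of the flux -/
def gJ (VE gL v : ℝ) : ℝ := gL * v / (VE - v)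

structure Cls (VE gL : ℝ) (p : ℝ → ℝ → ℝ) (G t1 t2 : ℝ) (Θ : ℝ → ℝ → ℝ → ℝ) (Θd : ℝ → ℝ → ℝ)
    (C0 δ : ℝ) : Prop where
  hδ : 0 < δ
  hδ1 : δ ≤ 1
  hG : δ < G
  hC0 : 0 ≤ C0
  bdd : ∀ v ∈ Icc t1 t2, ∀ g ∈ Icc 0 G, ∀ y, 0 ≤ y → |Θ v g y| ≤ C0
  lipv : ∀ v ∈ Icc t1 t2, ∀ v' ∈ Icc t1 t2, ∀ g ∈ Icc 0 G, ∀ y, 0 ≤ y →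
    |Θ v g y - Θ v' g y| ≤ C0 * |v - v'|
  mono : ∀ v ∈ Icc t1 t2, ∀ g ∈ Icc 0 G, ∀ y y', 0 ≤ y → y ≤ y' → Θ v g y ≤ Θ v g y'
  lipy : ∀ v ∈ Icc t1 t2, ∀ g ∈ Icc 0 G, ∀ y y', 0 ≤ y → 0 ≤ y' →
    |Θ v g y - Θ v g y'| ≤ C0 * |y - y'|
  supp : ∀ v ∈ Icc t1 t2, ∀ g ∈ Icc 0 G, G - δ ≤ g → ∀ y, 0 ≤ y → Θ v g y = 0
  meas : ∀ v ∈ Icc t1 t2, Measurable (fun g => Θ v g (p v g))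
  hasd : ∀ v ∈ Ioo t1 t2, ∀ g ∈ Ioo 0 G, HasDerivAt (fun v' => Θ v' g (p v' g)) (Θd v g) v
  intd : ∀ v ∈ Ioo t1 t2, IntervalIntegrable (fun g => Jflux VE gL v g * Θd v g) volume 0 G
  layer : ∀ v ∈ Ioo t1 t2, ∃ C η K0 : ℝ, 0 ≤ C ∧ 0 < η ∧ 0 ≤ K0 ∧ ∀ g ∈ Icc 0 G,
    |g - gJ VE gL v| ≤ η → ∀ y, 0 ≤ y → |y - p v g| ≤ η →
    |Θ v g y - Θ v g (p v g) - K0 * (y - p v g)| ≤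
      C * ((y - p v g) ^ 2 + |g - gJ VE gL v| * |y - p v g|)

def NN (VE gL : ℝ) (p : ℝ → ℝ → ℝ) (G : ℝ) (Θ : ℝ → ℝ → ℝ → ℝ) (v : ℝ) : ℝ :=
  ∫ g in (0:ℝ)..G, Jflux VE gL v g * Θ v g (p v g)

def Rd (VE gL : ℝ) (p : ℝ → ℝ → ℝ) (G : ℝ) (Θ : ℝ → ℝ → ℝ → ℝ) (Θd : ℝ → ℝ → ℝ) (v : ℝ) : ℝ :=
  ∫ g in (0:ℝ)..G, (-(g + gL) * Θ v g (p v g) + Jflux VE gL v g * Θd v g)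

def Ineq (VE gL : ℝ) (p : ℝ → ℝ → ℝ) (G x y : ℝ) : Prop :=
  ∀ Θ Θd C0 δ, Cls VE gL p G x y Θ Θd C0 δ → ∀ (b : ℝ → ℝ) (B : ℝ), Measurable b →
    (∀ v, |b v| ≤ B) → (∀ v ∈ Ioo x y, b v ≤ Rd VE gL p G Θ Θd v) →
    ∫ v in x..y, b v ≤ NN VE gL p G Θ y - NN VE gL p G Θ x

/-! ### One dimensional arguments -/

lemma chain_arg {F : ℝ → ℝ} {S : Set ℝ} {x y : ℝ} (hxy : x ≤ y) (hF : ContinuousOn F (Icc x y))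
    (hS : IsClosed (S ∩ Icc x y)) (hx : x ∈ S)
    (h : ∀ t ∈ S ∩ Ico x y, ∃ t' ∈ S ∩ Ioc t y, F t ≤ F t') : F x ≤ F y := by
  set T := (S ∩ Icc x y) ∩ {t | F x ≤ F t} with hT
  have hTc : IsCompact T := by
    have h1 : IsCompact (S ∩ Icc x y) := isCompact_Icc.of_isClosed_subset hS inter_subset_right
    have h2 : IsClosed ((S ∩ Icc x y) ∩ F ⁻¹' (Ici (F x))) :=
      (hF.mono inter_subset_right).preimage_isClosed_of_isClosed hS isClosed_Ici
    exact h1.of_isClosed_subset h2 inter_subset_left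
  have hTn : T.Nonempty := ⟨x, ⟨hx, left_mem_Icc.2 hxy⟩, le_refl (F x)⟩
  obtain ⟨s, hs⟩ := hTc.exists_isGreatest hTn
  obtain ⟨⟨⟨hsS, hs1, hs2⟩, hs3⟩, hsu⟩ := hs
  rcases hs2.lt_or_eq with hlt | heq
  · obtain ⟨t', ⟨ht1, ht2⟩, ht3⟩ := h s ⟨hsS, hs1, hlt⟩
    have : t' ≤ s := hsu ⟨⟨ht1, hs1.trans ht2.1.le, ht2.2⟩, le_trans hs3 ht3⟩
    exact absurd ht2.1 (not_lt.2 this)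
  · rw [← heq]; exact hs3

lemma sup_arg {F : ℝ → ℝ} {x y : ℝ} (hxy : x < y) (hF : ContinuousOn F (Icc x y))
    (h : ∀ t ∈ Ioo x y, ∃ t' ∈ Ioc t y, F t ≤ F t') : F x ≤ F y := by
  have key : ∀ z ∈ Ioo x y, F z ≤ F y := by
    intro z hz
    refine chain_arg (S := univ) hz.2.le (hF.mono (Icc_subset_Icc_left hz.1.le))
      (by simpa using isClosed_Icc) (mem_univ _) ?_
    rintro t ⟨-, ht⟩
    obtain ⟨t', ht', h3⟩ := h t ⟨hz.1.trans_le ht.1, ht.2⟩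
    exact ⟨t', ⟨mem_univ _, ht'⟩, h3⟩
  have hc : ContinuousWithinAt F (Ioo x y) x :=
    (hF x (left_mem_Icc.2 hxy.le)).mono Ioo_subset_Icc_self
  have : (nhdsWithin x (Ioo x y)).NeBot := by
    rw [nhdsWithin_Ioo_eq_nhdsGT hxy]; infer_instance
  exact le_of_tendsto hc (eventually_nhdsWithin_of_forall key)

/-- either isolated from the right with a next point, or accumulated -/
lemma right_alt {S : Set ℝ} {s y : ℝ} (hsy : s < y) (hy : y ∈ S)
    (hS : IsClosed (S ∩ Icc s y)) :
    (∃ b ∈ S ∩ Ioc s y, ∀ t ∈ Ioo s b, t ∉ S) ∨ (∀ ε > 0, ∃ t ∈ S ∩ Ioc s y, t < s + ε) := by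
  by_cases h : ∀ ε > 0, ∃ t ∈ S ∩ Ioc s y, t < s + ε
  · exact Or.inr h
  left
  push Not at h
  obtain ⟨ε, hε, h⟩ := h
  have hT : S ∩ Icc s y ∩ Ici (s+ε) = S ∩ Ioc s y := by
    ext t; constructor
    · rintro ⟨⟨h1, h2⟩, h3⟩
      have : s + ε ≤ t := h3
      exact ⟨h1, by linarith, h2.2⟩
    · rintro ⟨h1, h2⟩
      exact ⟨⟨h1, h2.1.le, h2.2⟩, h t ⟨h1, h2⟩⟩
  have hc : IsCompact (S ∩ Ioc s y) := by
    rw [← hT]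
    exact isCompact_Icc.of_isClosed_subset (hS.inter isClosed_Ici)
      (inter_subset_left.trans inter_subset_right)
  obtain ⟨b, hb, hbl⟩ := hc.exists_isLeast ⟨y, hy, hsy, le_refl _⟩
  refine ⟨b, hb, fun t ht htS => ?_⟩
  exact absurd (hbl ⟨htS, ht.1, ht.2.le.trans hb.2.2⟩) (not_le.2 ht.2)

lemma chain_deriv {f : ℝ → ℝ} {S : Set ℝ} {x y K : ℝ} (hxy : x ≤ y)
    (hf : ContinuousOn f (Icc x y)) (hS : IsClosed (S ∩ Icc x y)) (hx : x ∈ S) (hy : y ∈ S)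
    (hgap : ∀ a ∈ S ∩ Icc x y, ∀ b ∈ S ∩ Icc x y, a < b → (∀ t ∈ Ioo a b, t ∉ S) →
      -K * (b - a) ≤ f b - f a)
    (hd : ∀ z ∈ S ∩ Icc x y, ∃ d, -K ≤ d ∧ HasDerivAt f d z) :
    -K * (y - x) ≤ f y - f x := by
  have key : ∀ ε > 0, -(K + ε) * (y - x) ≤ f y - f x := by
    intro ε hε
    have := chain_arg (F := fun t => f t + (K + ε) * t) hxy (by fun_prop) hS hx ?_
    · nlinarith
    rintro s ⟨hsS, hs⟩
    have hcl : IsClosed (S ∩ Icc s y) := by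
      have : S ∩ Icc s y = (S ∩ Icc x y) ∩ Icc s y := by
        ext t; constructor
        · rintro ⟨h1, h2⟩; exact ⟨⟨h1, hs.1.trans h2.1, h2.2⟩, h2⟩
        · rintro ⟨h1, h2⟩; exact ⟨h1.1, h2⟩
      rw [this]; exact hS.inter isClosed_Icc
    rcases right_alt hs.2 hy hcl with ⟨b, hb, hb2⟩ | hacc
    · refine ⟨b, hb, ?_⟩
      have := hgap s ⟨hsS, hs.1, hs.2.le⟩ b ⟨hb.1, hs.1.trans hb.2.1.le, hb.2.2⟩ hb.2.1 hb2
      have := hb.2.1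
      nlinarith
    · obtain ⟨d, hd1, hd2⟩ := hd s ⟨hsS, hs.1, hs.2.le⟩
      have h1 := (hasDerivAt_iff_tendsto_slope.1 hd2).eventually
        (lt_mem_nhds (show -(K+ε) < d by linarith))
      rw [eventually_nhdsWithin_iff, Metric.eventually_nhds_iff] at h1
      obtain ⟨r, hr, h1⟩ := h1
      obtain ⟨t, ht, ht2⟩ := hacc r hr
      refine ⟨t, ht, ?_⟩
      have h3 := h1 (y := t) (by rw [Real.dist_eq, abs_of_pos] <;> linarith [ht.2.1]) (ne_of_gt ht.2.1)
      rw [slope_def_field, lt_div_iff₀ (by linarith [ht.2.1])] at h3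
      nlinarith
  by_contra hcon
  push Not at hcon
  have hpos : 0 ≤ y - x := by linarith
  have := key ((-K*(y-x) - (f y - f x)) / (2*(y - x + 1))) (by
    apply div_pos <;> linarith)
  have h2 : (-K*(y-x) - (f y - f x)) / (2*(y - x + 1)) * (y-x) ≤ (-K*(y-x) - (f y - f x))/2 := by
    rw [div_mul_eq_mul_div, div_le_div_iff₀ (by linarith) (by norm_num)]
    nlinarith
  nlinarith

lemma exists_usc {b : ℝ → ℝ} {B x y ε : ℝ} (hxy : x < y) (hb : Measurable b)
    (hB : ∀ v, |b v| ≤ B) (hε : 0 < ε) :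
    ∃ u : ℝ → ℝ, (∀ a c : ℝ, IntervalIntegrable u volume a c) ∧ (∀ t, u t < b t) ∧
      (∀ t c, u t < c → ∀ᶠ s in nhds t, u s < c) ∧
      ∫ v in x..y, b v ≤ (∫ v in x..y, u v) + ε := by
  have hint : Integrable b (volume.restrict (Ioc x y)) := by
    refine Integrable.of_bound hb.aestronglyMeasurable B (Eventually.of_forall ?_)
    intro v; simpa using hB v
  obtain ⟨g, hg1, hg2, hg3, hg4, hg5⟩ := exists_upperSemicontinuous_lt_integral_gt b hint hε
  have hbB : ∀ t, -(B+1) < b t := fun t => by have := neg_abs_le (b t); linarith [hB t]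
  set u : ℝ → ℝ := fun t => (max (g t) ((-(B+1) : ℝ) : EReal)).toReal with hu
  have hlt : ∀ t (c : ℝ), -(B+1) < c → g t < (c:EReal) → u t < c := by
    intro t c hc hgc
    have h1 : max (g t) ((-(B+1) : ℝ) : EReal) < (c : EReal) :=
      max_lt hgc (by exact_mod_cast hc)
    have h2 : max (g t) ((-(B+1) : ℝ) : EReal) ≠ ⊥ :=
      ne_of_gt (lt_of_lt_of_le (EReal.bot_lt_coe _) (le_max_right _ _))
    have h3 : max (g t) ((-(B+1) : ℝ) : EReal) ≠ ⊤ := ne_of_lt (h1.trans (EReal.coe_lt_top _))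
    rw [← EReal.coe_toReal h3 h2] at h1
    exact_mod_cast h1
  have hub : ∀ t, u t < b t := fun t => hlt t _ (hbB t) (hg1 t)
  have hcoe : ∀ t, ((u t : ℝ) : EReal) = max (g t) ((-(B+1) : ℝ) : EReal) := by
    intro t
    apply EReal.coe_toReal
    · refine ne_of_lt (max_lt ((hg1 t).trans (EReal.coe_lt_top _)) (EReal.coe_lt_top _))
    · exact ne_of_gt (lt_of_lt_of_le (EReal.bot_lt_coe _) (le_max_right _ _))
  have hlow : ∀ t, -(B+1) ≤ u t := by
    intro t
    have := le_max_right (g t) ((-(B+1) : ℝ) : EReal)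
    rw [← hcoe t] at this
    exact_mod_cast this
  have husc : ∀ t c, u t < c → ∀ᶠ s in nhds t, u s < c := by
    intro t c hc
    have h1 : g t < (c : EReal) := by
      refine lt_of_le_of_lt (le_max_left _ ((-(B+1) : ℝ) : EReal)) ?_
      rw [← hcoe t]; exact_mod_cast hc
    filter_upwards [hg2 t c h1] with s hs
    exact hlt s c (lt_of_le_of_lt (hlow t) hc) hs
  have humeas : Measurable u := by
    have : Measurable g := hg2.measurable
    exact (this.max measurable_const).ereal_toReal
  have huabs : ∀ t, ‖u t‖ ≤ B + 1 := by
    intro t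
    rw [Real.norm_eq_abs, abs_le]
    exact ⟨hlow t, by linarith [hub t, le_abs_self (b t), hB t]⟩
  have hui : ∀ a c : ℝ, IntervalIntegrable u volume a c := by
    intro a c
    rw [intervalIntegrable_iff, uIoc]
    exact Integrable.of_bound humeas.aestronglyMeasurable (B+1) (Eventually.of_forall huabs)
  refine ⟨u, hui, hub, husc, ?_⟩
  rw [intervalIntegral.integral_of_le hxy.le, intervalIntegral.integral_of_le hxy.le]
  have h6 : ∫ t in Ioc x y, (g t).toReal ≤ ∫ t in Ioc x y, u t := by
    refine integral_mono_ae hg3 ((intervalIntegrable_iff_integrableOn_Ioc_of_le hxy.le).1 (hui x y)) ?_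
    filter_upwards [hg4] with t ht
    have h7 : g t = (((g t).toReal : ℝ) : EReal) :=
      (EReal.coe_toReal (ne_of_lt ((hg1 t).trans (EReal.coe_lt_top _))) (ne_of_gt ht)).symm
    have := le_max_left (g t) ((-(B+1) : ℝ) : EReal)
    rw [← hcoe t, h7] at this
    exact_mod_cast this
  linarith

/-! ### Basic properties of the class -/

section basics
variable {VF VE gL gin α κ : ℝ} {p pg pgg pv : ℝ → ℝ → ℝ} {G t1 t2 C0 δ : ℝ}
  {Θ : ℝ → ℝ → ℝ → ℝ} {Θd : ℝ → ℝ → ℝ}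

lemma Cls.restrict (h : Cls VE gL p G t1 t2 Θ Θd C0 δ) {s1 s2 : ℝ} (h1 : t1 ≤ s1) (h2 : s2 ≤ t2) :
    Cls VE gL p G s1 s2 Θ Θd C0 δ := by
  have hI : Icc s1 s2 ⊆ Icc t1 t2 := Icc_subset_Icc h1 h2
  have hJ : Ioo s1 s2 ⊆ Ioo t1 t2 := Ioo_subset_Ioo h1 h2
  exact ⟨h.hδ, h.hδ1, h.hG, h.hC0, fun v hv => h.bdd v (hI hv),
    fun v hv v' hv' => h.lipv v (hI hv) v' (hI hv'), fun v hv => h.mono v (hI hv),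
    fun v hv => h.lipy v (hI hv), fun v hv => h.supp v (hI hv), fun v hv => h.meas v (hI hv),
    fun v hv => h.hasd v (hJ hv), fun v hv => h.intd v (hJ hv), fun v hv => h.layer v (hJ hv)⟩

lemma Jflux_cont (VE gL : ℝ) : Continuous (fun x : ℝ × ℝ => Jflux VE gL x.1 x.2) := by
  unfold Jflux; fun_prop

lemma Jflux_contg (VE gL v : ℝ) : Continuous (fun g => Jflux VE gL v g) := by
  unfold Jflux; fun_prop

lemma Jflux_contv (VE gL g : ℝ) : Continuous (fun v => Jflux VE gL v g) := by
  unfold Jflux; fun_prop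

lemma Jflux_eq {VE gL v : ℝ} (g : ℝ) (hv : v < VE) :
    Jflux VE gL v g = (VE - v) * (g - gJ VE gL v) := by
  unfold Jflux gJ
  have : VE - v ≠ 0 := by linarith
  field_simp
  ring

/-- uniform bound of the flux -/
lemma Jflux_bd {VF VE gL G : ℝ} (hVF : 0 < VF) (hVE : VF < VE) (hgL : 0 < gL) :
    ∃ M : ℝ, 0 < M ∧ ∀ v ∈ Icc 0 VF, ∀ g ∈ Icc 0 G, |Jflux VE gL v g| ≤ M := by
  have hVE0 : 0 < VE := hVF.trans hVE
  refine ⟨gL * VF + |G| * VE + 1, by positivity, fun v hv g hg => ?_⟩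
  unfold Jflux
  have h1 : gL * v ≤ gL * VF := by nlinarith [hv.2]
  have h0 : 0 ≤ gL * v := mul_nonneg hgL.le hv.1
  have h2 : g * (VE - v) ≤ |G| * VE := by
    have := le_abs_self G
    apply mul_le_mul <;> linarith [hg.1, hg.2, hv.1, hv.2, abs_nonneg G]
  have h3 : 0 ≤ g * (VE - v) := mul_nonneg hg.1 (by linarith [hv.2])
  have h4 : 0 ≤ |G| * VE := by have := abs_nonneg G; nlinarith
  rw [abs_le]; constructor <;> linarith

lemma NN_intable (S : Sys VF VE gL gin α κ p pg pgg pv) (h : Cls VE gL p G t1 t2 Θ Θd C0 δ)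
    {v : ℝ} (hv : v ∈ Icc t1 t2) :
    IntervalIntegrable (fun g => Jflux VE gL v g * Θ v g (p v g)) volume 0 G := by
  have hG : (0:ℝ) ≤ G := h.hδ.le.trans h.hG.le
  have : IntervalIntegrable (fun g => Θ v g (p v g)) volume 0 G := by
    rw [intervalIntegrable_iff_integrableOn_Ioc_of_le hG]
    refine Integrable.of_bound (h.meas v hv).aestronglyMeasurable C0 ?_
    filter_upwards [ae_restrict_mem measurableSet_Ioc] with g hg
    exact h.bdd v hv g (Ioc_subset_Icc_self hg) _ (S.nonneg _ _)
  exact this.continuousOn_mul (Jflux_contg VE gL v).continuousOn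

lemma Th_intable (S : Sys VF VE gL gin α κ p pg pgg pv) (h : Cls VE gL p G t1 t2 Θ Θd C0 δ)
    {v : ℝ} (hv : v ∈ Icc t1 t2) :
    IntervalIntegrable (fun g => Θ v g (p v g)) volume 0 G := by
  have hG : (0:ℝ) ≤ G := h.hδ.le.trans h.hG.le
  rw [intervalIntegrable_iff_integrableOn_Ioc_of_le hG]
  refine Integrable.of_bound (h.meas v hv).aestronglyMeasurable C0 ?_
  filter_upwards [ae_restrict_mem measurableSet_Ioc] with g hg
  exact h.bdd v hv g (Ioc_subset_Icc_self hg) _ (S.nonneg _ _)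

lemma Rd_intable (S : Sys VF VE gL gin α κ p pg pgg pv) (h : Cls VE gL p G t1 t2 Θ Θd C0 δ)
    {v : ℝ} (hv : v ∈ Ioo t1 t2) :
    IntervalIntegrable (fun g => -(g + gL) * Θ v g (p v g) + Jflux VE gL v g * Θd v g)
      volume 0 G :=
  ((Th_intable S h (Ioo_subset_Icc_self hv)).continuousOn_mul
    (by fun_prop)).add (h.intd v hv)

lemma Th_contv (S : Sys VF VE gL gin α κ p pg pgg pv) (h : Cls VE gL p G t1 t2 Θ Θd C0 δ)
    {g : ℝ} (hg : g ∈ Icc 0 G) : ContinuousOn (fun v => Θ v g (p v g)) (Icc t1 t2) := by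
  intro v hv
  have hp : Tendsto (fun v' => C0 * |v' - v| + C0 * |p v' g - p v g|) (nhdsWithin v (Icc t1 t2))
      (nhds 0) := by
    have : Continuous (fun v' => C0 * |v' - v| + C0 * |p v' g - p v g|) := by
      have := S.contv g
      fun_prop
    have h2 := (this.tendsto v).mono_left (nhdsWithin_le_nhds (s := Icc t1 t2))
    simpa using h2
  rw [ContinuousWithinAt, tendsto_iff_norm_sub_tendsto_zero]
  refine squeeze_zero' (Eventually.of_forall fun _ => norm_nonneg _) ?_ hp
  filter_upwards [self_mem_nhdsWithin] with v' hv'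
  have e1 := h.lipv v' hv' v hv g hg (p v' g) (S.nonneg _ _)
  have e2 := h.lipy v hv g hg (p v' g) (p v g) (S.nonneg _ _) (S.nonneg _ _)
  calc ‖Θ v' g (p v' g) - Θ v g (p v g)‖
      = |(Θ v' g (p v' g) - Θ v g (p v' g)) + (Θ v g (p v' g) - Θ v g (p v g))| := by
        rw [Real.norm_eq_abs]; congr 1; ring
    _ ≤ _ := (abs_add_le _ _).trans (add_le_add e1 e2)

lemma NN_cont (S : Sys VF VE gL gin α κ p pg pgg pv) (h : Cls VE gL p G t1 t2 Θ Θd C0 δ)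
    (h1 : 0 ≤ t1) (h2 : t2 ≤ VF) : ContinuousOn (NN VE gL p G Θ) (Icc t1 t2) := by
  have hG : (0:ℝ) ≤ G := h.hδ.le.trans h.hG.le
  obtain ⟨M, hM, hJ⟩ := Jflux_bd (G := G) S.hVF S.hVE S.hgL
  intro v hv
  unfold NN
  refine intervalIntegral.continuousWithinAt_of_dominated_interval (bound := fun _ => M * C0)
    ?_ ?_ ?_ ?_
  · filter_upwards [self_mem_nhdsWithin] with v' hv'
    exact ((Jflux_contg VE gL v').measurable.mul (h.meas v' hv')).aestronglyMeasurable
  · filter_upwards [self_mem_nhdsWithin] with v' hv'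
    refine Eventually.of_forall fun g hg => ?_
    rw [uIoc_of_le hG] at hg
    have hg' := Ioc_subset_Icc_self hg
    rw [norm_mul]
    exact mul_le_mul (hJ v' ⟨h1.trans hv'.1, hv'.2.trans h2⟩ g hg')
      (h.bdd v' hv' g hg' _ (S.nonneg _ _)) (norm_nonneg _) hM.le
  · exact intervalIntegrable_const
  · refine Eventually.of_forall fun g hg => ?_
    rw [uIoc_of_le hG] at hg
    exact ((Jflux_contv VE gL g).continuousWithinAt).mul
      (Th_contv S h (Ioc_subset_Icc_self hg) v hv)

def Good (VE gL : ℝ) (p : ℝ → ℝ → ℝ) (G v : ℝ) : Prop :=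
  ∃ ε > 0, ∀ x y, v - ε < x → x < y → y < v + ε → Ineq VE gL p G x y

lemma bint {b : ℝ → ℝ} {B : ℝ} (hb : Measurable b) (hB : ∀ v, |b v| ≤ B) (a c : ℝ) :
    IntervalIntegrable b volume a c := by
  rw [intervalIntegrable_iff, uIoc]
  exact Integrable.of_bound hb.aestronglyMeasurable B (Eventually.of_forall fun v => by
    simpa using hB v)

lemma gap_ineq (S : Sys VF VE gL gin α κ p pg pgg pv) {x y : ℝ} (hx : 0 ≤ x) (hxy : x < y)
    (hy : y ≤ VF) (hg : ∀ t ∈ Ioo x y, Good VE gL p G t) : Ineq VE gL p G x y := by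
  intro Θ Θd C0 δ h b B hb hB hR
  have hbi := bint hb hB
  have := sup_arg (F := fun t => NN VE gL p G Θ t - ∫ v in x..t, b v) hxy ?_ ?_
  · simp only [intervalIntegral.integral_same] at this; linarith
  · refine (NN_cont S h hx hy).sub ?_
    exact (intervalIntegral.continuous_primitive hbi x).continuousOn
  · intro t ht
    obtain ⟨ε, hε, hI⟩ := hg t ht
    have hm : t < min y (t + ε/2) := lt_min ht.2 (by linarith)
    refine ⟨min y (t + ε/2), ⟨hm, min_le_left _ _⟩, ?_⟩
    have h1 := hI t _ (by linarith) hm (lt_of_le_of_lt (min_le_right _ _) (by linarith))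
      Θ Θd C0 δ (h.restrict ht.1.le (min_le_left _ _)) b B hb hB
      (fun v hv => hR v ⟨ht.1.trans hv.1, hv.2.trans_le (min_le_left _ _)⟩)
    have h2 := intervalIntegral.integral_add_adjacent_intervals (hbi x t) (hbi t (min y (t+ε/2)))
    linarith

end basics

section vn
variable {VF VE gL gin α κ : ℝ} {p pg pgg pv : ℝ → ℝ → ℝ} {G n : ℝ}

def Vn (VF : ℝ) (p pg pgg : ℝ → ℝ → ℝ) (G n v : ℝ) : Prop :=
  v ∈ Ioo 0 VF ∧ ∀ g ∈ Icc 0 G, p v g ≤ n ∧ |pg v g| ≤ n ∧ |pgg v g| ≤ n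

lemma Sys.hpg' (S : Sys VF VE gL gin α κ p pg pgg pv) {v g : ℝ} (hv : v ∈ Ioo 0 VF) (hg : 0 < g) :
    HasDerivAt (p v) (pg v g) g := (S.hpg v hv g hg.le).hasDerivAt (Ici_mem_nhds hg)

lemma Sys.hpgg' (S : Sys VF VE gL gin α κ p pg pgg pv) {v g : ℝ} (hv : v ∈ Ioo 0 VF) (hg : 0 < g) :
    HasDerivAt (pg v) (pgg v g) g := (S.hpgg v hv g hg.le).hasDerivAt (Ici_mem_nhds hg)

lemma Vn.lip (S : Sys VF VE gL gin α κ p pg pgg pv) {v : ℝ} (h : Vn VF p pg pgg G n v)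
    {x y : ℝ} (hx : x ∈ Icc 0 G) (hy : y ∈ Icc 0 G) : |p v y - p v x| ≤ n * |y - x| :=
  (convex_Icc 0 G).norm_image_sub_le_of_norm_hasDerivWithin_le
    (fun z hz => (S.hpg v h.1 z hz.1).mono Icc_subset_Ici_self) (fun z hz => (h.2 z hz).2.1) hx hy

lemma Vn.lipg (S : Sys VF VE gL gin α κ p pg pgg pv) {v : ℝ} (h : Vn VF p pg pgg G n v)
    {x y : ℝ} (hx : x ∈ Icc 0 G) (hy : y ∈ Icc 0 G) : |pg v y - pg v x| ≤ n * |y - x| :=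
  (convex_Icc 0 G).norm_image_sub_le_of_norm_hasDerivWithin_le
    (fun z hz => (S.hpgg v h.1 z hz.1).mono Icc_subset_Ici_self) (fun z hz => (h.2 z hz).2.2) hx hy

lemma Vn.taylor (S : Sys VF VE gL gin α κ p pg pgg pv) {v : ℝ} (h : Vn VF p pg pgg G n v)
    {x y : ℝ} (hx : x ∈ Icc 0 G) (hy : y ∈ Icc 0 G) :
    |p v y - p v x - pg v x * (y - x)| ≤ n * |y - x| * |y - x| := by
  have hsub : uIcc x y ⊆ Icc 0 G := uIcc_subset_Icc hx hy
  have hn : 0 ≤ n := (abs_nonneg _).trans (h.2 x hx).2.1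
  have := (convex_uIcc x y).norm_image_sub_le_of_norm_hasDerivWithin_le
    (f := fun z => p v z - pg v x * z) (f' := fun z => pg v z - pg v x * 1) (C := n * |y - x|)
    (fun z hz => ((S.hpg v h.1 z (hsub hz).1).mono (hsub.trans Icc_subset_Ici_self)).sub
      ((hasDerivWithinAt_id z _).const_mul _)) (fun z hz => ?_) left_mem_uIcc right_mem_uIcc
  · simp only [Real.norm_eq_abs] at this
    calc _ = |p v y - pg v x * y - (p v x - pg v x * x)| := by congr 1; ring
      _ ≤ _ := this
  · have h1 := h.lipg S hx (hsub hz)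
    rw [mul_one]
    refine h1.trans (mul_le_mul_of_nonneg_left ?_ hn)
    exact abs_sub_left_of_mem_uIcc hz

lemma Vn_iff (S : Sys VF VE gL gin α κ p pg pgg pv) (hG : 0 < G) {v : ℝ} (hv : v ∈ Ioo 0 VF) :
    Vn VF p pg pgg G n v ↔ (0 ≤ n ∧ (∀ g ∈ Icc 0 G, p v g ≤ n) ∧
      (∀ x ∈ Icc 0 G, ∀ y ∈ Icc 0 G, |p v y - p v x| ≤ n * |y - x|) ∧
      (∀ x y t, 0 ≤ x → 0 ≤ y → 0 ≤ t → x + t ≤ G → y + t ≤ G →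
        |(p v (y + t) - p v y) - (p v (x + t) - p v x)| ≤ n * t * |y - x|)) := by
  constructor
  · intro h
    have hn : 0 ≤ n := (abs_nonneg _).trans (h.2 0 ⟨le_refl _, hG.le⟩).2.1
    refine ⟨hn, fun g hg => (h.2 g hg).1, fun x hx y hy => h.lip S hx hy, ?_⟩
    intro x y t hx hy ht hxt hyt
    refine (convex_Icc 0 (G - t)).norm_image_sub_le_of_norm_hasDerivWithin_le
      (f := fun z => p v (z + t) - p v z) (f' := fun z => pg v (z + t) - pg v z)
      (fun z hz => ?_) (fun z hz => ?_) ⟨hx, by linarith⟩ ⟨hy, by linarith⟩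
    · refine HasDerivWithinAt.sub ?_ ((S.hpg v hv z hz.1).mono Icc_subset_Ici_self)
      have h1 := S.hpg v hv (z + t) (by linarith [hz.1])
      have h2 : HasDerivWithinAt (fun z => z + t) 1 (Icc 0 (G - t)) z :=
        (hasDerivWithinAt_id z _).add_const t
      have := h1.scomp z h2 (fun w hw => by simp only [mem_Ici]; linarith [hw.1])
      simpa [Function.comp_def] using this
    · have := h.lipg S (x := z) (y := z + t) ⟨hz.1, by linarith [hz.2]⟩
        ⟨by linarith [hz.1], by linarith [hz.2]⟩
      simpa [abs_of_nonneg ht] using this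
  · rintro ⟨hn, h1, h2, h3⟩
    have hcl : closure (Ioo 0 G) = Icc 0 G := closure_Ioo hG.ne
    have hpgb : ∀ g ∈ Ioo 0 G, |pg v g| ≤ n := by
      intro g hg
      refine (S.hpg' hv hg.1).le_of_lip' hn ?_
      filter_upwards [Ioo_mem_nhds hg.1 hg.2] with y hy
      exact h2 g (Ioo_subset_Icc_self hg) y (Ioo_subset_Icc_self hy)
    have hpgl : ∀ x ∈ Ioo 0 G, ∀ y ∈ Ioo 0 G, |pg v y - pg v x| ≤ n * |y - x| := by
      intro x hx y hy
      have e1 := (S.hpg' hv hx.1).tendsto_slope_zero_right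
      have e2 := (S.hpg' hv hy.1).tendsto_slope_zero_right
      refine le_of_tendsto (e2.sub e1).abs ?_
      have : Ioo 0 (min (G - x) (G - y)) ∈ nhdsWithin (0:ℝ) (Ioi 0) :=
        Ioo_mem_nhdsGT (lt_min (by linarith [hx.2]) (by linarith [hy.2]))
      filter_upwards [this] with t ht
      have ht1 := ht.2.trans_le (min_le_left _ _)
      have ht2 := ht.2.trans_le (min_le_right _ _)
      have := h3 x y t hx.1.le hy.1.le ht.1.le (by linarith) (by linarith)
      have e3 : t⁻¹ • (p v (y + t) - p v y) - t⁻¹ • (p v (x + t) - p v x)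
        = ((p v (y + t) - p v y) - (p v (x + t) - p v x)) / t := by
        simp only [smul_eq_mul]; field_simp
      rw [e3, abs_div, abs_of_pos ht.1, div_le_iff₀ ht.1]
      linarith
    have hpggb : ∀ g ∈ Ioo 0 G, |pgg v g| ≤ n := by
      intro g hg
      refine (S.hpgg' hv hg.1).le_of_lip' hn ?_
      filter_upwards [Ioo_mem_nhds hg.1 hg.2] with y hy
      exact hpgl g hg y hy
    refine ⟨hv, fun g hg => ⟨h1 g hg, ?_, ?_⟩⟩
    · refine le_on_closure (s := Ioo 0 G) (f := fun g => |pg v g|) hpgb ?_ continuousOn_const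
        (hcl ▸ hg)
      rw [hcl]; exact ((S.contpg v hv).mono Icc_subset_Ici_self).abs
    · refine le_on_closure (s := Ioo 0 G) (f := fun g => |pgg v g|) hpggb ?_ continuousOn_const
        (hcl ▸ hg)
      rw [hcl]; exact ((S.contpgg v hv).mono Icc_subset_Ici_self).abs

lemma Vn_closed (S : Sys VF VE gL gin α κ p pg pgg pv) (hG : 0 < G) {a b : ℝ} (ha : 0 < a)
    (hb : b < VF) : IsClosed {v | v ∈ Icc a b ∧ Vn VF p pg pgg G n v} := by
  have : {v | v ∈ Icc a b ∧ Vn VF p pg pgg G n v} = Icc a b ∩ ({v | 0 ≤ n} ∩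
      ({v | ∀ g ∈ Icc 0 G, p v g ≤ n} ∩
      ({v | ∀ x ∈ Icc 0 G, ∀ y ∈ Icc 0 G, |p v y - p v x| ≤ n * |y - x|} ∩
      {v | ∀ x y t, 0 ≤ x → 0 ≤ y → 0 ≤ t → x + t ≤ G → y + t ≤ G →
        |(p v (y + t) - p v y) - (p v (x + t) - p v x)| ≤ n * t * |y - x|}))) := by
    ext v
    constructor
    · rintro ⟨h1, h2⟩
      exact ⟨h1, (Vn_iff S hG h2.1).1 h2⟩
    · rintro ⟨h1, h2⟩
      have hv : v ∈ Ioo 0 VF := ⟨by linarith [h1.1], by linarith [h1.2]⟩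
      exact ⟨h1, (Vn_iff S hG hv).2 h2⟩
  rw [this]
  refine isClosed_Icc.inter (isClosed_const.inter (IsClosed.inter ?_ (IsClosed.inter ?_ ?_)))
  · simp only [ofPred_forall]
    exact isClosed_iInter fun g => isClosed_iInter fun _ => isClosed_le (S.contv g) continuous_const
  · simp only [ofPred_forall]
    exact isClosed_iInter fun x => isClosed_iInter fun _ => isClosed_iInter fun y =>
      isClosed_iInter fun _ => isClosed_le ((S.contv y).sub (S.contv x)).abs continuous_const
  · simp only [ofPred_forall]
    exact isClosed_iInter fun x => isClosed_iInter fun y => isClosed_iInter fun t =>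
      isClosed_iInter fun _ => isClosed_iInter fun _ => isClosed_iInter fun _ =>
      isClosed_iInter fun _ => isClosed_iInter fun _ => isClosed_le
        (((S.contv _).sub (S.contv _)).sub ((S.contv _).sub (S.contv _))).abs continuous_const

lemma Vn_exists (S : Sys VF VE gL gin α κ p pg pgg pv) {v : ℝ} (hv : v ∈ Ioo 0 VF) :
    ∃ n : ℕ, Vn VF p pg pgg G n v := by
  have hb : ∀ f : ℝ → ℝ, ContinuousOn f (Ici 0) → ∃ C, ∀ g ∈ Icc 0 G, |f g| ≤ C := by
    intro f hf
    obtain ⟨C, hC⟩ := isCompact_Icc.exists_bound_of_continuousOn (hf.mono (Icc_subset_Ici_self : Icc 0 G ⊆ Ici 0))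
    exact ⟨C, hC⟩
  obtain ⟨C1, h1⟩ := hb _ (S.contg v hv).continuousOn
  obtain ⟨C2, h2⟩ := hb _ (S.contpg v hv)
  obtain ⟨C3, h3⟩ := hb _ (S.contpgg v hv)
  obtain ⟨n, hn⟩ := exists_nat_ge (max C1 (max C2 C3))
  have hn1 := (le_max_left _ _).trans hn
  have hn2 := ((le_max_left _ _).trans (le_max_right _ _)).trans hn
  have hn3 := ((le_max_right _ _).trans (le_max_right _ _)).trans hn
  exact ⟨n, hv, fun g hg => ⟨(le_abs_self _).trans ((h1 g hg).trans hn1), (h2 g hg).trans hn2,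
    (h3 g hg).trans hn3⟩⟩

def ZZ (VF VE gL : ℝ) (p : ℝ → ℝ → ℝ) (G : ℝ) : Set ℝ := {v | v ∈ Ioo 0 VF ∧ ¬ Good VE gL p G v}

lemma Good_open : IsOpen {v | Good VE gL p G v} := by
  rw [Metric.isOpen_iff]
  rintro v ⟨ε, hε, h⟩
  refine ⟨ε/2, by linarith, fun w hw => ⟨ε/2, by linarith, fun x y hx hxy hy => ?_⟩⟩
  rw [Metric.mem_ball, Real.dist_eq, abs_lt] at hw
  exact h x y (by linarith [hw.1]) hxy (by linarith [hw.2])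

lemma ZZ_closed {a b : ℝ} (ha : 0 < a) (hb : b < VF) : IsClosed (ZZ VF VE gL p G ∩ Icc a b) := by
  have : ZZ VF VE gL p G ∩ Icc a b = {v | Good VE gL p G v}ᶜ ∩ Icc a b := by
    ext v; constructor
    · rintro ⟨h1, h2⟩; exact ⟨h1.2, h2⟩
    · rintro ⟨h1, h2⟩; exact ⟨⟨⟨by linarith [h2.1], by linarith [h2.2]⟩, h1⟩, h2⟩
  rw [this]
  exact Good_open.isClosed_compl.inter isClosed_Icc

lemma baire_portion (S : Sys VF VE gL gin α κ p pg pgg pv) (hG : 0 < G)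
    (hne : (ZZ VF VE gL p G).Nonempty) :
    ∃ (n : ℕ) (i1 i2 : ℝ), 0 < i1 ∧ i2 < VF ∧ (∃ z ∈ ZZ VF VE gL p G, z ∈ Ioo i1 i2) ∧
      ∀ z ∈ ZZ VF VE gL p G, z ∈ Ioo i1 i2 → Vn VF p pg pgg G n z := by
  obtain ⟨z0, hz0⟩ := hne
  have hz := hz0.1
  set a := z0 / 2 with ha
  set b := (z0 + VF) / 2 with hb
  have ha0 : 0 < a := by have := hz.1; positivity
  have hbV : b < VF := by have := hz.2; linarith
  have haz : a < z0 := by have := hz.1; linarith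
  have hzb : z0 < b := by have := hz.2; linarith
  set K := ZZ VF VE gL p G ∩ Icc a b with hK
  have hKc : IsClosed K := ZZ_closed ha0 hbV
  have : CompleteSpace K := hKc.completeSpace_coe
  let f : ℕ → Set K := fun n => {x | Vn VF p pg pgg G n x.1}
  have hf : ∀ n, IsClosed (f n) := by
    intro n
    have h1 := (Vn_closed (n := (n:ℝ)) S hG ha0 hbV).preimage (continuous_subtype_val (p := (· ∈ K)))
    have : f n = Subtype.val ⁻¹' {v | v ∈ Icc a b ∧ Vn VF p pg pgg G n v} := by
      ext x; exact ⟨fun h => ⟨x.2.2, h⟩, fun h => h.2⟩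
    rw [this]; exact h1
  have hU : ⋃ n, f n = univ := by
    ext x; simp only [mem_iUnion, mem_univ, iff_true]
    exact Vn_exists S x.2.1.1
  have hd := dense_iUnion_interior_of_closed hf hU
  have hO : IsOpen (Subtype.val ⁻¹' (Ioo a b) : Set K) := isOpen_Ioo.preimage continuous_subtype_val
  obtain ⟨x, hx1, hx2⟩ := hd.inter_open_nonempty _ hO ⟨⟨z0, hz0, haz.le, hzb.le⟩, haz, hzb⟩
  rw [mem_iUnion] at hx2
  obtain ⟨n, hx2⟩ := hx2
  rw [mem_interior_iff_mem_nhds, Metric.mem_nhds_iff] at hx2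
  obtain ⟨r, hr, hball⟩ := hx2
  refine ⟨n, max a (x.1 - r), min b (x.1 + r), lt_max_of_lt_left ha0, min_lt_of_left_lt hbV,
    ⟨x.1, x.2.1, max_lt hx1.1 (by linarith), lt_min hx1.2 (by linarith)⟩, ?_⟩
  intro z hzZ hzI
  have h1 := (le_max_left _ _).trans_lt hzI.1
  have h2 := (le_max_right _ _).trans_lt hzI.1
  have h3 := hzI.2.trans_le (min_le_left _ _)
  have h4 := hzI.2.trans_le (min_le_right _ _)
  have hzK : z ∈ K := ⟨hzZ, h1.le, h3.le⟩
  have hzb : (⟨z, hzK⟩ : K) ∈ Metric.ball x r := by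
    rw [Metric.mem_ball, Subtype.dist_eq, Real.dist_eq, abs_lt]
    constructor <;> linarith
  exact hball hzb

end vn

lemma hasDerivAt_max_pow (k : ℕ) (x : ℝ) :
    HasDerivAt (fun x : ℝ => (max x 0) ^ (k + 2)) ((k + 2 : ℕ) * (max x 0) ^ (k + 1)) x := by
  rcases lt_trichotomy x 0 with hx | hx | hx
  · have h1 : HasDerivAt (fun _ : ℝ => (0:ℝ)) 0 x := hasDerivAt_const x 0
    rw [max_eq_right hx.le, zero_pow (by omega), mul_zero]
    refine h1.congr_of_eventuallyEq ?_
    filter_upwards [Iio_mem_nhds hx] with y hy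
    simp [max_eq_right (le_of_lt (show y < 0 from hy))]
  · subst hx
    rw [max_self, zero_pow (by omega), mul_zero]
    rw [← hasDerivWithinAt_univ, ← Iic_union_Ici (a := (0:ℝ))]
    refine HasDerivWithinAt.union ?_ ?_
    · refine (hasDerivWithinAt_const (0:ℝ) _ (0:ℝ)).congr ?_ (by simp)
      intro y hy
      simp [max_eq_right (show y ≤ 0 from hy)]
    · have := (hasDerivAt_pow (k+2) (0:ℝ)).hasDerivWithinAt (s := Ici 0)
      refine (this.congr (f₁ := fun x : ℝ => (max x 0) ^ (k + 2)) ?_ (by simp)).congr_deriv ?_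
      · intro y hy
        simp [max_eq_left (show 0 ≤ y from hy)]
      · have : k + 2 - 1 = k + 1 := rfl
        rw [this, zero_pow (by omega), mul_zero]
  · have h1 := hasDerivAt_pow (k+2) x
    rw [max_eq_left hx.le]
    refine h1.congr_of_eventuallyEq ?_
    filter_upwards [Ioi_mem_nhds hx] with y hy
    simp [max_eq_left (le_of_lt (show 0 < y from hy))]

lemma cube_lip {n a b : ℝ} (ha : 0 ≤ a) (hb : 0 ≤ b) (han : a ≤ n) (hbn : b ≤ n) :
    |a ^ 3 - b ^ 3| ≤ 3 * n ^ 2 * |a - b| := by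
  have h : a ^ 3 - b ^ 3 = (a ^ 2 + a * b + b ^ 2) * (a - b) := by ring
  rw [h, abs_mul, abs_of_nonneg (by positivity)]
  refine mul_le_mul_of_nonneg_right ?_ (abs_nonneg _)
  nlinarith [mul_le_mul han hbn hb (ha.trans han), mul_le_mul han han ha (ha.trans han),
    mul_le_mul hbn hbn hb (ha.trans han)]

section box
variable (p : ℝ → ℝ → ℝ) (vs σ B n μ R g0 : ℝ)

def YY (s g : ℝ) : ℝ := ((g - g0) ^ 2 + μ * (σ * (s - vs))) / R ^ 2
def PP (s g : ℝ) : ℝ := p vs g - B * (σ * (s - vs)) - n * (YY vs σ μ R g0 s g) ^ 5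
def ThB (s g y : ℝ) : ℝ := -(max (PP p vs σ B n μ R g0 s g - y) 0) ^ 3
def ThBd (pv : ℝ → ℝ → ℝ) (s g : ℝ) : ℝ := -(3 * (max (PP p vs σ B n μ R g0 s g - p s g) 0) ^ 2 *
  (-σ * (B + 5 * n * μ / R ^ 2 * (YY vs σ μ R g0 s g) ^ 4) - pv s g))
end box

/-- data for the box comparison -/
structure BoxD (VF VE gL gin α κ : ℝ) (p pg pgg pv : ℝ → ℝ → ℝ)
    (G n v1 v2 vs ve σ d δ g0 B μ R : ℝ) : Prop where
  S : Sys VF VE gL gin α κ p pg pgg pv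
  hV : Vn VF p pg pgg G n vs
  h1 : 0 ≤ v1
  h12 : v1 < v2
  h2 : v2 ≤ VF
  hc : (σ = 1 ∧ vs = v1 ∧ ve = v2) ∨ (σ = -1 ∧ vs = v2 ∧ ve = v1)
  hd : 0 < d
  hdδ : d ≤ δ
  hδ1 : δ ≤ 1
  hδG : δ < G
  hg0 : 0 ≤ g0
  hg0G : g0 ≤ G - δ
  hdist : ∀ s ∈ Icc v1 v2, d ≤ σ * (g0 - gJ VE gL s)
  hB : B = 2 * n * (α + κ * (G + gin)) / ((VE - VF) * d)
  hμ : μ = (36 * α + 4 * (κ * (G + gin))) / ((VE - VF) * d)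
  hR : R = d / 2

namespace BoxD
variable {VF VE gL gin α κ : ℝ} {p pg pgg pv : ℝ → ℝ → ℝ}
    {G n v1 v2 vs ve σ d δ g0 B μ R : ℝ}
    (D : BoxD VF VE gL gin α κ p pg pgg pv G n v1 v2 vs ve σ d δ g0 B μ R)
include D

lemma hn : 0 ≤ n := (abs_nonneg _).trans (D.hV.2 0 ⟨le_refl _, by linarith [D.hδG, D.hd, D.hdδ]⟩).2.1
lemma hG : 0 < G := by linarith [D.hδG, D.hd, D.hdδ]
lemma hRp : 0 < R := by rw [D.hR]; linarith [D.hd]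
lemma hR1 : R ≤ 1 := by rw [D.hR]; linarith [D.hdδ, D.hδ1, D.hd]
lemma hcm : 0 < κ * (G + gin) := mul_pos D.S.hκ (add_pos D.hG D.S.hgin)
lemma hm : 0 < VE - VF := by linarith [D.S.hVE]
lemma hBp : 0 ≤ B := by
  rw [D.hB]
  have := D.hn; have := D.hm; have := D.hd; have := D.hcm; have := D.S.hα
  positivity
lemma hμp : 0 < μ := by
  rw [D.hμ]
  have := D.hm; have := D.hd; have := D.hcm; have := D.S.hα
  positivity
lemma hσ : σ * σ = 1 := by rcases D.hc with h | h <;> rw [h.1] <;> norm_num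
lemma hσa : |σ| = 1 := by rcases D.hc with h | h <;> rw [h.1] <;> norm_num
lemma hτ {s : ℝ} (hs : s ∈ Icc v1 v2) : 0 ≤ σ * (s - vs) := by
  rcases D.hc with ⟨h, h', _⟩ | ⟨h, h', _⟩ <;> rw [h, h'] <;> linarith [hs.1, hs.2]
lemma hτV {s : ℝ} (hs : s ∈ Icc v1 v2) : σ * (s - vs) ≤ VF := by
  rcases D.hc with ⟨h, h', _⟩ | ⟨h, h', _⟩ <;> rw [h, h'] <;> linarith [hs.1, hs.2, D.h1, D.h2]
lemma hvs : vs ∈ Icc v1 v2 := by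
  rcases D.hc with ⟨h, h', _⟩ | ⟨h, h', _⟩ <;> rw [h'] <;> simp [D.h12.le]
lemma hve : ve ∈ Icc v1 v2 := by
  rcases D.hc with ⟨h, _, h'⟩ | ⟨h, _, h'⟩ <;> rw [h'] <;> simp [D.h12.le]

lemma Y0 {s : ℝ} (hs : s ∈ Icc v1 v2) (g : ℝ) : (g - g0) ^ 2 / R ^ 2 ≤ YY vs σ μ R g0 s g := by
  have := D.hRp
  unfold YY
  gcongr
  have := mul_nonneg D.hμp.le (D.hτ hs)
  linarith
lemma Ynn {s : ℝ} (hs : s ∈ Icc v1 v2) (g : ℝ) : 0 ≤ YY vs σ μ R g0 s g :=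
  le_trans (by positivity) (D.Y0 hs g)
lemma Pn {s g : ℝ} (hs : s ∈ Icc v1 v2) (hg : g ∈ Icc 0 G) :
    PP p vs σ B n μ R g0 s g ≤ n - n * (YY vs σ μ R g0 s g) ^ 5 := by
  unfold PP
  have := mul_nonneg D.hBp (D.hτ hs)
  linarith [(D.hV.2 g hg).1]
lemma Pn' {s g : ℝ} (hs : s ∈ Icc v1 v2) (hg : g ∈ Icc 0 G) :
    PP p vs σ B n μ R g0 s g ≤ n := by
  have := D.Pn hs hg
  have h2 := mul_nonneg D.hn (pow_nonneg (D.Ynn hs g) 5)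
  linarith
lemma Pneg {s g : ℝ} (hs : s ∈ Icc v1 v2) (hg : g ∈ Icc 0 G) (h : R ≤ |g - g0|) :
    PP p vs σ B n μ R g0 s g ≤ 0 := by
  have h1 := D.Pn hs hg
  have h2 : 1 ≤ (g - g0) ^ 2 / R ^ 2 := by
    have := D.hRp
    rw [le_div_iff₀ (by positivity), one_mul, ← sq_abs (g - g0)]
    exact pow_le_pow_left₀ this.le h 2
  have h3 : 1 ≤ (YY vs σ μ R g0 s g) ^ 5 := one_le_pow₀ (h2.trans (D.Y0 hs g))
  nlinarith [D.hn]
lemma Th0 {s g y : ℝ} (hs : s ∈ Icc v1 v2) (hg : g ∈ Icc 0 G) (h : R ≤ |g - g0|) (hy : 0 ≤ y) :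
    ThB p vs σ B n μ R g0 s g y = 0 := by
  unfold ThB
  have := D.Pneg hs hg h
  rw [max_eq_right (by linarith)]; norm_num
lemma zb {s g y : ℝ} (hs : s ∈ Icc v1 v2) (hg : g ∈ Icc 0 G) (hy : 0 ≤ y) :
    max (PP p vs σ B n μ R g0 s g - y) 0 ≤ n :=
  max_le (by linarith [D.Pn' hs hg]) D.hn

lemma P_lip : ∃ L, 0 ≤ L ∧ ∀ s ∈ Icc v1 v2, ∀ s' ∈ Icc v1 v2, ∀ g ∈ Icc 0 G,
    |PP p vs σ B n μ R g0 s g - PP p vs σ B n μ R g0 s' g| ≤ L * |s - s'| := by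
  have hR := D.hRp
  have hμ := D.hμp
  have hVF := D.S.hVF
  have hn := D.hn
  have hG := D.hG
  set Ym := (G ^ 2 + μ * VF) / R ^ 2 with hYm
  have hYm0 : 0 ≤ Ym := by positivity
  have hY : ∀ s ∈ Icc v1 v2, ∀ g ∈ Icc 0 G, |YY vs σ μ R g0 s g| ≤ Ym := by
    intro s hs g hg
    rw [abs_of_nonneg (D.Ynn hs g), hYm]
    unfold YY
    have e1 : (g - g0) ^ 2 ≤ G ^ 2 := by
      rw [← sq_abs]
      refine pow_le_pow_left₀ (abs_nonneg _) ?_ 2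
      rw [abs_le]; constructor <;> linarith [hg.1, hg.2, D.hg0, D.hg0G, D.hd, D.hdδ]
    have e2 := mul_le_mul_of_nonneg_left (D.hτV hs) hμ.le
    exact div_le_div_of_nonneg_right (add_le_add e1 e2) (by positivity)
  refine ⟨B + n * ((μ / R ^ 2) * 5 * Ym ^ 4), add_nonneg D.hBp (by positivity), ?_⟩
  intro s hs s' hs' g hg
  have e1 : YY vs σ μ R g0 s g - YY vs σ μ R g0 s' g = μ / R ^ 2 * (σ * (s - s')) := by
    unfold YY; field_simp; ring
  have e2 : |(YY vs σ μ R g0 s g) ^ 5 - (YY vs σ μ R g0 s' g) ^ 5| ≤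
      (μ / R ^ 2) * |s - s'| * 5 * Ym ^ 4 := by
    refine (abs_pow_sub_pow_le _ _ 5).trans ?_
    rw [e1, abs_mul, abs_mul, D.hσa, one_mul, abs_of_pos (by positivity : 0 < μ / R^2)]
    norm_num
    gcongr
    exact max_le (hY s hs g hg) (hY s' hs' g hg)
  have e3 : PP p vs σ B n μ R g0 s g - PP p vs σ B n μ R g0 s' g =
      -(B * (σ * (s - s'))) - n * ((YY vs σ μ R g0 s g) ^ 5 - (YY vs σ μ R g0 s' g) ^ 5) := by
    unfold PP; ring
  rw [e3]
  refine (abs_sub _ _).trans ?_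
  rw [abs_neg, abs_mul, abs_mul, D.hσa, abs_mul, abs_of_nonneg hn, abs_of_nonneg D.hBp]
  have := mul_le_mul_of_nonneg_left e2 hn
  nlinarith

lemma key {v g : ℝ} (hv : v ∈ Ioo v1 v2) (hg : g ∈ Ioo 0 G)
    (hz : 0 < PP p vs σ B n μ R g0 v g) :
    0 ≤ -(Jflux VE gL v g * (-σ * (B + 5 * n * μ / R ^ 2 * (YY vs σ μ R g0 v g) ^ 4)))
      + α * (pgg vs g - n * (20 * (YY vs σ μ R g0 v g) ^ 3 * (2 * (g - g0) / R ^ 2) ^ 2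
        + 5 * (YY vs σ μ R g0 v g) ^ 4 * (2 / R ^ 2)))
      + κ * (g - gin) * (pg vs g - n * (5 * (YY vs σ μ R g0 v g) ^ 4 * (2 * (g - g0) / R ^ 2))) := by
  have hvI := Ioo_subset_Icc_self hv
  have hgI := Ioo_subset_Icc_self hg
  have hgR : |g - g0| < R := by
    by_contra h
    push Not at h
    exact absurd (D.Pneg hvI hgI h) (not_le.2 hz)
  set Y := YY vs σ μ R g0 v g with hY
  have hYn : 0 ≤ Y := D.Ynn hvI g
  have hY0 := D.Y0 hvI g
  rw [← hY] at hY0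
  have hR := D.hRp; have hR1 := D.hR1; have hn := D.hn; have hm := D.hm; have hcm := D.hcm
  have hd := D.hd; have hα := D.S.hα; have hμ := D.hμp; have hB := D.hBp
  have hσJ : (VE - VF) * R ≤ σ * Jflux VE gL v g := by
    rw [Jflux_eq g (by linarith [hv.2, D.h2, D.S.hVE])]
    have h1 := D.hdist v hvI
    have h2 : R ≤ σ * (g - gJ VE gL v) := by
      have h3 : σ * (g0 - g) ≤ R := by
        calc σ * (g0 - g) ≤ |σ * (g0 - g)| := le_abs_self _
          _ = |g - g0| := by rw [abs_mul, D.hσa, one_mul, abs_sub_comm]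
          _ ≤ R := hgR.le
      have h4 := D.hR
      nlinarith
    have h5 : VE - VF ≤ VE - v := by linarith [hv.2, D.h2]
    calc (VE - VF) * R ≤ (VE - v) * (σ * (g - gJ VE gL v)) :=
          mul_le_mul h5 h2 hR.le (by linarith)
      _ = _ := by ring
  have hc : |κ * (g - gin)| ≤ κ * (G + gin) := by
    rw [abs_mul, abs_of_pos D.S.hκ]
    refine mul_le_mul_of_nonneg_left ?_ D.S.hκ.le
    rw [abs_le]; constructor <;> linarith [hg.1, hg.2, D.S.hgin]
  obtain ⟨-, hW1, hW2⟩ := D.hV.2 g hgI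
  have t1 : n * (α + κ * (G + gin)) + n * (90 * α + 10 * (κ * (G + gin))) * (Y ^ 4 / R ^ 2) ≤
      -(Jflux VE gL v g * (-σ * (B + 5 * n * μ / R ^ 2 * Y ^ 4))) := by
    have : (VE - VF) * R * (B + 5 * n * μ / R ^ 2 * Y ^ 4) ≤
        (σ * Jflux VE gL v g) * (B + 5 * n * μ / R ^ 2 * Y ^ 4) :=
      mul_le_mul_of_nonneg_right hσJ (by positivity)
    refine le_trans (le_of_eq ?_) (this.trans (le_of_eq (by ring)))
    rw [D.hB, D.hμ]
    have : d = 2 * R := by rw [D.hR]; ring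
    rw [this]
    field_simp
    ring
  have t2 : -(n * α) ≤ α * pgg vs g := by have := (abs_le.1 hW2).1; nlinarith
  have t3 : -(n * (κ * (G + gin))) ≤ κ * (g - gin) * pg vs g := by
    have : |κ * (g - gin) * pg vs g| ≤ (κ * (G + gin)) * n := by
      rw [abs_mul]; exact mul_le_mul hc hW1 (abs_nonneg _) hcm.le
    linarith [(abs_le.1 this).1]
  have t4 : α * (n * (20 * Y ^ 3 * (2 * (g - g0) / R ^ 2) ^ 2 + 5 * Y ^ 4 * (2 / R ^ 2))) ≤
      n * (90 * α) * (Y ^ 4 / R ^ 2) := by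
    have : 20 * Y ^ 3 * (2 * (g - g0) / R ^ 2) ^ 2 ≤ 80 * (Y ^ 4 / R ^ 2) := by
      calc 20 * Y ^ 3 * (2 * (g - g0) / R ^ 2) ^ 2 = 80 * Y ^ 3 / R ^ 2 * ((g - g0) ^ 2 / R ^ 2) := by
            field_simp; ring
        _ ≤ 80 * Y ^ 3 / R ^ 2 * Y := by gcongr
        _ = _ := by field_simp
    have h2 : 20 * Y ^ 3 * (2 * (g - g0) / R ^ 2) ^ 2 + 5 * Y ^ 4 * (2 / R ^ 2) ≤
        90 * (Y ^ 4 / R ^ 2) := by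
      have : 5 * Y ^ 4 * (2 / R ^ 2) = 10 * (Y ^ 4 / R ^ 2) := by ring
      linarith
    calc _ ≤ α * (n * (90 * (Y ^ 4 / R ^ 2))) := by gcongr
      _ = _ := by ring
  have t5 : κ * (g - gin) * (n * (5 * Y ^ 4 * (2 * (g - g0) / R ^ 2))) ≤
      n * (10 * (κ * (G + gin))) * (Y ^ 4 / R ^ 2) := by
    calc κ * (g - gin) * (n * (5 * Y ^ 4 * (2 * (g - g0) / R ^ 2)))
        = n * 10 * (Y ^ 4 / R ^ 2) * (κ * (g - gin) * (g - g0)) := by ring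
      _ ≤ n * 10 * (Y ^ 4 / R ^ 2) * (κ * (G + gin) * 1) := by
        refine mul_le_mul_of_nonneg_left ?_ (by positivity)
        refine (le_abs_self _).trans ?_
        rw [abs_mul]
        exact mul_le_mul hc (by linarith) (abs_nonneg _) hcm.le
      _ = _ := by ring
  nlinarith

end BoxD

namespace BoxD
variable {VF VE gL gin α κ : ℝ} {p pg pgg pv : ℝ → ℝ → ℝ}
    {G n v1 v2 vs ve σ d δ g0 B μ R : ℝ}
    (D : BoxD VF VE gL gin α κ p pg pgg pv G n v1 v2 vs ve σ d δ g0 B μ R)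
include D

lemma vIoo {v : ℝ} (hv : v ∈ Ioo v1 v2) : v ∈ Ioo 0 VF :=
  ⟨D.h1.trans_lt hv.1, hv.2.trans_le D.h2⟩

lemma dPs {s g : ℝ} :
    HasDerivAt (fun s => PP p vs σ B n μ R g0 s g)
      (-σ * (B + 5 * n * μ / R ^ 2 * (YY vs σ μ R g0 s g) ^ 4)) s := by
  have h1 : HasDerivAt (fun s => σ * (s - vs)) (σ * 1) s := ((hasDerivAt_id s).sub_const vs).const_mul σ
  have h2 : HasDerivAt (fun s => YY vs σ μ R g0 s g) (μ * (σ * 1) / R ^ 2) s :=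
    ((h1.const_mul μ).const_add _).div_const _
  refine (((h1.const_mul B).const_sub (p vs g)).sub ((h2.pow 5).const_mul n)).congr_deriv ?_
  norm_num; ring

lemma dYg {s g : ℝ} :
    HasDerivAt (fun g => YY vs σ μ R g0 s g) (2 * (g - g0) / R ^ 2) g := by
  have h1 : HasDerivAt (fun g => (g - g0) ^ 2) ((2:ℕ) * (g - g0) ^ 1 * 1) g :=
    ((hasDerivAt_id g).sub_const g0).pow 2
  refine ((h1.add_const (μ * (σ * (s - vs)))).div_const (R^2)).congr_deriv ?_
  norm_num

lemma dr {s g : ℝ} (hs : s ∈ Ioo v1 v2) (hg : 0 < g) :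
    HasDerivAt (fun g => PP p vs σ B n μ R g0 s g - p s g)
      (pg vs g - n * (5 * (YY vs σ μ R g0 s g) ^ 4 * (2 * (g - g0) / R ^ 2)) - pg s g) g := by
  have h2 := (D.dYg (s := s) (g := g)).pow 5
  refine ((((D.S.hpg' D.hV.1 hg).sub_const (B * (σ * (s - vs)))).sub (h2.const_mul n)).sub
    (D.S.hpg' (D.vIoo hs) hg)).congr_deriv ?_
  norm_num

lemma drg {s g : ℝ} (hs : s ∈ Ioo v1 v2) (hg : 0 < g) :
    HasDerivAt (fun g => pg vs g - n * (5 * (YY vs σ μ R g0 s g) ^ 4 * (2 * (g - g0) / R ^ 2)) - pg s g)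
      (pgg vs g - n * (20 * (YY vs σ μ R g0 s g) ^ 3 * (2 * (g - g0) / R ^ 2) ^ 2
        + 5 * (YY vs σ μ R g0 s g) ^ 4 * (2 / R ^ 2)) - pgg s g) g := by
  have h2 := ((D.dYg (s := s) (g := g)).pow 4).const_mul 5
  have h3 : HasDerivAt (fun g => 2 * (g - g0) / R ^ 2) (2 * 1 / R ^ 2) g :=
    (((hasDerivAt_id g).sub_const g0).const_mul 2).div_const _
  refine (((D.S.hpgg' D.hV.1 hg).sub ((h2.mul h3).const_mul n)).sub
    (D.S.hpgg' (D.vIoo hs) hg)).congr_deriv ?_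
  simp only [Pi.pow_apply, Nat.cast_ofNat]
  ring

lemma contY (s : ℝ) : Continuous (fun g => YY vs σ μ R g0 s g) := by
  unfold YY; fun_prop

lemma contP (s : ℝ) : Continuous (fun g => PP p vs σ B n μ R g0 s g) := by
  have := D.S.contg vs D.hV.1
  have := D.contY s
  unfold PP; fun_prop

lemma JThd {v g : ℝ} (hv : v ∈ Ioo v1 v2) (hg : 0 < g) :
    Jflux VE gL v g * ThBd p vs σ B n μ R g0 pv v g =
    -(3 * (max (PP p vs σ B n μ R g0 v g - p v g) 0) ^ 2 *
      (Jflux VE gL v g * (-σ * (B + 5 * n * μ / R ^ 2 * (YY vs σ μ R g0 v g) ^ 4)) -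
        (α * pgg v g + κ * (g - gin) * pg v g + (g + gL + κ) * p v g))) := by
  rw [← D.S.pde v (D.vIoo hv) g hg]
  unfold ThBd; ring

lemma cls : ∃ C0, Cls VE gL p G v1 v2 (ThB p vs σ B n μ R g0) (ThBd p vs σ B n μ R g0 pv) C0 (δ/2) := by
  obtain ⟨L, hL, hP⟩ := D.P_lip
  have hn := D.hn
  have hδ : 0 < δ := D.hd.trans_le D.hdδ
  have hC : n ^ 3 + 3 * n ^ 2 + 3 * n ^ 2 * L ≥ 0 := by positivity
  refine ⟨n ^ 3 + 3 * n ^ 2 + 3 * n ^ 2 * L, by linarith, by linarith [D.hδ1], by linarith [D.hδG],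
    hC, ?_, ?_, ?_, ?_, ?_, ?_, ?_, ?_, ?_⟩
  · intro v hv g hg y hy
    unfold ThB
    rw [abs_neg, abs_of_nonneg (by positivity)]
    have := pow_le_pow_left₀ (le_max_right _ _) (D.zb hv hg hy) 3
    have : 0 ≤ 3 * n ^ 2 + 3 * n ^ 2 * L := by positivity
    linarith
  · intro v hv v' hv' g hg y hy
    unfold ThB
    have e1 := cube_lip (le_max_right (PP p vs σ B n μ R g0 v' g - y) 0)
      (le_max_right (PP p vs σ B n μ R g0 v g - y) 0) (D.zb hv' hg hy) (D.zb hv hg hy)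
    have e2 := (abs_max_sub_max_le_abs (PP p vs σ B n μ R g0 v' g - y) (PP p vs σ B n μ R g0 v g - y) 0)
    have e3 := hP v' hv' v hv g hg
    rw [abs_sub_comm v' v] at e3
    have e4 : PP p vs σ B n μ R g0 v' g - y - (PP p vs σ B n μ R g0 v g - y)
      = PP p vs σ B n μ R g0 v' g - PP p vs σ B n μ R g0 v g := by ring
    rw [e4] at e2
    rw [neg_sub_neg]
    refine e1.trans ?_
    calc _ ≤ 3 * n ^ 2 * (L * |v - v'|) := by gcongr; exact e2.trans e3
      _ ≤ _ := by
        have : 0 ≤ (n ^ 3 + 3 * n ^ 2) * |v - v'| := by positivity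
        nlinarith
  · intro v hv g hg y y' hy hyy
    unfold ThB
    apply neg_le_neg
    gcongr
  · intro v hv g hg y y' hy hy'
    unfold ThB
    have e1 := cube_lip (le_max_right (PP p vs σ B n μ R g0 v g - y') 0)
      (le_max_right (PP p vs σ B n μ R g0 v g - y) 0) (D.zb hv hg hy') (D.zb hv hg hy)
    have e2 := (abs_max_sub_max_le_abs (PP p vs σ B n μ R g0 v g - y') (PP p vs σ B n μ R g0 v g - y) 0)
    have e4 : PP p vs σ B n μ R g0 v g - y' - (PP p vs σ B n μ R g0 v g - y) = y - y' := by ring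
    rw [e4] at e2
    rw [neg_sub_neg]
    refine e1.trans ?_
    calc _ ≤ 3 * n ^ 2 * |y - y'| := by gcongr
      _ ≤ _ := by
        have : 0 ≤ (n ^ 3 + 3 * n ^ 2 * L) * |y - y'| := by positivity
        nlinarith
  · intro v hv g hg hgG y hy
    refine D.Th0 hv hg ?_ hy
    refine le_trans ?_ (le_abs_self _)
    linarith [D.hg0G, D.hR, D.hdδ]
  · intro v hv
    have h1 := (D.contP v).measurable
    have h2 : Measurable (p v) := D.S.meas.comp (measurable_const.prodMk measurable_id)
    unfold ThB
    exact (((h1.sub h2).max measurable_const).pow_const 3).neg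
  · intro v hv g hg
    have h1 := (D.dPs (s := v) (g := g)).sub (D.S.hpv v (D.vIoo hv) g hg.1)
    have h2 := (hasDerivAt_max_pow 1 (PP p vs σ B n μ R g0 v g - p v g)).scomp v h1
    refine h2.neg.congr_deriv ?_
    unfold ThBd
    simp only [smul_eq_mul]; norm_num; ring
  · intro v hv
    have hG := D.hG
    have hsub : Icc 0 G ⊆ Ici 0 := Icc_subset_Ici_self
    have hcont : ContinuousOn (fun g => -(3 * (max (PP p vs σ B n μ R g0 v g - p v g) 0) ^ 2 *
      (Jflux VE gL v g * (-σ * (B + 5 * n * μ / R ^ 2 * (YY vs σ μ R g0 v g) ^ 4)) -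
        (α * pgg v g + κ * (g - gin) * pg v g + (g + gL + κ) * p v g)))) (Icc 0 G) := by
      have e1 := (D.S.contpg v (D.vIoo hv)).mono hsub
      have e2 := (D.S.contpgg v (D.vIoo hv)).mono hsub
      have e3 := (D.S.contg v (D.vIoo hv))
      have e4 := D.contP v
      have e5 := D.contY v
      have e6 := Jflux_contg VE gL v
      fun_prop
    refine (hcont.intervalIntegrable_of_Icc hG.le).congr_uIoo ?_
    intro g hg
    rw [uIoo_of_le hG.le] at hg
    exact (D.JThd hv hg.1).symm
  · intro v hv
    have hvI := Ioo_subset_Icc_self hv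
    have hR := D.hRp
    refine ⟨0, R, 0, le_refl _, hR, le_refl _, ?_⟩
    intro g hg hgJ y hy _
    have h2 : R ≤ |g - g0| := by
      have h1 := D.hdist v hvI
      have h3 : σ * (g0 - gJ VE gL v) ≤ |g0 - gJ VE gL v| := by
        refine (le_abs_self _).trans ?_
        rw [abs_mul, D.hσa, one_mul]
      have h4 : |g0 - gJ VE gL v| ≤ |g - g0| + |g - gJ VE gL v| := by
        rw [abs_sub_comm g g0]; exact abs_sub_le _ _ _
      linarith [D.hR]
    rw [D.Th0 hvI hg h2 hy, D.Th0 hvI hg h2 (D.S.nonneg _ _)]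
    simp

lemma Rd_nonneg {v : ℝ} (hv : v ∈ Ioo v1 v2) :
    0 ≤ Rd VE gL p G (ThB p vs σ B n μ R g0) (ThBd p vs σ B n μ R g0 pv) v := by
  obtain ⟨C0, hcls⟩ := D.cls
  have hG := D.hG
  have hvI := Ioo_subset_Icc_self hv
  have hsub : Icc 0 G ⊆ Ici 0 := Icc_subset_Ici_self
  set r : ℝ → ℝ := fun g => PP p vs σ B n μ R g0 v g - p v g with hr
  set rg : ℝ → ℝ := fun g => pg vs g - n * (5 * (YY vs σ μ R g0 v g) ^ 4 * (2 * (g - g0) / R ^ 2))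
    - pg v g with hrg
  set rgg : ℝ → ℝ := fun g => pgg vs g - n * (20 * (YY vs σ μ R g0 v g) ^ 3 * (2 * (g - g0) / R ^ 2) ^ 2
        + 5 * (YY vs σ μ R g0 v g) ^ 4 * (2 / R ^ 2)) - pgg v g with hrgg
  have e1 := (D.S.contpg v (D.vIoo hv)).mono hsub
  have e2 := (D.S.contpgg v (D.vIoo hv)).mono hsub
  have e3 := (D.S.contg v (D.vIoo hv))
  have e4 := D.contP v
  have e5 := D.contY v
  have e6 := (D.S.contpg vs D.hV.1).mono hsub
  have e7 := (D.S.contpgg vs D.hV.1).mono hsub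
  have cr : ContinuousOn r (Icc 0 G) := by fun_prop
  have crg : ContinuousOn rg (Icc 0 G) := by
    simp only [hrg]; fun_prop
  have crgg : ContinuousOn rgg (Icc 0 G) := by
    simp only [hrgg]; fun_prop
  set A : ℝ → ℝ := fun g => 3 * α * ((max (r g) 0) ^ 2 * rg g) + κ * (g - gin) * (max (r g) 0) ^ 3 with hA
  set A' : ℝ → ℝ := fun g => 3 * α * (2 * max (r g) 0 * rg g * rg g + (max (r g) 0) ^ 2 * rgg g)
    + (κ * (max (r g) 0) ^ 3 + κ * (g - gin) * (3 * (max (r g) 0) ^ 2 * rg g)) with hA'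
  have hcA : ContinuousOn A (Icc 0 G) := by simp only [hA]; fun_prop
  have hcA' : ContinuousOn A' (Icc 0 G) := by simp only [hA']; fun_prop
  have hiA' := hcA'.intervalIntegrable_of_Icc (μ := volume) hG.le
  have hdA : ∀ g ∈ Ioo 0 G, HasDerivAt A (A' g) g := by
    intro g hg
    have d1 := D.dr hv hg.1
    have d2 := D.drg hv hg.1
    have d3 := (hasDerivAt_max_pow 0 (r g)).scomp g d1
    have d4 := (hasDerivAt_max_pow 1 (r g)).scomp g d1
    have d5 : HasDerivAt (fun g => κ * (g - gin)) (κ * 1) g :=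
      ((hasDerivAt_id g).sub_const gin).const_mul κ
    refine (((d3.mul d2).const_mul (3 * α)).add (d5.mul d4)).congr_deriv ?_
    simp only [hA', smul_eq_mul, Function.comp]
    simp only [hr, hrg, hrgg]
    norm_num
    ring
  have hint := intervalIntegral.integral_eq_sub_of_hasDerivAt_of_le hG.le hcA hdA hiA'
  have hAG : A G = 0 := by
    have : r G ≤ 0 := by
      have h1 := D.Pneg hvI ⟨hG.le, le_refl _⟩ (by
        refine le_trans ?_ (le_abs_self _)
        linarith [D.hg0G, D.hR, D.hdδ, D.hd])
      have := D.S.nonneg v G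
      simp only [hr]; linarith
    simp [hA, max_eq_right this]
  have hA0 : 0 ≤ A 0 := by
    rcases le_or_gt (r 0) 0 with h0 | h0
    · simp [hA, max_eq_right h0]
    · have b1 := D.S.bc v (D.vIoo hv)
      have b2 := D.S.bc vs D.hV.1
      have hz : 0 ≤ n * (5 * (YY vs σ μ R g0 v 0) ^ 4 * (2 * (g0 - 0) / R ^ 2)) := by
        have := D.hn; have := D.Ynn hvI 0; have := D.hg0; have := D.hRp
        rw [sub_zero]
        positivity
      have hr0 : r 0 ≤ p vs 0 - p v 0 := by
        simp only [hr, PP]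
        have := mul_nonneg D.hBp (D.hτ hvI)
        have := mul_nonneg D.hn (pow_nonneg (D.Ynn hvI 0) 5)
        linarith
      have h3 : κ * gin * r 0 ≤ α * rg 0 := by
        have : α * rg 0 = κ * gin * (p vs 0 - p v 0) +
          α * (n * (5 * (YY vs σ μ R g0 v 0) ^ 4 * (2 * (g0 - 0) / R ^ 2))) := by
          simp only [hrg]
          linear_combination b2 - b1
        rw [this]
        have h5 := mul_nonneg D.S.hα.le hz
        have h6 := mul_le_mul_of_nonneg_left hr0 (mul_pos D.S.hκ D.S.hgin).le
        linarith
      simp only [hA, max_eq_left h0.le]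
      have h4 : 0 ≤ κ * gin * r 0 ^ 3 := by
        have := D.S.hκ; have := D.S.hgin; positivity
      have h5 : (r 0)^2 * (κ * gin * r 0) ≤ (r 0)^2 * (α * rg 0) :=
        mul_le_mul_of_nonneg_left h3 (sq_nonneg _)
      nlinarith
  have hmono : ∫ g in (0:ℝ)..G, -A' g ≤
      Rd VE gL p G (ThB p vs σ B n μ R g0) (ThBd p vs σ B n μ R g0 pv) v := by
    unfold Rd
    refine intervalIntegral.integral_mono_on_of_le_Ioo hG.le hiA'.neg (Rd_intable D.S hcls hv) ?_
    intro g hg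
    rw [D.JThd hv hg.1]
    unfold ThB
    change -A' g ≤ -(g + gL) * -(max (r g) 0) ^ 3 + -(3 * (max (r g) 0) ^ 2 * _)
    rcases le_or_gt (r g) 0 with h0 | h0
    · simp [hA', max_eq_right h0]
    · have hP : 0 < PP p vs σ B n μ R g0 v g := by
        have := D.S.nonneg v g
        simp only [hr] at h0; linarith
      have hk := D.key hv hg hP
      simp only [hA', max_eq_left h0.le]
      have k1 : 0 ≤ (g + gL + κ) * p v g :=
        mul_nonneg (by linarith [hg.1, D.S.hgL, D.S.hκ]) (D.S.nonneg _ _)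
      have k2 : 0 ≤ (g + gL + κ) * r g ^ 3 :=
        mul_nonneg (by linarith [hg.1, D.S.hgL, D.S.hκ]) (by positivity)
      have k3 : 0 ≤ 6 * α * (r g * rg g ^ 2) := by have := D.S.hα; positivity
      have k4 := mul_nonneg (mul_nonneg (by norm_num : (0:ℝ) ≤ 3) (sq_nonneg (r g))) (add_nonneg hk k1)
      rw [← sub_nonneg]
      refine le_trans (add_nonneg (add_nonneg k2 k3) k4) (le_of_eq ?_)
      simp only [hrg, hrgg]
      ring
  rw [intervalIntegral.integral_neg, hint, hAG] at hmono
  linarith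

lemma sJ {v g : ℝ} (hvI : v ∈ Icc v1 v2) (hgR : |g - g0| ≤ R) :
    (VE - VF) * R ≤ σ * Jflux VE gL v g := by
  have hR := D.hRp; have hm := D.hm
  rw [Jflux_eq g (by linarith [hvI.2, D.h2, D.S.hVE])]
  have h1 := D.hdist v hvI
  have h2 : R ≤ σ * (g - gJ VE gL v) := by
    have h3 : σ * (g0 - g) ≤ R := by
      calc σ * (g0 - g) ≤ |σ * (g0 - g)| := le_abs_self _
        _ = |g - g0| := by rw [abs_mul, D.hσa, one_mul, abs_sub_comm]
        _ ≤ R := hgR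
    have h4 := D.hR
    nlinarith
  have h5 : VE - VF ≤ VE - v := by linarith [hvI.2, D.h2]
  calc (VE - VF) * R ≤ (VE - v) * (σ * (g - gJ VE gL v)) :=
        mul_le_mul h5 h2 hR.le (by linarith)
    _ = _ := by ring

lemma result (hve0 : ve ∈ Ioo 0 VF) (hI : Ineq VE gL p G v1 v2) : PP p vs σ B n μ R g0 ve g0 ≤ p ve g0 := by
  obtain ⟨C0, hcls⟩ := D.cls
  have hG := D.hG
  have hRp := D.hRp
  have h0 := hI _ _ _ _ hcls (fun _ => 0) 0 measurable_const (by simp) (fun v hv => D.Rd_nonneg hv)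
  simp only [intervalIntegral.integral_zero] at h0
  have hs0 : NN VE gL p G (ThB p vs σ B n μ R g0) vs = 0 := by
    unfold NN
    rw [intervalIntegral.integral_congr (g := fun _ => 0)]
    · simp
    · intro g hg
      simp only
      unfold ThB PP
      rw [max_eq_right]
      · norm_num
      · have := mul_nonneg D.hn (pow_nonneg (D.Ynn D.hvs g) 5)
        simp only [sub_self, mul_zero]; linarith
  have h1 : 0 ≤ σ * NN VE gL p G (ThB p vs σ B n μ R g0) ve := by
    have key : ∀ X : ℝ → ℝ, X vs = 0 → 0 ≤ X v2 - X v1 → 0 ≤ σ * X ve := by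
      intro X hX1 hX2
      rcases D.hc with ⟨h, h', h''⟩ | ⟨h, h', h''⟩
      · rw [h'] at hX1; rw [h'', h]; linarith
      · rw [h'] at hX1; rw [h'', h]; linarith
    exact key (NN VE gL p G (ThB p vs σ B n μ R g0)) hs0 h0
  by_contra hcon
  push Not at hcon
  have hp : Continuous (fun g => PP p vs σ B n μ R g0 ve g) := D.contP ve
  have hp2 := D.S.contg ve hve0
  have hpos := intervalIntegral.integral_pos (f := fun g => -(σ * (Jflux VE gL ve g *
    ThB p vs σ B n μ R g0 ve g (p ve g)))) hG ?_ ?_ ?_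
  · rw [intervalIntegral.integral_neg, intervalIntegral.integral_const_mul] at hpos
    unfold NN at h1
    linarith
  · have := Jflux_contg VE gL ve
    unfold ThB; fun_prop
  · intro g hg
    rcases le_or_gt (PP p vs σ B n μ R g0 ve g) 0 with h2 | h2
    · unfold ThB
      rw [max_eq_right (by linarith [D.S.nonneg ve g])]; norm_num
    · have h3 : |g - g0| ≤ R := by
        by_contra h
        push Not at h
        exact absurd (D.Pneg D.hve (Ioc_subset_Icc_self hg) h.le) (not_le.2 h2)
      have h4 := D.sJ D.hve h3
      have h5 : 0 ≤ (VE - VF) * R := mul_nonneg D.hm.le hRp.le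
      have h6 : 0 ≤ (max (PP p vs σ B n μ R g0 ve g - p ve g) 0) ^ 3 := by positivity
      unfold ThB
      nlinarith [mul_nonneg (h5.trans h4) h6]
  · refine ⟨g0, ⟨D.hg0, by linarith [D.hg0G, D.hd, D.hdδ]⟩, ?_⟩
    have h4 := D.sJ (g := g0) D.hve (by simp [hRp.le])
    have h5 : 0 < (VE - VF) * R := mul_pos D.hm hRp
    have h6 : 0 < (PP p vs σ B n μ R g0 ve g0 - p ve g0) ^ 3 := by
      have : 0 < PP p vs σ B n μ R g0 ve g0 - p ve g0 := by linarith
      positivity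
    unfold ThB
    rw [max_eq_left (by linarith)]
    nlinarith [mul_pos (h5.trans_le h4) h6]

end BoxD

def boxA (VF VE gin α κ G n : ℝ) : ℝ := n * (2 * (α + κ * (G + gin)) / (VE - VF) +
  (4 * (36 * α + 4 * (κ * (G + gin))) / (VE - VF)) ^ 5)

lemma box_bound {VF VE gL gin α κ : ℝ} {p pg pgg pv : ℝ → ℝ → ℝ}
    {G n v1 v2 σ d δ g0 : ℝ} (S : Sys VF VE gL gin α κ p pg pgg pv)
    (hV1 : Vn VF p pg pgg G n v1) (hV2 : Vn VF p pg pgg G n v2) (h12 : v1 < v2)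
    (hI : Ineq VE gL p G v1 v2) (hσ : σ = 1 ∨ σ = -1) (hd : 0 < d) (hdδ : d ≤ δ) (hδ1 : δ ≤ 1)
    (hδG : δ < G) (hg0 : 0 ≤ g0) (hg0G : g0 ≤ G - δ)
    (hdist : ∀ s ∈ Icc v1 v2, d ≤ σ * (g0 - gJ VE gL s)) (hl : (v2 - v1) ^ 2 ≤ d ^ 7) :
    -(boxA VF VE gin α κ G n / d) * (v2 - v1) ≤ σ * (p v2 g0 - p v1 g0) := by
  have main : ∀ vs ve, ((σ = 1 ∧ vs = v1 ∧ ve = v2) ∨ (σ = -1 ∧ vs = v2 ∧ ve = v1)) →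
      -(boxA VF VE gin α κ G n / d) * (v2 - v1) ≤ p ve g0 - p vs g0 := by
    intro vs ve hc
    have hVs : Vn VF p pg pgg G n vs := by
      rcases hc with h | h <;> rw [h.2.1] <;> assumption
    have hve : ve ∈ Ioo 0 VF := by
      rcases hc with h | h <;> rw [h.2.2]
      exacts [hV2.1, hV1.1]
    have D : BoxD VF VE gL gin α κ p pg pgg pv G n v1 v2 vs ve σ d δ g0 _ _ _ :=
      ⟨S, hVs, hV1.1.1.le, h12, hV2.1.2.le, hc, hd, hdδ, hδ1, hδG, hg0, hg0G, hdist, rfl, rfl, rfl⟩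
    have hres := D.result hve hI
    have hτ : σ * (ve - vs) = v2 - v1 := by
      rcases hc with ⟨h, h', h''⟩ | ⟨h, h', h''⟩ <;> rw [h, h', h''] <;> ring
    unfold PP YY at hres
    rw [hτ] at hres
    have hm := D.hm; have hn := D.hn; have hcm := D.hcm
    have hl0 : 0 < v2 - v1 := by linarith
    set ℓ := v2 - v1
    set m := VE - VF
    set cm := κ * (G + gin)
    have h4 : ℓ ^ 5 / d ^ 15 ≤ ℓ / d := by
      rw [div_le_div_iff₀ (by positivity) hd]
      have h1 : (ℓ ^ 2) ^ 2 ≤ (d ^ 7) ^ 2 := pow_le_pow_left₀ (sq_nonneg _) hl 2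
      calc ℓ ^ 5 * d = (ℓ ^ 2) ^ 2 * (ℓ * d) := by ring
        _ ≤ (d ^ 7) ^ 2 * (ℓ * d) := by gcongr
        _ = _ := by ring
    have h5 : (((g0 - g0) ^ 2 + (36 * α + 4 * cm) / (m * d) * ℓ) / (d / 2) ^ 2) ^ 5
        = (4 * (36 * α + 4 * cm) / m) ^ 5 * (ℓ ^ 5 / d ^ 15) := by
      rw [sub_self]; field_simp; ring
    have hE : 0 ≤ (4 * (36 * α + 4 * cm) / m) ^ 5 := by have := S.hα; positivity
    have h6 := mul_le_mul_of_nonneg_left (mul_le_mul_of_nonneg_left h4 hE) hn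
    rw [h5] at hres
    have h7 : boxA VF VE gin α κ G n / d * ℓ = 2 * n * (α + cm) / (m * d) * ℓ +
       n * ((4 * (36 * α + 4 * cm) / m) ^ 5 * (ℓ / d)) := by
      unfold boxA
      simp only [cm, m]
      field_simp
    rw [neg_mul, h7]
    linarith
  rcases hσ with h | h
  · have := main v1 v2 (Or.inl ⟨h, rfl, rfl⟩)
    rw [h, one_mul]; exact this
  · have := main v2 v1 (Or.inr ⟨h, rfl, rfl⟩)
    rw [h]; linarith

section portion
variable {VF VE gL gin α κ : ℝ} {p pg pgg pv : ℝ → ℝ → ℝ} {G n i1 i2 : ℝ}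

structure Port (VF VE gL gin α κ : ℝ) (p pg pgg pv : ℝ → ℝ → ℝ) (G n i1 i2 : ℝ) : Prop where
  S : Sys VF VE gL gin α κ p pg pgg pv
  hG : 0 < G
  hn : 0 ≤ n
  h1 : 0 < i1
  h2 : i2 < VF
  hZ : ∀ z ∈ ZZ VF VE gL p G, z ∈ Ioo i1 i2 → Vn VF p pg pgg G n z

def clA (VF VE gL gin α κ G n : ℝ) : ℝ := boxA VF VE gin α κ G n +
  n * (α + κ * (G + gin) + (G + gL + κ)) / (VE - VF)

lemma claimA (P : Port VF VE gL gin α κ p pg pgg pv G n i1 i2) {v v' σ d δ g : ℝ}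
    (hv : v ∈ ZZ VF VE gL p G) (hvi : i1 < v) (hv' : v' ∈ ZZ VF VE gL p G) (hvi' : v' < i2)
    (hvv : v ≤ v') (hσ : σ = 1 ∨ σ = -1) (hd : 0 < d) (hdδ : d ≤ δ) (hδ1 : δ ≤ 1)
    (hδG : δ < G) (hg0 : 0 < g) (hg0G : g ≤ G - δ)
    (hdist : ∀ s ∈ Icc v v', d ≤ σ * (g - gJ VE gL s)) (hl : (v' - v) ^ 2 ≤ d ^ 7) :
    -(clA VF VE gL gin α κ G n / d) * (v' - v) ≤ σ * (p v' g - p v g) := by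
  have S := P.S
  have hm : 0 < VE - VF := by linarith [S.hVE]
  have hα := S.hα
  have hκ := S.hκ
  have hgin := S.hgin
  have hgL := S.hgL
  have hG := P.hG
  have hn := P.hn
  have hb0 : 0 ≤ boxA VF VE gin α κ G n := by unfold boxA; positivity
  have hb1 : 0 ≤ n * (α + κ * (G + gin) + (G + gL + κ)) / (VE - VF) := by positivity
  have hin : ∀ z ∈ Icc v v', z ∈ Ioo i1 i2 := fun z hz => ⟨hvi.trans_le hz.1, hz.2.trans_lt hvi'⟩
  have := chain_deriv (f := fun t => σ * p t g) (S := ZZ VF VE gL p G)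
    (K := clA VF VE gL gin α κ G n / d) hvv
    (continuous_const.mul (S.contv g)).continuousOn
    (ZZ_closed (P.h1.trans hvi) (hvi'.trans P.h2)) hv hv' ?_ ?_
  · linarith
  · rintro a ⟨ha, ha'⟩ b ⟨hb, hb'⟩ hab hno
    have hI : Ineq VE gL p G a b := by
      refine gap_ineq S ha.1.1.le hab hb.1.2.le fun t ht => ?_
      by_contra hc
      exact hno t ht ⟨⟨ha.1.1.trans ht.1, ht.2.trans hb.1.2⟩, hc⟩
    have h5 := box_bound S (P.hZ a ha (hin a ha')) (P.hZ b hb (hin b hb')) hab hI hσ hd hdδ hδ1 hδG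
      hg0.le hg0G (fun s hs => hdist s ⟨ha'.1.trans hs.1, hs.2.trans hb'.2⟩)
      (le_trans (by nlinarith [ha'.1, hb'.2]) hl)
    have h6 : boxA VF VE gin α κ G n / d * (b - a) ≤ clA VF VE gL gin α κ G n / d * (b - a) := by
      have : 0 ≤ b - a := by linarith
      gcongr
      unfold clA; linarith
    linarith
  · rintro z ⟨hz, hz'⟩
    refine ⟨σ * pv z g, ?_, (S.hpv z hz.1 g hg0).const_mul σ⟩
    have hV := (P.hZ z hz (hin z hz')).2 g ⟨hg0.le, by linarith⟩
    have hpde := S.pde z hz.1 g hg0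
    rw [Jflux_eq g (by linarith [hz.1.2] : z < VE)] at hpde
    have hds := hdist z hz'
    have hσ2 : σ * σ = 1 := by rcases hσ with h | h <;> rw [h] <;> norm_num
    have habs : |α * pgg z g + κ * (g - gin) * pg z g + (g + gL + κ) * p z g| ≤
        n * (α + κ * (G + gin) + (G + gL + κ)) := by
      have e1 : |α * pgg z g| ≤ α * n := by
        rw [abs_mul, abs_of_pos hα]; exact mul_le_mul_of_nonneg_left hV.2.2 hα.le
      have e2 : |κ * (g - gin) * pg z g| ≤ κ * (G + gin) * n := by
        rw [abs_mul, abs_mul, abs_of_pos hκ]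
        have : |g - gin| ≤ G + gin := by rw [abs_le]; constructor <;> linarith
        gcongr; exact hV.2.1
      have e3 : |(g + gL + κ) * p z g| ≤ (G + gL + κ) * n := by
        rw [abs_mul, abs_of_pos (by positivity : 0 < g + gL + κ), abs_of_nonneg (S.nonneg _ _)]
        have := S.nonneg z g
        gcongr
        · linarith
        · exact hV.1
      have e4 := abs_add_le (α * pgg z g + κ * (g - gin) * pg z g) ((g + gL + κ) * p z g)
      have e5 := abs_add_le (α * pgg z g) (κ * (g - gin) * pg z g)
      linarith
    rw [← hpde] at habs
    have h7 : (VE - VF) * d * |σ * pv z g| ≤ n * (α + κ * (G + gin) + (G + gL + κ)) := by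
      refine le_trans ?_ habs
      have : (VE - z) * (g - gJ VE gL z) * pv z g
         = ((VE - z) * (σ * (g - gJ VE gL z))) * (σ * pv z g) := by
        linear_combination (-(VE - z) * (g - gJ VE gL z) * pv z g) * hσ2
      rw [this, abs_mul ((VE - z) * (σ * (g - gJ VE gL z)))]
      have : 0 ≤ VE - z := by linarith [hz.1.2]
      have : VE - VF ≤ VE - z := by linarith [hz.1.2]
      rw [abs_of_nonneg (mul_nonneg ‹_› (hd.le.trans hds))]
      gcongr
    have h8 : |σ * pv z g| ≤ n * (α + κ * (G + gin) + (G + gL + κ)) / (VE - VF) / d := by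
      rw [div_div, le_div_iff₀ (by positivity)]; linarith
    have h9 := neg_abs_le (σ * pv z g)
    have : n * (α + κ * (G + gin) + (G + gL + κ)) / (VE - VF) / d ≤ clA VF VE gL gin α κ G n / d := by
      gcongr; unfold clA; linarith
    linarith

end portion

lemma gJ_pos {VF VE gL v : ℝ} (hgL : 0 < gL) (hv : v ∈ Ioo 0 VF) (hVE : VF < VE) : 0 < gJ VE gL v := by
  unfold gJ
  have : 0 < VE - v := by linarith [hv.2]
  have := hv.1
  positivity

lemma gJ_lip {VF VE gL v s : ℝ} (hgL : 0 < gL) (hv : v ∈ Ioo 0 VF) (hs : s ∈ Ioo 0 VF) (hVE : VF < VE) (h : v ≤ s) :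
    |gJ VE gL s - gJ VE gL v| ≤ gL * VE / (VE - VF) ^ 2 * (s - v) := by
  have h1 : 0 < VE - v := by linarith [hv.2]
  have h2 : 0 < VE - s := by linarith [hs.2]
  have h3 : 0 < VE - VF := by linarith
  have hE : 0 < VE := by linarith [hv.1, hv.2]
  have e : gJ VE gL s - gJ VE gL v = gL * VE / ((VE - v) * (VE - s)) * (s - v) := by
    unfold gJ; field_simp; ring
  have h0 : 0 ≤ s - v := by linarith
  rw [e, abs_of_nonneg (by positivity)]
  gcongr
  rw [pow_two]
  gcongr
  · linarith [hv.2]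
  · linarith [hs.2]

section atz
variable {VF VE gL gin α κ : ℝ} {p pg pgg pv : ℝ → ℝ → ℝ} {G n i1 i2 : ℝ}
variable {t1 t2 C0 δ v v' c0 D M : ℝ} {Θ : ℝ → ℝ → ℝ → ℝ} {Θd : ℝ → ℝ → ℝ}

structure AtD (VF VE gL gin α κ : ℝ) (p pg pgg pv : ℝ → ℝ → ℝ) (G n i1 i2 t1 t2 C0 δ v v' c0 D M : ℝ)
    (Θ : ℝ → ℝ → ℝ → ℝ) (Θd : ℝ → ℝ → ℝ) : Prop where
  P : Port VF VE gL gin α κ p pg pgg pv G n i1 i2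
  C : Cls VE gL p G t1 t2 Θ Θd C0 δ
  hv : v ∈ ZZ VF VE gL p G
  hv' : v' ∈ ZZ VF VE gL p G
  hvi : i1 < v
  hvi' : v' < i2
  hvv : v < v'
  hvt : t1 < v
  hvt' : v' < t2
  hc0 : 0 < c0
  hc1 : c0 ≤ 1 / 2
  hc2 : c0 * (G + gJ VE gL v) ≤ δ / 2
  hD : 0 < D
  hh : (v' - v) ^ 2 = (c0 * D) ^ 7
  hL : gL * VE / (VE - VF) ^ 2 * (v' - v) ≤ D / 2
  hM : 0 < M
  hJ : ∀ v ∈ Icc 0 VF, ∀ g ∈ Icc 0 G, |Jflux VE gL v g| ≤ M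

namespace AtD
variable (A : AtD VF VE gL gin α κ p pg pgg pv G n i1 i2 t1 t2 C0 δ v v' c0 D M Θ Θd)
include A

lemma fA {σ g : ℝ} (hσ : σ = 1 ∨ σ = -1) (hg : 0 < g) (hgG : g ≤ G - δ / 2)
    (hx : D ≤ σ * (g - gJ VE gL v)) :
    -(clA VF VE gL gin α κ G n / c0) * (v' - v) / (σ * (g - gJ VE gL v)) ≤ σ * (p v' g - p v g) := by
  have hδ := A.C.hδ
  have hc0 := A.hc0
  have hD := A.hD
  set x := σ * (g - gJ VE gL v) with hxd
  have hgJ := gJ_pos A.P.S.hgL A.hv.1 A.P.S.hVE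
  have hx0 : 0 < x := hD.trans_le hx
  have hxM : x ≤ G + gJ VE gL v := by
    rcases hσ with h | h <;> rw [hxd, h] <;> linarith
  have := claimA A.P A.hv A.hvi A.hv' A.hvi' A.hvv.le hσ (d := c0 * x) (δ := δ / 2) (by positivity)
    (le_trans (by gcongr) A.hc2) (by linarith [A.C.hδ1]) (by linarith [A.C.hG]) hg hgG ?_ ?_
  · refine le_trans (le_of_eq ?_) this
    field_simp
  · intro s hs
    have hl := gJ_lip A.P.S.hgL A.hv.1 (s := s) ⟨A.hv.1.1.trans_le hs.1, hs.2.trans_lt A.hv'.1.2⟩ A.P.S.hVE hs.1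
    have h3 : gL * VE / (VE - VF) ^ 2 * (s - v) ≤ gL * VE / (VE - VF) ^ 2 * (v' - v) := by
      have := A.P.S.hgL
      have : 0 < VE := A.P.S.hVF.trans A.P.S.hVE
      have := hs.2
      gcongr
    have h4 := hl.trans (h3.trans A.hL)
    rw [abs_le] at h4
    have h5 : x - D / 2 ≤ σ * (g - gJ VE gL s) := by
      rcases hσ with h | h <;> rw [hxd, h] <;> linarith [h4.1, h4.2]
    nlinarith [A.hc1]
  · rw [A.hh]
    gcongr

lemma t12 {g : ℝ} (hg : g ∈ Icc 0 G) :
    -((G + gL + M) * C0 * (v' - v)) + Jflux VE gL v g * (Θ v g (p v' g) - Θ v g (p v g)) ≤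
    Jflux VE gL v' g * Θ v' g (p v' g) - Jflux VE gL v g * Θ v g (p v g) := by
  have hvI : v ∈ Icc t1 t2 := ⟨A.hvt.le, (A.hvv.trans A.hvt').le⟩
  have hvI' : v' ∈ Icc t1 t2 := ⟨(A.hvt.trans A.hvv).le, A.hvt'.le⟩
  have h1 := A.C.bdd v' hvI' g hg _ (A.P.S.nonneg v' g)
  have h2 := A.C.lipv v' hvI' v hvI g hg _ (A.P.S.nonneg v' g)
  have h3 := A.hJ v ⟨A.hv.1.1.le, A.hv.1.2.le⟩ g hg
  have hh : 0 < v' - v := by linarith [A.hvv]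
  rw [abs_of_pos hh] at h2
  have e1 : Jflux VE gL v' g - Jflux VE gL v g = -(g + gL) * (v' - v) := by unfold Jflux; ring
  have h4 : |(Jflux VE gL v' g - Jflux VE gL v g) * Θ v' g (p v' g)| ≤ (G + gL) * (v' - v) * C0 := by
    rw [e1, abs_mul, abs_mul, abs_neg, abs_of_pos hh, abs_of_nonneg (by linarith [hg.1, A.P.S.hgL])]
    have := hg.2; have := hg.1; have := A.P.S.hgL; have := A.P.hG
    gcongr
  have h5 : |Jflux VE gL v g * (Θ v' g (p v' g) - Θ v g (p v' g))| ≤ M * (C0 * (v' - v)) := by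
    rw [abs_mul]
    have := A.hM
    gcongr
  have h6 := (abs_le.1 h4).1
  have h7 := (abs_le.1 h5).1
  nlinarith

lemma zeroq {g : ℝ} (hg : g ∈ Icc 0 G) (h : G - δ ≤ g) :
    Jflux VE gL v' g * Θ v' g (p v' g) - Jflux VE gL v g * Θ v g (p v g) = 0 := by
  have hvI : v ∈ Icc t1 t2 := ⟨A.hvt.le, (A.hvv.trans A.hvt').le⟩
  have hvI' : v' ∈ Icc t1 t2 := ⟨(A.hvt.trans A.hvv).le, A.hvt'.le⟩
  rw [A.C.supp v hvI g hg h _ (A.P.S.nonneg _ _), A.C.supp v' hvI' g hg h _ (A.P.S.nonneg _ _)]; simp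

lemma clA_nn : 0 ≤ clA VF VE gL gin α κ G n := by
  have S := A.P.S
  have hm : 0 < VE - VF := by linarith [S.hVE]
  have hα := S.hα
  have hκ := S.hκ
  have hgin := S.hgin
  have hgL := S.hgL
  have hG := A.P.hG
  have hn := A.P.hn
  unfold clA boxA; positivity

lemma outer {g : ℝ} (hg : 0 < g) (hgG : g ≤ G) (hx : D ≤ |g - gJ VE gL v|) :
    -(((G + gL + M) * C0 + (VE - v) * C0 * (clA VF VE gL gin α κ G n / c0)) * (v' - v)) ≤
    Jflux VE gL v' g * Θ v' g (p v' g) - Jflux VE gL v g * Θ v g (p v g) := by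
  have hA := A.clA_nn
  have hc0 := A.hc0
  have hC0 := A.C.hC0
  have hM := A.hM
  have hgL := A.P.S.hgL
  have hG := A.P.hG
  have hh : 0 < v' - v := by linarith [A.hvv]
  have hVv : 0 < VE - v := by linarith [A.P.S.hVE, A.hv.1.2]
  have hvI : v ∈ Icc t1 t2 := ⟨A.hvt.le, (A.hvv.trans A.hvt').le⟩
  rcases le_or_gt (G - δ) g with h | h
  · rw [A.zeroq ⟨hg.le, hgG⟩ h]
    rw [Left.neg_nonpos_iff]; positivity
  · refine le_trans ?_ (A.t12 ⟨hg.le, hgG⟩)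
    rw [add_mul, neg_add]
    gcongr
    obtain ⟨σ, hσ, hσx⟩ : ∃ σ : ℝ, (σ = 1 ∨ σ = -1) ∧ σ * (g - gJ VE gL v) = |g - gJ VE gL v| := by
      rcases le_or_gt 0 (g - gJ VE gL v) with h | h
      · exact ⟨1, Or.inl rfl, by rw [abs_of_nonneg h]; ring⟩
      · exact ⟨-1, Or.inr rfl, by rw [abs_of_neg h]; ring⟩
    have hf := A.fA hσ hg (by linarith [A.C.hδ]) (hx.trans_eq hσx.symm)
    rw [Jflux_eq g (by linarith : v < VE)]
    set x := σ * (g - gJ VE gL v) with hxd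
    have hx0 : 0 < x := by rw [hσx]; exact A.hD.trans_le hx
    set E := clA VF VE gL gin α κ G n / c0 * (v' - v) / x with hE
    have hE0 : 0 ≤ E := by positivity
    have hf' : -E ≤ σ * (p v' g - p v g) := by rw [hE]; refine le_trans (le_of_eq ?_) hf; ring
    have hσ2 : σ * σ = 1 := by rcases hσ with h | h <;> rw [h] <;> norm_num
    have hT : -(C0 * E) ≤ σ * (Θ v g (p v' g) - Θ v g (p v g)) := by
      have hlip := A.C.lipy v hvI g ⟨hg.le, hgG⟩ _ _ (A.P.S.nonneg v' g) (A.P.S.nonneg v g)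
      have hCE : 0 ≤ C0 * E := by positivity
      rcases hσ with h | h
      · rw [h, one_mul] at hf' ⊢
        rcases le_or_gt (p v g) (p v' g) with h1 | h1
        · have := A.C.mono v hvI g ⟨hg.le, hgG⟩ _ _ (A.P.S.nonneg v g) h1
          linarith
        · have h2 := (abs_le.1 hlip).1
          rw [abs_of_neg (by linarith)] at h2
          have h3 := mul_le_mul_of_nonneg_left hf' hC0
          linarith
      · rw [h] at hf' ⊢
        rcases le_or_gt (p v' g) (p v g) with h1 | h1
        · have := A.C.mono v hvI g ⟨hg.le, hgG⟩ _ _ (A.P.S.nonneg v' g) h1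
          linarith
        · have h2 := (abs_le.1 hlip).2
          rw [abs_of_pos (by linarith)] at h2
          have h3 := mul_le_mul_of_nonneg_left hf' hC0
          linarith
    have e1 : (VE - v) * (g - gJ VE gL v) * (Θ v g (p v' g) - Θ v g (p v g)) =
       (VE - v) * x * (σ * (Θ v g (p v' g) - Θ v g (p v g))) := by
      rw [hxd]; linear_combination (-(VE - v) * (g - gJ VE gL v) * (Θ v g (p v' g) - Θ v g (p v g))) * hσ2
    rw [e1]
    have e2 : (VE - v) * C0 * (clA VF VE gL gin α κ G n / c0) * (v' - v) = (VE - v) * x * (C0 * E) := by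
      rw [hE]; field_simp
    rw [e2]
    have := mul_le_mul_of_nonneg_left hT (by positivity : 0 ≤ (VE - v) * x)
    linarith

set_option maxHeartbeats 1000000 in
/-- inner estimate -/
lemma inner {C η K0 : ℝ} (hC : 0 ≤ C) (hK : 0 ≤ K0)
    (hlay : ∀ g ∈ Icc 0 G, |g - gJ VE gL v| ≤ η → ∀ y, 0 ≤ y → |y - p v g| ≤ η →
    |Θ v g y - Θ v g (p v g) - K0 * (y - p v g)| ≤
      C * ((y - p v g) ^ 2 + |g - gJ VE gL v| * |y - p v g|))
    (hDη : D ≤ η) (hh : v' - v ≤ D ^ 2)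
    (hfη : (clA VF VE gL gin α κ G n / c0 + 4 * n) * D ≤ η)
    (hD1 : 0 < gJ VE gL v - D) (hD2 : gJ VE gL v + D ≤ G - δ / 2)
    {g : ℝ} (hgD : |g - gJ VE gL v| ≤ D) :
    (VE - v) * K0 * (p v' (gJ VE gL v) - p v (gJ VE gL v)) * (g - gJ VE gL v)
      - (((G + gL + M) * C0 + (VE - v) * K0 * (clA VF VE gL gin α κ G n / c0)) * (v' - v)
        + (VE - v) * (K0 * 6 * n + C * ((clA VF VE gL gin α κ G n / c0 + 4 * n) ^ 2 +
        (clA VF VE gL gin α κ G n / c0 + 4 * n))) * D ^ 3) ≤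
    Jflux VE gL v' g * Θ v' g (p v' g) - Jflux VE gL v g * Θ v g (p v g) := by
  have hA := A.clA_nn
  have hc0 := A.hc0
  have hn := A.P.hn
  have hδ := A.C.hδ
  have S := A.P.S
  have hD := A.hD
  have hh0 : 0 < v' - v := by linarith [A.hvv]
  have hVv : 0 < VE - v := by linarith [A.P.S.hVE, A.hv.1.2]
  set A0 := clA VF VE gL gin α κ G n / c0 with hA0
  have hA0n : 0 ≤ A0 := by positivity
  set z := gJ VE gL v with hz
  have hgI := abs_le.1 hgD
  have hgm : g ∈ Icc 0 G := ⟨by linarith, by linarith⟩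
  have hzm : z ∈ Icc 0 G := ⟨by linarith, by linarith⟩
  have hpm : z + D ∈ Icc 0 G := ⟨by linarith, by linarith⟩
  have hmm : z - D ∈ Icc 0 G := ⟨by linarith, by linarith⟩
  have hV := A.P.hZ v A.hv ⟨A.hvi, A.hvv.trans A.hvi'⟩
  have hV' := A.P.hZ v' A.hv' ⟨A.hvi.trans A.hvv, A.hvi'⟩
  have f1 := A.fA (σ := 1) (Or.inl rfl) (g := z + D) (by linarith) hD2 (by rw [← hz]; linarith)
  have f2 := A.fA (σ := -1) (Or.inr rfl) (g := z - D) (by linarith) (by linarith) (by rw [← hz]; linarith)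
  rw [← hz, ← hA0] at f1 f2
  have e1 : -A0 * (v' - v) / (1 * (z + D - z)) = -(A0 * ((v' - v) / D)) := by
    rw [show 1 * (z + D - z) = D by ring]; ring
  have e2 : -A0 * (v' - v) / (-1 * (z - D - z)) = -(A0 * ((v' - v) / D)) := by
    rw [show -1 * (z - D - z) = D by ring]; ring
  rw [e1] at f1
  rw [e2] at f2
  have hhD : (v' - v) / D ≤ D := by rw [div_le_iff₀ hD]; linarith
  have hhD' : A0 * ((v' - v) / D) ≤ A0 * D := by gcongr
  obtain ⟨f, hf⟩ : ∃ f : ℝ → ℝ, ∀ y, f y = p v' y - p v y := ⟨_, fun _ => rfl⟩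
  have hfl : ∀ y ∈ Icc 0 G, |f y - f g| ≤ 2 * n * |y - g| := by
    intro y hy
    have a1 := hV.lip S hgm hy
    have a2 := hV'.lip S hgm hy
    have : f y - f g = (p v' y - p v' g) - (p v y - p v g) := by simp only [hf]; ring
    rw [this]
    exact (abs_sub _ _).trans (by linarith)
  have hfb : |f g| ≤ (A0 + 4 * n) * D := by
    have b1 := hfl _ hpm
    have b2 := hfl _ hmm
    have b3 : |z + D - g| ≤ 2 * D := by rw [abs_le]; constructor <;> linarith [hgI.1, hgI.2]
    have b4 : |z - D - g| ≤ 2 * D := by rw [abs_le]; constructor <;> linarith [hgI.1, hgI.2]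
    have b5 := b1.trans (mul_le_mul_of_nonneg_left b3 (by positivity))
    have b6 := b2.trans (mul_le_mul_of_nonneg_left b4 (by positivity))
    have b7 := abs_le.1 b5
    have b8 := abs_le.1 b6
    have f1' : -(A0 * ((v' - v) / D)) ≤ f (z + D) := by simp only [hf]; linarith
    have f2' : f (z - D) ≤ A0 * ((v' - v) / D) := by simp only [hf]; linarith
    rw [abs_le]; constructor <;> linarith [b7.2, b8.1]
  -- Taylor
  set s := pg v' z - pg v z with hs
  have hT : ∀ y ∈ Icc 0 G, |f y - f z - s * (y - z)| ≤ 2 * n * (y - z) ^ 2 := by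
    intro y hy
    have a1 := hV.taylor S hzm hy
    have a2 := hV'.taylor S hzm hy
    have : f y - f z - s * (y - z) = (p v' y - p v' z - pg v' z * (y - z)) - (p v y - p v z - pg v z * (y - z)) := by
      simp only [hf, hs]; ring
    rw [this]
    refine (abs_sub _ _).trans ?_
    have : |y - z| * |y - z| = (y - z) ^ 2 := by rw [← abs_mul, ← pow_two, abs_sq]
    rw [mul_assoc, this] at a1 a2
    linarith
  have hs1 : -(A0 * (v' - v)) - 2 * n * D ^ 3 ≤ s * D ^ 2 := by
    have b1 := (abs_le.1 (hT _ hpm)).2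
    have b2 := (abs_le.1 (hT _ hmm)).1
    have f1' : -(A0 * ((v' - v) / D)) ≤ f (z + D) := by simp only [hf]; linarith
    have f2' : f (z - D) ≤ A0 * ((v' - v) / D) := by simp only [hf]; linarith
    have b3 : -(2 * (A0 * ((v' - v) / D))) - 4 * n * D ^ 2 ≤ 2 * s * D := by
      have q1 : (z + D - z) = D := by ring
      have q2 : (z - D - z) = -D := by ring
      rw [q1] at b1; rw [q2] at b2
      linarith
    have b4 := mul_le_mul_of_nonneg_right b3 hD.le
    have q3 : (v' - v) / D * D = v' - v := by field_simp
    have q4 : (-(2 * (A0 * ((v' - v) / D))) - 4 * n * D ^ 2) * D = -(2 * (A0 * ((v' - v) / D * D))) - 4 * n * D ^ 3 := by ring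
    rw [q4, q3] at b4
    linarith
  have hx2 : (g - z) ^ 2 ≤ D ^ 2 := by rw [← sq_abs]; gcongr
  have hsx : -(A0 * (v' - v)) - 2 * n * D ^ 3 ≤ s * (g - z) ^ 2 := by
    rcases le_or_gt 0 s with h | h
    · have : 0 ≤ s * (g - z) ^ 2 := by positivity
      have : 0 ≤ A0 * (v' - v) := by positivity
      have : 0 ≤ 2 * n * D ^ 3 := by positivity
      linarith
    · have := mul_le_mul_of_nonpos_left hx2 h.le
      linarith
  -- main term
  have hm : f z * (g - z) - (A0 * (v' - v) + 4 * n * D ^ 3) ≤ (g - z) * f g := by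
    have b1 := hT g hgm
    have b2 : |(g - z) * (f g - f z - s * (g - z))| ≤ D * (2 * n * D ^ 2) := by
      rw [abs_mul]
      gcongr
      exact b1.trans (by gcongr)
    have b3 := (abs_le.1 b2).1
    have e : (g - z) * (f g - f z - s * (g - z)) = (g - z) * f g - f z * (g - z) - s * (g - z) ^ 2 := by ring
    rw [e] at b3
    linarith
  have hl := hlay g hgm (hgD.trans hDη) (p v' g) (S.nonneg _ _) ((by rw [← hf]; exact hfb.trans hfη))
  have hft : p v' g - p v g = f g := (hf g).symm
  rw [hft] at hl
  set X := Θ v g (p v' g) - Θ v g (p v g) with hX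
  have hl2 : |X - K0 * f g| ≤ C * (((A0 + 4 * n) ^ 2 + (A0 + 4 * n)) * D ^ 2) := by
    refine hl.trans ?_
    have : f g ^ 2 ≤ ((A0 + 4 * n) * D) ^ 2 := by rw [← sq_abs (f g)]; gcongr
    have : |g - z| * |f g| ≤ D * ((A0 + 4 * n) * D) := by gcongr
    gcongr
    linarith
  have hl3 : |(g - z) * (X - K0 * f g)| ≤ D * (C * (((A0 + 4 * n) ^ 2 + (A0 + 4 * n)) * D ^ 2)) := by
    rw [abs_mul]; gcongr
  have hl4 := (abs_le.1 hl3).1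
  refine le_trans ?_ (A.t12 hgm)
  rw [Jflux_eq g (by linarith : v < VE), ← hX, ← hz]
  have hn3 : 0 ≤ n * D ^ 3 := by positivity
  have h9 : K0 * f z * (g - z) - (K0 * A0 * (v' - v) + (K0 * 6 * n + C * ((A0 + 4 * n) ^ 2 + (A0 + 4 * n))) * D ^ 3)
     ≤ (g - z) * X := by
    have q5 := mul_le_mul_of_nonneg_left hm hK
    have q6 := mul_nonneg hK hn3
    linarith
  have h10 := mul_le_mul_of_nonneg_left h9 hVv.le
  have : p v' z - p v z = f z := (hf z).symm
  rw [this]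
  linarith

end AtD
end atz

lemma integral_layer {z D c E G : ℝ} (hD : 0 < D) (h1 : 0 < z - D) (h2 : z + D ≤ G) :
    ∫ g in (0:ℝ)..G, (Ioo (z - D) (z + D)).indicator (fun g => c * (g - z) - E) g = -(2 * D * E) := by
  rw [intervalIntegral.integral_of_le (by linarith), setIntegral_indicator measurableSet_Ioo]
  have : Ioc 0 G ∩ Ioo (z - D) (z + D) = Ioo (z - D) (z + D) :=
    inter_eq_right.2 fun x hx => ⟨h1.trans hx.1, hx.2.le.trans h2⟩
  rw [this, ← integral_Ioc_eq_integral_Ioo, ← intervalIntegral.integral_of_le (by linarith)]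
  rw [intervalIntegral.integral_comp_sub_right (fun x => c * x - E) z]
  rw [intervalIntegral.integral_sub (by apply Continuous.intervalIntegrable; fun_prop) (by simp),
    intervalIntegral.integral_const_mul, integral_id, intervalIntegral.integral_const]
  rw [smul_eq_mul]; ring

section atz
variable {VF VE gL gin α κ : ℝ} {p pg pgg pv : ℝ → ℝ → ℝ} {G n i1 i2 : ℝ}
variable {t1 t2 C0 δ v : ℝ} {Θ : ℝ → ℝ → ℝ → ℝ} {Θd : ℝ → ℝ → ℝ}

set_option maxHeartbeats 1000000 in
lemma atZ (P : Port VF VE gL gin α κ p pg pgg pv G n i1 i2)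
    (C : Cls VE gL p G t1 t2 Θ Θd C0 δ) (hv : v ∈ ZZ VF VE gL p G) (hi1 : i1 < v) (hi2 : v < i2)
    (ht1 : t1 < v) (ht2 : v < t2) {ε : ℝ} (hε : 0 < ε) :
    ∀ᶠ v' in nhdsWithin v (ZZ VF VE gL p G ∩ Ioi v),
      (Rd VE gL p G Θ Θd v - ε) * (v' - v) ≤ NN VE gL p G Θ v' - NN VE gL p G Θ v := by
  have S := P.S
  obtain ⟨M, hM, hJ⟩ := Jflux_bd (G := G) S.hVF S.hVE S.hgL
  have hG := P.hG
  have hδ := C.hδ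
  have hz0 := gJ_pos S.hgL hv.1 S.hVE
  set z := gJ VE gL v with hz
  set l := nhdsWithin v (ZZ VF VE gL p G ∩ Ioi v) with hl
  set c0 := δ / (4 * (1 + G + z)) with hc0d
  have hc0 : 0 < c0 := by positivity
  have hc1 : c0 ≤ 1 / 2 := by
    rw [hc0d, div_le_iff₀ (by positivity)]; nlinarith [C.hδ1]
  have hc2 : c0 * (G + z) ≤ δ / 2 := by
    rw [hc0d, div_mul_eq_mul_div, div_le_iff₀ (by positivity)]; nlinarith
  obtain ⟨Cl, η, K0, hCl, hη, hK0, hlay⟩ := C.layer v ⟨ht1, ht2⟩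
  have hmem : ∀ᶠ v' in l, v' ∈ ZZ VF VE gL p G ∩ Ioi v := self_mem_nhdsWithin
  have hnear : ∀ᶠ v' in l, v' < i2 ∧ v' < t2 :=
    (((gt_mem_nhds hi2).and (gt_mem_nhds ht2))).filter_mono nhdsWithin_le_nhds
  -- the scale
  have hτ : Tendsto (fun v' => (v' - v) ^ (1/7:ℝ)) l (nhdsWithin 0 (Ioi 0)) := by
    rw [tendsto_nhdsWithin_iff]
    constructor
    · have : ContinuousAt (fun v' => (v' - v) ^ (1/7:ℝ)) v := by
        apply ContinuousAt.rpow_const (by fun_prop); right; norm_num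
      have h := this.tendsto.mono_left (nhdsWithin_le_nhds (s := ZZ VF VE gL p G ∩ Ioi v))
      simpa [Real.zero_rpow] using h
    · filter_upwards [hmem] with v' h
      exact Real.rpow_pos_of_pos (sub_pos.2 h.2) _
  have small : ∀ f : ℝ → ℝ, Continuous f → ∀ c, f 0 < c → ∀ᶠ v' in l, f ((v' - v) ^ (1/7:ℝ)) < c := by
    intro f hf c hc
    have h1 : ∀ᶠ t in nhds (0:ℝ), f t < c := hf.tendsto 0 (gt_mem_nhds hc)
    exact hτ.eventually (h1.filter_mono nhdsWithin_le_nhds)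
  set A0 := clA VF VE gL gin α κ G n / c0 with hA0
  set K1 := (G + gL + M) * C0 + (VE - v) * K0 * A0 with hK1
  set K2 := (VE - v) * (K0 * 6 * n + Cl * ((A0 + 4 * n) ^ 2 + (A0 + 4 * n))) with hK2
  have s1 := small (fun t => gL * VE / (VE - VF) ^ 2 * t ^ 5 * (2 * c0)) (by fun_prop) 1 (by simp)
  have s2 := small (fun t => t ^ 2 / c0) (by fun_prop) (min (min η z) (δ / 2)) (by simp [hη, hz0, hδ])
  have s3 := small (fun t => t ^ 3 * c0 ^ 2) (by fun_prop) 1 (by simp)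
  have s4 := small (fun t => (A0 + 4 * n) * (t ^ 2 / c0)) (by fun_prop) η (by simp [hη])
  have s5 : ∀ᶠ v' in l, z < G - δ / 2 → z + ((v' - v) ^ (1/7:ℝ)) ^ 2 / c0 < G - δ / 2 := by
    by_cases h : z < G - δ / 2
    · filter_upwards [small (fun t => z + t ^ 2 / c0) (by fun_prop) (G - δ/2) (by simpa using h)] with v' hv' _ using hv'
    · exact Eventually.of_forall fun _ h' => absurd h' h
  have s6 := small (fun t => 2 / c0 * K1 * t ^ 2 + 2 * K2 / c0 ^ 4 * t) (by fun_prop) (ε / 2) (by simpa using hε)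
  -- package
  have hAt : ∀ᶠ v' in l, 0 < (v' - v) ^ (1/7:ℝ) ∧ ((v' - v) ^ (1/7:ℝ)) ^ 7 = v' - v ∧
      AtD VF VE gL gin α κ p pg pgg pv G n i1 i2 t1 t2 C0 δ v v' c0 (((v' - v) ^ (1/7:ℝ)) ^ 2 / c0) M Θ Θd := by
    filter_upwards [hmem, hnear, s1] with v' h1 h2 h3
    have hh : 0 < v' - v := sub_pos.2 h1.2
    have hp : 0 < (v' - v) ^ (1/7:ℝ) := Real.rpow_pos_of_pos hh _
    have h7 : ((v' - v) ^ (1/7:ℝ)) ^ 7 = v' - v := by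
      rw [← Real.rpow_natCast, ← Real.rpow_mul hh.le]; norm_num
    refine ⟨hp, h7, P, C, hv, h1.1, hi1, h2.1, h1.2, ht1, h2.2, hc0, hc1, hc2, by positivity, ?_, ?_, hM, hJ⟩
    · have : c0 * (((v' - v) ^ (1/7:ℝ)) ^ 2 / c0) = ((v' - v) ^ (1/7:ℝ)) ^ 2 := by field_simp
      rw [this]
      nth_rewrite 1 [← h7]; ring
    · nth_rewrite 1 [← h7]
      set t := (v' - v) ^ (1/7:ℝ)
      rw [div_div, le_div_iff₀ (by positivity)]
      have := mul_le_mul_of_nonneg_right h3.le (sq_nonneg t)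
      nlinarith
  set ρ : ℝ → ℝ := fun g => -(g + gL) * Θ v g (p v g) + Jflux VE gL v g * Θd v g with hρ
  have hρi : IntervalIntegrable ρ volume 0 G := Rd_intable S C ⟨ht1, ht2⟩
  set q : ℝ → ℝ → ℝ := fun v' g => Jflux VE gL v' g * Θ v' g (p v' g) - Jflux VE gL v g * Θ v g (p v g) with hq
  have hvI : v ∈ Icc t1 t2 := ⟨ht1.le, ht2.le⟩
  have hvI' : ∀ᶠ v' in l, v' ∈ Icc t1 t2 := by
    filter_upwards [hmem, hnear] with v' h1 h2
    exact ⟨(ht1.trans h1.2).le, h2.2.le⟩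
  have hqi : ∀ v' ∈ Icc t1 t2, IntervalIntegrable (q v') volume 0 G := fun v' h' =>
    (NN_intable S C h').sub (NN_intable S C hvI)
  set I : ℝ → Set ℝ := fun v' => Ioo (z - ((v' - v) ^ (1/7:ℝ)) ^ 2 / c0) (z + ((v' - v) ^ (1/7:ℝ)) ^ 2 / c0) with hI
  have hIiff : ∀ v' g, g ∉ I v' ↔ ((v' - v) ^ (1/7:ℝ)) ^ 2 / c0 ≤ |g - z| := by
    intro v' g
    have : g ∈ I v' ↔ |g - z| < ((v' - v) ^ (1/7:ℝ)) ^ 2 / c0 := by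
      rw [abs_lt, hI]; simp only [mem_Ioo]
      constructor
      · rintro ⟨h1, h2⟩; constructor <;> linarith
      · rintro ⟨h1, h2⟩; constructor <;> linarith
    rw [this, not_lt]
  set C1 := (G + gL + M) * C0 + (VE - v) * C0 * A0 with hC1
  set F : ℝ → ℝ → ℝ := fun v' g => min ((I v')ᶜ.indicator (fun g => q v' g / (v' - v)) g) |ρ g| with hF
  have hC1n : 0 ≤ C1 ∨ ¬ (∃ᶠ v' in l, True) := by
    by_cases h : ∃ᶠ v' in l, True
    · left
      obtain ⟨v', -, -, -, hA⟩ := (h.and_eventually hAt).exists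
      have := hA.clA_nn; have := C.hC0; have := S.hgL
      have : 0 < VE - v := by linarith [S.hVE, hv.1.2]
      positivity
    · exact Or.inr h
  rcases hC1n with hC1n | hbot
  swap
  · simp only [frequently_true_iff_neBot, not_neBot] at hbot
    rw [hbot]; exact eventually_bot
  have hint : ∀ v' ∈ Icc t1 t2, IntervalIntegrable ((I v')ᶜ.indicator (fun g => q v' g / (v' - v))) volume 0 G := by
    intro v' h'
    have h0 := (hqi v' h').div_const (v' - v)
    rw [intervalIntegrable_iff] at h0 ⊢
    exact h0.indicator measurableSet_Ioo.compl
  have hlim : Tendsto (fun v' => ∫ g in (0:ℝ)..G, F v' g) l (nhds (∫ g in (0:ℝ)..G, ρ g)) := by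
    refine intervalIntegral.tendsto_integral_filter_of_dominated_convergence (fun g => C1 + |ρ g|) ?_ ?_ ?_ ?_
    · filter_upwards [hvI'] with v' h'
      have h1 := (intervalIntegrable_iff.1 (hint v' h')).aestronglyMeasurable
      have h2 := (intervalIntegrable_iff.1 hρi.abs).aestronglyMeasurable
      exact h1.inf h2
    · filter_upwards [hAt] with v' hA
      refine Eventually.of_forall fun g hg => ?_
      rw [uIoc_of_le hG.le] at hg
      have hh : 0 < v' - v := by linarith [hA.2.2.hvv]
      have hlow : -C1 ≤ (I v')ᶜ.indicator (fun g => q v' g / (v' - v)) g := by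
        by_cases hgi : g ∈ (I v')ᶜ
        · rw [indicator_of_mem hgi, le_div_iff₀ hh]
          have := hA.2.2.outer hg.1 hg.2 ((hIiff v' g).1 hgi)
          linarith
        · rw [indicator_of_notMem hgi]; linarith
      rw [Real.norm_eq_abs, abs_le]
      constructor
      · refine le_min ?_ ?_ <;> linarith [abs_nonneg (ρ g)]
      · exact (min_le_right _ _).trans (by linarith)
    · exact intervalIntegrable_const.add hρi.abs
    · have hae : ∀ᵐ g : ℝ, g ≠ z ∧ g ≠ G := by
        have h1 : ∀ᵐ g : ℝ, g ≠ z := by simp [ae_iff]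
        have h2 : ∀ᵐ g : ℝ, g ≠ G := by simp [ae_iff]
        exact h1.and h2
      filter_upwards [hae] with g hg hgI
      rw [uIoc_of_le hG.le] at hgI
      have hgo : g ∈ Ioo 0 G := ⟨hgI.1, lt_of_le_of_ne hgI.2 hg.2⟩
      have hd : HasDerivAt (fun v' => Jflux VE gL v' g * Θ v' g (p v' g)) (ρ g) v := by
        have h1 : HasDerivAt (fun v' => Jflux VE gL v' g) (-(g + gL)) v := by
          unfold Jflux
          have := ((hasDerivAt_id v).const_mul (-gL)).add (((hasDerivAt_id v).const_sub VE).const_mul g)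
          refine this.congr_deriv ?_
          simp
        exact h1.mul (C.hasd v ⟨ht1, ht2⟩ g hgo)
      have hs := hasDerivAt_iff_tendsto_slope.1 hd
      have hln : l ≤ nhdsWithin v {v}ᶜ := nhdsWithin_mono _ fun x hx => ne_of_gt hx.2
      have hs := hs.mono_left hln
      have e : Tendsto (fun v' => (I v')ᶜ.indicator (fun g => q v' g / (v' - v)) g) l (nhds (ρ g)) := by
        refine hs.congr' ?_
        have hpos : 0 < |g - z| := abs_pos.2 (sub_ne_zero.2 hg.1)
        filter_upwards [small (fun t => t ^ 2 / c0) (by fun_prop) |g - z| (by simpa using hpos)] with v' h'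
        have : g ∈ (I v')ᶜ := (hIiff v' g).2 h'.le
        rw [indicator_of_mem this, slope_def_field]
      have := e.min (tendsto_const_nhds (x := |ρ g|))
      rwa [min_eq_left (le_abs_self _)] at this
  have hev := hlim.eventually (lt_mem_nhds (show (∫ g in (0:ℝ)..G, ρ g) - ε / 2 < ∫ g in (0:ℝ)..G, ρ g by linarith))
  filter_upwards [hev, hAt, hvI', s2, s3, s4, s5, s6] with v' h1 hA h' h2 h3 h4 h5 h6
  obtain ⟨hp, h7, hA⟩ := hA
  have hh : 0 < v' - v := by linarith [hA.hvv]
  set t := (v' - v) ^ (1/7:ℝ) with ht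
  rw [lt_min_iff, lt_min_iff] at h2
  have e1 : NN VE gL p G Θ v' - NN VE gL p G Θ v = ∫ g in (0:ℝ)..G, q v' g := by
    unfold NN
    rw [← intervalIntegral.integral_sub (NN_intable S C h') (NN_intable S C hvI)]
  have hqo : IntervalIntegrable ((I v')ᶜ.indicator (q v')) volume 0 G := by
    have h0 := hqi v' h'
    rw [intervalIntegrable_iff] at h0 ⊢
    exact h0.indicator measurableSet_Ioo.compl
  have hqn : IntervalIntegrable ((I v').indicator (q v')) volume 0 G := by
    have h0 := hqi v' h'
    rw [intervalIntegrable_iff] at h0 ⊢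
    exact h0.indicator measurableSet_Ioo
  have e2 : ∫ g in (0:ℝ)..G, q v' g = (∫ g in (0:ℝ)..G, (I v')ᶜ.indicator (q v') g) + ∫ g in (0:ℝ)..G, (I v').indicator (q v') g := by
    rw [← intervalIntegral.integral_add hqo hqn]
    congr 1; ext g
    rw [indicator_compl_add_self_apply]
  have e3 : (v' - v) * (∫ g in (0:ℝ)..G, F v' g) ≤ ∫ g in (0:ℝ)..G, (I v')ᶜ.indicator (q v') g := by
    rw [← intervalIntegral.integral_const_mul]
    have hFi : IntervalIntegrable (F v') volume 0 G := by
      have a1 := hint v' h'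
      have a2 := hρi.abs
      rw [intervalIntegrable_iff] at a1 a2 ⊢
      exact a1.inf a2
    refine intervalIntegral.integral_mono hG.le (hFi.const_mul _) hqo fun g => ?_
    have : F v' g ≤ (I v')ᶜ.indicator (fun g => q v' g / (v' - v)) g := min_le_left _ _
    refine (mul_le_mul_of_nonneg_left this hh.le).trans (le_of_eq ?_)
    by_cases hgi : g ∈ (I v')ᶜ
    · rw [indicator_of_mem hgi, indicator_of_mem hgi]; field_simp
    · rw [indicator_of_notMem hgi, indicator_of_notMem hgi]; simp
  have e4 : -(ε / 2) * (v' - v) ≤ ∫ g in (0:ℝ)..G, (I v').indicator (q v') g := by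
    rcases lt_or_ge z (G - δ / 2) with hc | hc
    · have hin := fun g (hg : |g - z| ≤ t ^ 2 / c0) => hA.inner hCl hK0 hlay h2.1.1.le ?_ h4.le (by linarith [h2.1.2]) (h5 hc).le hg
      swap
      · rw [← h7]
        have := mul_le_mul_of_nonneg_right h3.le (by positivity : 0 ≤ t ^ 4)
        rw [div_pow, le_div_iff₀ (by positivity)]
        nlinarith
      have hl2 := integral_layer (z := z) (D := t ^ 2 / c0) (G := G)
        (c := (VE - v) * K0 * (p v' z - p v z)) (E := K1 * (v' - v) + K2 * (t ^ 2 / c0) ^ 3) hA.hD (by linarith [h2.1.2]) (by linarith [h5 hc])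
      have hle : -(2 * (t ^ 2 / c0) * (K1 * (v' - v) + K2 * (t ^ 2 / c0) ^ 3)) ≤ ∫ g in (0:ℝ)..G, (I v').indicator (q v') g := by
        rw [← hl2]
        refine intervalIntegral.integral_mono hG.le ?_ hqn fun g => ?_
        · have : IntervalIntegrable (fun g => (VE - v) * K0 * (p v' z - p v z) * (g - z) - (K1 * (v' - v) + K2 * (t ^ 2 / c0) ^ 3)) volume 0 G := by
            apply Continuous.intervalIntegrable; fun_prop
          rw [intervalIntegrable_iff] at this ⊢
          exact this.indicator measurableSet_Ioo
        · by_cases hgi : g ∈ I v'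
          · rw [indicator_of_mem hgi]
            have hgi' : g ∈ Ioo (z - t ^ 2 / c0) (z + t ^ 2 / c0) := hgi
            rw [indicator_of_mem hgi']
            have := hin g (by rw [abs_le]; constructor <;> linarith [hgi'.1, hgi'.2])
            exact this
          · rw [indicator_of_notMem hgi]
            have hgi' : g ∉ Ioo (z - t ^ 2 / c0) (z + t ^ 2 / c0) := hgi
            rw [indicator_of_notMem hgi']
      refine le_trans ?_ hle
      have h66 := mul_le_mul_of_nonneg_right h6.le (by positivity : 0 ≤ t ^ 7)
      have e5 : 2 * (t ^ 2 / c0) * (K1 * (v' - v) + K2 * (t ^ 2 / c0) ^ 3) = (2 / c0 * K1 * t ^ 2 + 2 * K2 / c0 ^ 4 * t) * t ^ 7 := by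
        rw [← h7]; field_simp
      rw [e5]
      rw [h7] at h66 ⊢
      linarith
    · have : ∫ g in (0:ℝ)..G, (I v').indicator (q v') g = ∫ g in (0:ℝ)..G, (0:ℝ) := by
        apply intervalIntegral.integral_congr
        intro g hg
        rw [uIcc_of_le hG.le] at hg
        by_cases hgi : g ∈ I v'
        · simp only
          rw [indicator_of_mem hgi]
          have hgi' : g ∈ Ioo (z - t ^ 2 / c0) (z + t ^ 2 / c0) := hgi
          exact hA.zeroq hg (by linarith [hgi'.1, h2.2])
        · exact indicator_of_notMem hgi _
      rw [this]; simp; positivity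
  have e6 : Rd VE gL p G Θ Θd v = ∫ g in (0:ℝ)..G, ρ g := rfl
  rw [e1, e2, e6]
  have := mul_le_mul_of_nonneg_left h1.le hh.le
  linarith

end atz

section core
variable {VF VE gL gin α κ : ℝ} {p pg pgg pv : ℝ → ℝ → ℝ} {G n i1 i2 : ℝ}

lemma port_ineq (P : Port VF VE gL gin α κ p pg pgg pv G n i1 i2) {x y : ℝ} (hx : i1 < x)
    (hxy : x < y) (hy : y < i2) : Ineq VE gL p G x y := by
  have S := P.S
  intro Θ Θd C0 δ h b B hb hB hR
  have hx0 : 0 < x := P.h1.trans hx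
  have hyF : y < VF := hy.trans P.h2
  have hbi := bint hb hB
  have key : ∀ ε > 0, ∫ v in x..y, b v ≤ NN VE gL p G Θ y - NN VE gL p G Θ x + ε * (1 + (y - x)) := by
    intro ε hε
    obtain ⟨u, hui, hub, husc, huint⟩ := exists_usc hxy hb hB hε
    have mono : ∀ t t', t ≤ t' → ∫ v in t..t', u v ≤ ∫ v in t..t', b v := fun t t' htt =>
      intervalIntegral.integral_mono htt (hui _ _) (hbi _ _) fun v => (hub v).le
    have := sup_arg (F := fun t => NN VE gL p G Θ t - (∫ v in x..t, u v) + ε * t) hxy ?_ ?_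
    · simp only [intervalIntegral.integral_same] at this; linarith
    · refine ((NN_cont S h hx0.le hyF.le).sub ?_).add (by fun_prop)
      exact (intervalIntegral.continuous_primitive hui x).continuousOn
    · intro t ht
      have htF : t ∈ Ioo 0 VF := ⟨hx0.trans ht.1, ht.2.trans hyF⟩
      -- using an inequality on a right neighbourhood
      have use : ∀ t', t < t' → t' ≤ y → Ineq VE gL p G t t' →
          NN VE gL p G Θ t - (∫ v in x..t, u v) + ε * t ≤ NN VE gL p G Θ t' - (∫ v in x..t', u v) + ε * t' := by
        intro t' h1 h2 hI
        have h3 := hI Θ Θd C0 δ (h.restrict ht.1.le h2) b B hb hB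
          (fun v hv => hR v ⟨ht.1.trans hv.1, hv.2.trans_le h2⟩)
        have h4 := intervalIntegral.integral_add_adjacent_intervals (hui x t) (hui t t')
        have h5 := mono t t' h1.le
        nlinarith
      by_cases hz : t ∈ ZZ VF VE gL p G
      · by_cases hgap : ∃ b' ∈ Ioc t y, ∀ s ∈ Ioo t b', s ∉ ZZ VF VE gL p G
        · obtain ⟨b', hb', hno⟩ := hgap
          refine ⟨b', hb', use b' hb'.1 hb'.2 (gap_ineq S htF.1.le hb'.1 (hb'.2.trans hyF.le) ?_)⟩
          intro s hs
          by_contra hc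
          exact hno s hs ⟨⟨htF.1.trans hs.1, hs.2.trans_le (hb'.2.trans hyF.le)⟩, hc⟩
        · push Not at hgap
          have h1 := atZ P h hz (hx.trans ht.1) (ht.2.trans hy) ht.1 ht.2 hε
          rw [eventually_nhdsWithin_iff] at h1
          have h2 := husc t (Rd VE gL p G Θ Θd t) ((hub t).trans_le (hR t ht))
          obtain ⟨r, hr, hball⟩ := Metric.eventually_nhds_iff.1 (h1.and h2)
          obtain ⟨t', ht', hz'⟩ := hgap (min y (t + r)) ⟨lt_min ht.2 (by linarith), min_le_left _ _⟩
          have hty : t' < y := ht'.2.trans_le (min_le_left _ _)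
          have htr : t' < t + r := ht'.2.trans_le (min_le_right _ _)
          have hin : ∀ s ∈ Icc t t', dist s t < r := fun s hs => by
            rw [Real.dist_eq, abs_of_nonneg (by linarith [hs.1])]; linarith [hs.2]
          refine ⟨t', ⟨ht'.1, hty.le⟩, ?_⟩
          have h3 := (hball (hin t' ⟨ht'.1.le, le_refl _⟩)).1 ⟨hz', ht'.1⟩
          have h4 := intervalIntegral.integral_add_adjacent_intervals (hui x t) (hui t t')
          have h5 : ∫ v in t..t', u v ≤ ∫ v in t..t', Rd VE gL p G Θ Θd t :=
            intervalIntegral.integral_mono_on ht'.1.le (hui _ _) (by simp) fun s hs =>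
              (hball (hin s hs)).2.le
          rw [intervalIntegral.integral_const, smul_eq_mul] at h5
          linarith
      · have hgood : Good VE gL p G t := by
          by_contra hc; exact hz ⟨htF, hc⟩
        obtain ⟨r, hr, hI⟩ := hgood
        have hm : t < min y (t + r/2) := lt_min ht.2 (by linarith)
        exact ⟨min y (t + r/2), ⟨hm, min_le_left _ _⟩, use _ hm (min_le_left _ _)
          (hI t _ (by linarith) hm (lt_of_le_of_lt (min_le_right _ _) (by linarith)))⟩
  refine le_of_forall_pos_le_add fun ε hε => ?_
  have h1 : 0 < 1 + (y - x) := by linarith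
  have := key (ε / (1 + (y - x))) (by positivity)
  rwa [div_mul_cancel₀ _ h1.ne'] at this

theorem core_ineq (S : Sys VF VE gL gin α κ p pg pgg pv) (hG : 0 < G) {x y : ℝ} (hx : 0 ≤ x)
    (hxy : x < y) (hy : y ≤ VF) : Ineq VE gL p G x y := by
  have hZ : ¬ (ZZ VF VE gL p G).Nonempty := by
    intro hne
    obtain ⟨n, i1, i2, h1, h2, ⟨z, hz, hzi⟩, hV⟩ := baire_portion S hG hne
    have P : Port VF VE gL gin α κ p pg pgg pv G n i1 i2 := ⟨S, hG, by positivity, h1, h2, hV⟩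
    refine hz.2 ⟨min (z - i1) (i2 - z), lt_min (by linarith [hzi.1]) (by linarith [hzi.2]), ?_⟩
    intro x y hx hxy hy
    have := min_le_left (z - i1) (i2 - z)
    have := min_le_right (z - i1) (i2 - z)
    exact port_ineq P (by linarith) hxy (by linarith)
  refine gap_ineq S hx hxy hy fun t ht => ?_
  by_contra hc
  exact hZ ⟨t, ⟨hx.trans_lt ht.1, ht.2.trans_le hy⟩, hc⟩

end core

/-- compactly supported test functions in `g` -/
structure TF (φ φ1 φ2 : ℝ → ℝ) (R A : ℝ) : Prop where
  d1 : ∀ g, HasDerivAt φ (φ1 g) g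
  d2 : ∀ g, HasDerivAt φ1 (φ2 g) g
  c2 : Continuous φ2
  nn : ∀ g, 0 ≤ g → 0 ≤ φ g
  z : φ1 0 = 0
  hR : 0 < R
  supp : ∀ g, R ≤ g → φ g = 0
  supp1 : ∀ g, R ≤ g → φ1 g = 0
  supp2 : ∀ g, R ≤ g → φ2 g = 0
  hA : 0 ≤ A
  b0 : ∀ g, 0 ≤ g → φ g ≤ A * (1 + g)
  b1 : ∀ g, 0 ≤ g → |φ1 g| ≤ A
  b2 : ∀ g, 0 ≤ g → |φ2 g| ≤ A

lemma TF.cont {φ φ1 φ2 : ℝ → ℝ} {R A : ℝ} (T : TF φ φ1 φ2 R A) : Continuous φ :=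
  continuous_iff_continuousAt.2 fun g => (T.d1 g).continuousAt
lemma TF.cont1 {φ φ1 φ2 : ℝ → ℝ} {R A : ℝ} (T : TF φ φ1 φ2 R A) : Continuous φ1 :=
  continuous_iff_continuousAt.2 fun g => (T.d2 g).continuousAt

/-- bounded concave functions -/
structure CF (Φ Φ1 Φ2 : ℝ → ℝ) (B L : ℝ) : Prop where
  c0 : Continuous Φ
  m1 : Measurable Φ1
  m2 : Measurable Φ2
  d1 : ∀ y, 0 < y → HasDerivAt Φ (Φ1 y) y
  d2 : ∀ y, 0 < y → HasDerivAt Φ1 (Φ2 y) y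
  c2 : ContinuousOn Φ2 (Ioi 0)
  nn : ∀ y, 0 ≤ y → 0 ≤ Φ y
  bd : ∀ y, 0 ≤ y → Φ y ≤ B
  nn1 : ∀ y, 0 < y → 0 ≤ Φ1 y
  bd1 : ∀ y, 0 < y → Φ1 y ≤ L
  conc : ∀ y, 0 < y → y * Φ1 y ≤ Φ y
  neg2 : ∀ y, 0 < y → Φ2 y ≤ 0

section
variable {Φ Φ1 Φ2 : ℝ → ℝ} {B L : ℝ}

lemma CF.hB (F : CF Φ Φ1 Φ2 B L) : 0 ≤ B := (F.nn 0 le_rfl).trans (F.bd 0 le_rfl)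
lemma CF.hL (F : CF Φ Φ1 Φ2 B L) : 0 ≤ L := (F.nn1 1 one_pos).trans (F.bd1 1 one_pos)

lemma CF.mono (F : CF Φ Φ1 Φ2 B L) {y y' : ℝ} (hy : 0 ≤ y) (h : y ≤ y') : Φ y ≤ Φ y' := by
  have : MonotoneOn Φ (Ici 0) := monotoneOn_of_deriv_nonneg (convex_Ici 0) F.c0.continuousOn
    (by rw [interior_Ici]; exact fun x hx => (F.d1 x hx).differentiableAt.differentiableWithinAt)
    (by rw [interior_Ici]; intro x hx; rw [(F.d1 x hx).deriv]; exact F.nn1 x hx)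
  exact this hy (hy.trans h) h

lemma CF.lip' (F : CF Φ Φ1 Φ2 B L) {y y' : ℝ} (hy : 0 ≤ y) (h : y ≤ y') : Φ y' - Φ y ≤ L * (y' - y) := by
  have : MonotoneOn (fun y => L * y - Φ y) (Ici 0) := by
    have hd : ∀ x ∈ Ioi (0:ℝ), HasDerivAt (fun y => L * y - Φ y) (L * 1 - Φ1 x) x := fun x hx =>
      ((hasDerivAt_id x).const_mul L).sub (F.d1 x hx)
    have hc := F.c0
    refine monotoneOn_of_deriv_nonneg (convex_Ici 0) (by fun_prop) ?_ ?_
    · rw [interior_Ici]; exact fun x hx => (hd x hx).differentiableAt.differentiableWithinAt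
    · rw [interior_Ici]; intro x hx; rw [(hd x hx).deriv]; linarith [F.bd1 x hx]
  have := this hy (hy.trans h) h
  simp only at this; linarith

lemma CF.lip (F : CF Φ Φ1 Φ2 B L) {y y' : ℝ} (hy : 0 ≤ y) (hy' : 0 ≤ y') : |Φ y - Φ y'| ≤ L * |y - y'| := by
  rcases le_total y y' with h | h
  · have h1 := F.mono hy h
    rw [abs_sub_comm, abs_sub_comm y, abs_of_nonneg (sub_nonneg.2 h1), abs_of_nonneg (sub_nonneg.2 h)]
    exact F.lip' hy h
  · have h1 := F.mono hy' h
    rw [abs_of_nonneg (sub_nonneg.2 h1), abs_of_nonneg (sub_nonneg.2 h)]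
    exact F.lip' hy' h

lemma CF.c1 (F : CF Φ Φ1 Φ2 B L) : ContinuousOn Φ1 (Ioi 0) := fun y hy => (F.d2 y hy).continuousAt.continuousWithinAt

lemma CF.taylor (F : CF Φ Φ1 Φ2 B L) {a b C y x : ℝ} (ha : 0 < a) (hC : ∀ z ∈ Icc a b, |Φ2 z| ≤ C)
    (hx : x ∈ Icc a b) (hy : y ∈ Icc a b) : |Φ y - Φ x - Φ1 x * (y - x)| ≤ C * (y - x) ^ 2 := by
  have h0 : ∀ z ∈ Icc a b, 0 < z := fun z hz => ha.trans_le hz.1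
  have h1 : ∀ z ∈ Icc a b, |Φ1 z - Φ1 x| ≤ C * |z - x| := fun z hz =>
    (convex_Icc a b).norm_image_sub_le_of_norm_hasDerivWithin_le (fun w hw => (F.d2 w (h0 w hw)).hasDerivWithinAt) hC hx hz
  have hC0 : 0 ≤ C := (abs_nonneg _).trans (hC x hx)
  have hsub : uIcc x y ⊆ Icc a b := uIcc_subset_Icc hx hy
  have := (convex_uIcc x y).norm_image_sub_le_of_norm_hasDerivWithin_le
    (f := fun z => Φ z - Φ1 x * z) (f' := fun z => Φ1 z - Φ1 x * 1) (C := C * |y - x|)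
    (fun z hz => ((F.d1 z (h0 z (hsub hz))).sub ((hasDerivAt_id z).const_mul _)).hasDerivWithinAt)
    (fun z hz => by
      rw [mul_one, Real.norm_eq_abs]
      refine (h1 z (hsub hz)).trans (mul_le_mul_of_nonneg_left ?_ hC0)
      exact abs_sub_left_of_mem_uIcc hz)
    left_mem_uIcc right_mem_uIcc
  rw [Real.norm_eq_abs, Real.norm_eq_abs, mul_assoc, ← pow_two, sq_abs] at this
  refine le_trans (le_of_eq ?_) this
  congr 1; ring

end

section cls
variable {VF VE gL gin α κ : ℝ} {p pg pgg pv : ℝ → ℝ → ℝ} {φ φ1 φ2 : ℝ → ℝ} {R A : ℝ}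
  {Φ Φ1 Φ2 : ℝ → ℝ} {B L c1 c2 t1 t2 : ℝ}

def ThP (φ Φ : ℝ → ℝ) (c1 c2 : ℝ) (v g y : ℝ) : ℝ := (c1 + c2 * v) * φ g * Φ y
def ThPd (φ Φ Φ1 : ℝ → ℝ) (c1 c2 : ℝ) (p pv : ℝ → ℝ → ℝ) (v g : ℝ) : ℝ :=
  c2 * φ g * Φ (p v g) + (c1 + c2 * v) * φ g * (Φ1 (p v g) * pv v g)

lemma prod_layer (S : Sys VF VE gL gin α κ p pg pgg pv) (T : TF φ φ1 φ2 R A) (F : CF Φ Φ1 Φ2 B L)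
    {v : ℝ} (hv : v ∈ Ioo 0 VF) (G : ℝ) (hℓ : 0 ≤ c1 + c2 * v) :
    ∃ C η K0 : ℝ, 0 ≤ C ∧ 0 < η ∧ 0 ≤ K0 ∧ ∀ g ∈ Icc 0 G,
    |g - gJ VE gL v| ≤ η → ∀ y, 0 ≤ y → |y - p v g| ≤ η →
    |ThP φ Φ c1 c2 v g y - ThP φ Φ c1 c2 v g (p v g) - K0 * (y - p v g)| ≤
      C * ((y - p v g) ^ 2 + |g - gJ VE gL v| * |y - p v g|) := by
  set z := gJ VE gL v with hz
  have hz0 : 0 < z := gJ_pos S.hgL hv S.hVE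
  have hK : IsCompact (Icc 0 (z + 1)) := isCompact_Icc
  have hne : (Icc 0 (z + 1)).Nonempty := ⟨0, le_rfl, by linarith⟩
  have hpc := S.contg v hv
  obtain ⟨x0, hx0, hmin⟩ := hK.exists_isMinOn hne hpc.continuousOn
  obtain ⟨Mx, hMx⟩ := hK.exists_bound_of_continuousOn hpc.continuousOn
  set m := p v x0 with hm
  have hm0 : 0 < m := S.pos v hv x0 hx0.1
  have hmp : ∀ g ∈ Icc 0 (z+1), m ≤ p v g := fun g hg => hmin hg
  have hK2 : IsCompact (Icc (m/2) (Mx + m)) := isCompact_Icc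
  obtain ⟨C2, hC2⟩ := hK2.exists_bound_of_continuousOn (F.c2.mono fun x (hx : x ∈ Icc (m/2) (Mx + m)) => lt_of_lt_of_le (by positivity) hx.1)
  obtain ⟨Cφ, hCφ⟩ := hK.exists_bound_of_continuousOn T.cont.continuousOn
  have hpos : ∀ g ∈ Icc 0 (z+1), 0 < p v g := fun g hg => hm0.trans_le (hmp g hg)
  have hdc : ContinuousOn (fun g => φ1 g * Φ1 (p v g) + φ g * (Φ2 (p v g) * pg v g)) (Icc 0 (z+1)) := by
    have a1 := F.c1.comp hpc.continuousOn (s := Icc 0 (z+1)) hpos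
    have a2 := F.c2.comp hpc.continuousOn (s := Icc 0 (z+1)) hpos
    have a3 := (S.contpg v hv).mono (Icc_subset_Ici_self : Icc 0 (z+1) ⊆ Ici 0)
    exact (T.cont1.continuousOn.mul a1).add (T.cont.continuousOn.mul (a2.mul a3))
  obtain ⟨CL, hCL⟩ := hK.exists_bound_of_continuousOn hdc
  have hlip : ∀ g ∈ Icc 0 (z+1), |φ g * Φ1 (p v g) - φ z * Φ1 (p v z)| ≤ CL * |g - z| := by
    intro g hg
    refine (convex_Icc 0 (z+1)).norm_image_sub_le_of_norm_hasDerivWithin_le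
      (f := fun g => φ g * Φ1 (p v g)) (fun x hx => ?_) hCL ⟨hz0.le, by linarith⟩ hg
    have := (F.d2 _ (hpos x hx)).comp_hasDerivWithinAt x ((S.hpg v hv x hx.1).mono (Icc_subset_Ici_self : Icc 0 (z+1) ⊆ Ici 0))
    exact (T.d1 x).hasDerivWithinAt.mul this
  have hCL0 : 0 ≤ CL := (norm_nonneg _).trans (hCL 0 ⟨le_rfl, by linarith⟩)
  have hCφ0 : 0 ≤ Cφ := (norm_nonneg _).trans (hCφ 0 ⟨le_rfl, by linarith⟩)
  have hmM : m ≤ Mx := by have := hMx x0 hx0; rw [Real.norm_eq_abs] at this; exact (le_abs_self _).trans this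
  have hC20 : 0 ≤ C2 := (norm_nonneg _).trans (hC2 m ⟨by linarith, by linarith⟩)
  set ℓ := c1 + c2 * v
  refine ⟨ℓ * (Cφ * C2 + CL), min 1 (m / 2), ℓ * (φ z * Φ1 (p v z)), by positivity, by positivity,
    mul_nonneg hℓ (mul_nonneg (T.nn z hz0.le) (F.nn1 _ (hpos z ⟨hz0.le, by linarith⟩))), ?_⟩
  intro g hg hgz y hy hyp
  have hg1 : g ∈ Icc 0 (z+1) := ⟨hg.1, by linarith [(abs_le.1 (hgz.trans (min_le_left _ _))).2]⟩
  have hy2 := abs_le.1 (hyp.trans (min_le_right _ _))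
  have hpm := hmp g hg1
  have hpM : p v g ≤ Mx := (le_abs_self _).trans (hMx g hg1)
  have hty := F.taylor (a := m/2) (b := Mx + m) (by positivity) hC2 (x := p v g) (y := y) ⟨by linarith, by linarith⟩
    ⟨by linarith [hy2.1], by linarith [hy2.2]⟩
  have hl := hlip g hg1
  have e : ThP φ Φ c1 c2 v g y - ThP φ Φ c1 c2 v g (p v g) - ℓ * (φ z * Φ1 (p v z)) * (y - p v g)
     = ℓ * (φ g * (Φ y - Φ (p v g) - Φ1 (p v g) * (y - p v g)) + (φ g * Φ1 (p v g) - φ z * Φ1 (p v z)) * (y - p v g)) := by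
    unfold ThP; ring
  rw [e, abs_mul, abs_of_nonneg hℓ, mul_assoc]
  gcongr
  refine (abs_add_le _ _).trans ?_
  rw [abs_mul, abs_mul]
  have h1 : |φ g| * |Φ y - Φ (p v g) - Φ1 (p v g) * (y - p v g)| ≤ Cφ * (C2 * (y - p v g) ^ 2) := by
    gcongr; exact hCφ g hg1
  have h2 : |φ g * Φ1 (p v g) - φ z * Φ1 (p v z)| * |y - p v g| ≤ CL * |g - z| * |y - p v g| := by gcongr
  have h3 : 0 ≤ CL * (y - p v g) ^ 2 := by positivity
  have h4 : 0 ≤ Cφ * C2 * (|g - z| * |y - p v g|) := by positivity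
  nlinarith

/-- the pointwise form of `J * Θd` -/
lemma prod_JThd (S : Sys VF VE gL gin α κ p pg pgg pv) {v g : ℝ} (hv : v ∈ Ioo 0 VF) (hg : 0 < g) :
    Jflux VE gL v g * ThPd φ Φ Φ1 c1 c2 p pv v g = Jflux VE gL v g * (c2 * φ g * Φ (p v g)) +
      (c1 + c2 * v) * φ g * (Φ1 (p v g) * (α * pgg v g + κ * (g - gin) * pg v g + (g + gL + κ) * p v g)) := by
  rw [← S.pde v hv g hg]; unfold ThPd; ring

lemma prod_cls (S : Sys VF VE gL gin α κ p pg pgg pv) (T : TF φ φ1 φ2 R A) (F : CF Φ Φ1 Φ2 B L)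
    (h1 : 0 ≤ t1) (h2 : t2 ≤ VF) (hℓ : ∀ v ∈ Icc t1 t2, 0 ≤ c1 + c2 * v) :
    ∃ C0, Cls VE gL p (R + 1) t1 t2 (ThP φ Φ c1 c2) (ThPd φ Φ Φ1 c1 c2 p pv) C0 1 := by
  have hB := F.hB
  have hL := F.hL
  have hR := T.hR
  obtain ⟨Cφ, hCφ⟩ := (isCompact_Icc (a := (0:ℝ)) (b := R + 1)).exists_bound_of_continuousOn T.cont.continuousOn
  have hCφ0 : 0 ≤ Cφ := (norm_nonneg _).trans (hCφ 0 ⟨le_rfl, by linarith⟩)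
  set ℓM := |c1| + |c2| * VF with hℓM
  have hVF := S.hVF
  have hℓ0 : 0 ≤ ℓM := by positivity
  have hℓb : ∀ v ∈ Icc t1 t2, |c1 + c2 * v| ≤ ℓM := by
    intro v hv
    refine (abs_add_le _ _).trans ?_
    rw [abs_mul, abs_of_nonneg (h1.trans hv.1)]
    have := hv.2.trans h2
    simp only [hℓM]; gcongr
  have hoo : ∀ v ∈ Ioo t1 t2, v ∈ Ioo 0 VF := fun v hv => ⟨h1.trans_lt hv.1, hv.2.trans_le h2⟩
  have k1 : 0 ≤ ℓM * Cφ * B := by positivity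
  have k2 : 0 ≤ |c2| * Cφ * B := by positivity
  have k3 : 0 ≤ ℓM * Cφ * L := by positivity
  refine ⟨ℓM * Cφ * B + |c2| * Cφ * B + ℓM * Cφ * L, one_pos, le_rfl, by linarith, by positivity, ?_, ?_, ?_, ?_, ?_, ?_, ?_, ?_, ?_⟩
  · intro v hv g hg y hy
    unfold ThP
    have : |(c1 + c2 * v) * φ g * Φ y| ≤ ℓM * Cφ * B := by
      rw [abs_mul, abs_mul, abs_of_nonneg (F.nn y hy)]
      have := hℓb v hv; have := hCφ g hg; have := F.bd y hy; have := F.nn y hy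
      rw [Real.norm_eq_abs] at *
      gcongr
    linarith
  · intro v hv v' hv' g hg y hy
    unfold ThP
    have e : (c1 + c2 * v) * φ g * Φ y - (c1 + c2 * v') * φ g * Φ y = c2 * φ g * Φ y * (v - v') := by ring
    have : |(c1 + c2 * v) * φ g * Φ y - (c1 + c2 * v') * φ g * Φ y| ≤ |c2| * Cφ * B * |v - v'| := by
      rw [e, abs_mul, abs_mul, abs_mul, abs_of_nonneg (F.nn y hy)]
      have := hCφ g hg; have := F.bd y hy; have := F.nn y hy
      rw [Real.norm_eq_abs] at *
      gcongr
    refine this.trans ?_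
    gcongr; linarith
  · intro v hv g hg y y' hy hyy
    unfold ThP
    have := F.mono hy hyy
    have := hℓ v hv
    have := T.nn g hg.1
    gcongr
  · intro v hv g hg y y' hy hy'
    unfold ThP
    have e : (c1 + c2 * v) * φ g * Φ y - (c1 + c2 * v) * φ g * Φ y' = (c1 + c2 * v) * φ g * (Φ y - Φ y') := by ring
    have : |(c1 + c2 * v) * φ g * Φ y - (c1 + c2 * v) * φ g * Φ y'| ≤ ℓM * Cφ * (L * |y - y'|) := by
      rw [e, abs_mul, abs_mul]
      have := hCφ g hg; have := hℓb v hv; have := F.lip hy hy'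
      rw [Real.norm_eq_abs] at *
      gcongr
    refine this.trans ?_
    have : 0 ≤ |y - y'| := abs_nonneg _
    nlinarith
  · intro v hv g hg hgs y hy
    unfold ThP
    rw [T.supp g (by linarith)]; ring
  · intro v hv
    unfold ThP
    have hp : Measurable (p v) := S.meas.comp measurable_prodMk_left
    exact (measurable_const.mul T.cont.measurable).mul (F.c0.measurable.comp hp)
  · intro v hv g hg
    have hv0 := hoo v hv
    have a1 : HasDerivAt (fun v' => Φ (p v' g)) (Φ1 (p v g) * pv v g) v :=
      HasDerivAt.comp v (F.d1 _ (S.pos v hv0 g hg.1.le)) (S.hpv v hv0 g hg.1)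
    have a2 : HasDerivAt (fun v' => (c1 + c2 * v') * φ g) (c2 * φ g) v := by
      have := ((((hasDerivAt_id v).const_mul c2).const_add c1).mul_const (φ g))
      refine this.congr_deriv ?_
      simp
    exact a2.mul a1
  · intro v hv
    have hv0 := hoo v hv
    have hpos : ∀ g ∈ Icc 0 (R+1), 0 < p v g := fun g hg => S.pos v hv0 g hg.1
    have hpc := S.contg v hv0
    have hc : ContinuousOn (fun g => Jflux VE gL v g * (c2 * φ g * Φ (p v g)) +
      (c1 + c2 * v) * φ g * (Φ1 (p v g) * (α * pgg v g + κ * (g - gin) * pg v g + (g + gL + κ) * p v g))) (Icc 0 (R+1)) := by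
      have a1 : ContinuousOn (fun g => Φ1 (p v g)) (Icc 0 (R+1)) := F.c1.comp hpc.continuousOn hpos
      have a2 := (S.contpg v hv0).mono (Icc_subset_Ici_self : Icc 0 (R+1) ⊆ Ici 0)
      have a3 := (S.contpgg v hv0).mono (Icc_subset_Ici_self : Icc 0 (R+1) ⊆ Ici 0)
      have a4 := Jflux_contg VE gL v
      have a5 := F.c0
      have a6 := T.cont
      have a7 : Continuous (fun g => Φ (p v g)) := F.c0.comp hpc
      have a8 : ContinuousOn (fun g => κ * (g - gin)) (Icc 0 (R+1)) := by fun_prop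
      have a9 : ContinuousOn (fun g => g + gL + κ) (Icc 0 (R+1)) := by fun_prop
      exact (a4.continuousOn.mul ((continuous_const.mul a6).mul a7).continuousOn).add
        (((continuous_const.mul a6).continuousOn).mul (a1.mul (((continuousOn_const.mul a3).add (a8.mul a2)).add
          (a9.mul hpc.continuousOn))))
    have h0 : (0:ℝ) ≤ R + 1 := by linarith
    refine (hc.intervalIntegrable_of_Icc h0).congr ?_
    intro g hg
    rw [uIoc_of_le h0] at hg
    exact (prod_JThd S hv0 hg.1).symm
  · intro v hv
    exact prod_layer S T F (hoo v hv) (R+1) (hℓ v (Ioo_subset_Icc_self hv))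

end cls

section rd
variable {VF VE gL gin α κ : ℝ} {p pg pgg pv : ℝ → ℝ → ℝ} {φ φ1 φ2 : ℝ → ℝ} {R A : ℝ}
  {Φ Φ1 Φ2 : ℝ → ℝ} {B L c1 c2 t1 t2 : ℝ}

/-- the adjoint operator applied to the test function -/
def Lst (VE gL gin α κ : ℝ) (φ φ1 φ2 : ℝ → ℝ) (c1 c2 v g : ℝ) : ℝ :=
  Jflux VE gL v g * (c2 * φ g) + (c1 + c2 * v) * (α * φ2 g - κ * (g - gin) * φ1 g)

/-- boundary functional -/
def Nf (VE gL : ℝ) (p : ℝ → ℝ → ℝ) (φ Φ : ℝ → ℝ) (v : ℝ) : ℝ :=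
  ∫ g in Ioi (0:ℝ), Jflux VE gL v g * (φ g * Φ (p v g))

def I1 (VE gL gin α κ : ℝ) (p : ℝ → ℝ → ℝ) (φ φ1 φ2 Φ Φ1 : ℝ → ℝ) (c1 c2 v g : ℝ) : ℝ :=
  Φ (p v g) * Lst VE gL gin α κ φ φ1 φ2 c1 c2 v g
    - (g + gL + κ) * (Φ (p v g) - p v g * Φ1 (p v g)) * ((c1 + c2 * v) * φ g)

def Ed (α : ℝ) (p pg : ℝ → ℝ → ℝ) (φ Φ2 : ℝ → ℝ) (c1 c2 v g : ℝ) : ℝ :=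
  -(α * ((c1 + c2 * v) * φ g) * (Φ2 (p v g) * pg v g ^ 2))

lemma rd_lower (S : Sys VF VE gL gin α κ p pg pgg pv) (T : TF φ φ1 φ2 R A) (F : CF Φ Φ1 Φ2 B L)
    {v : ℝ} (hv : v ∈ Ioo 0 VF) (hℓ : 0 ≤ c1 + c2 * v) :
    (∫ g in (0:ℝ)..(R+1), (I1 VE gL gin α κ p φ φ1 φ2 Φ Φ1 c1 c2 v g + Ed α p pg φ Φ2 c1 c2 v g))
     ≤ Rd VE gL p (R+1) (ThP φ Φ c1 c2) (ThPd φ Φ Φ1 c1 c2 p pv) v := by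
  set ℓ := c1 + c2 * v with hℓd
  have hR := T.hR
  have h0 : (0:ℝ) ≤ R + 1 := by linarith
  have hpos : ∀ g ∈ Icc 0 (R+1), 0 < p v g := fun g hg => S.pos v hv g hg.1
  have hpc := S.contg v hv
  have a1 : ContinuousOn (fun g => Φ1 (p v g)) (Icc 0 (R+1)) := F.c1.comp hpc.continuousOn hpos
  have a1' : ContinuousOn (fun g => Φ2 (p v g)) (Icc 0 (R+1)) := F.c2.comp hpc.continuousOn hpos
  have a2 := (S.contpg v hv).mono (Icc_subset_Ici_self : Icc 0 (R+1) ⊆ Ici 0)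
  have a3 := (S.contpgg v hv).mono (Icc_subset_Ici_self : Icc 0 (R+1) ⊆ Ici 0)
  have a4 := (Jflux_contg VE gL v).continuousOn (s := Icc 0 (R+1))
  have a6 := T.cont.continuousOn (s := Icc 0 (R+1))
  have a61 := T.cont1.continuousOn (s := Icc 0 (R+1))
  have a62 := T.c2.continuousOn (s := Icc 0 (R+1))
  have a7 : ContinuousOn (fun g => Φ (p v g)) (Icc 0 (R+1)) := (F.c0.comp hpc).continuousOn
  have a8 : ContinuousOn (fun g => κ * (g - gin)) (Icc 0 (R+1)) := by fun_prop
  have a9 : ContinuousOn (fun g => g + gL + κ) (Icc 0 (R+1)) := by fun_prop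
  have ap := hpc.continuousOn (s := Icc 0 (R+1))
  have cI : ContinuousOn (fun g => I1 VE gL gin α κ p φ φ1 φ2 Φ Φ1 c1 c2 v g + Ed α p pg φ Φ2 c1 c2 v g) (Icc 0 (R+1)) := by
    refine ContinuousOn.add ?_ ?_
    · exact (a7.mul ((a4.mul (continuousOn_const.mul a6)).add (continuousOn_const.mul ((continuousOn_const.mul a62).sub (a8.mul a61))))).sub
        ((a9.mul (a7.sub (ap.mul a1))).mul (continuousOn_const.mul a6))
    · exact ((continuousOn_const.mul (continuousOn_const.mul a6)).mul (a1'.mul (a2.pow 2))).neg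
  set H : ℝ → ℝ := fun g => ℓ * (α * (φ g * (Φ1 (p v g) * pg v g)) - α * (φ1 g * Φ (p v g)) + κ * (g - gin) * (φ g * Φ (p v g))) with hH
  set H' : ℝ → ℝ := fun g => ℓ * (α * (φ1 g * (Φ1 (p v g) * pg v g) + φ g * (Φ2 (p v g) * pg v g * pg v g + Φ1 (p v g) * pgg v g))
     - α * (φ2 g * Φ (p v g) + φ1 g * (Φ1 (p v g) * pg v g)) +
     (κ * 1 * (φ g * Φ (p v g)) + κ * (g - gin) * (φ1 g * Φ (p v g) + φ g * (Φ1 (p v g) * pg v g)))) with hH'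
  have cH : ContinuousOn H (Icc 0 (R+1)) :=
    continuousOn_const.mul (((continuousOn_const.mul (a6.mul (a1.mul a2))).sub (continuousOn_const.mul (a61.mul a7))).add (a8.mul (a6.mul a7)))
  have cH' : ContinuousOn H' (Icc 0 (R+1)) :=
    continuousOn_const.mul (((continuousOn_const.mul ((a61.mul (a1.mul a2)).add (a6.mul (((a1'.mul a2).mul a2).add (a1.mul a3))))).sub
      (continuousOn_const.mul ((a62.mul a7).add (a61.mul (a1.mul a2))))).add ((continuousOn_const.mul (a6.mul a7)).add
        (a8.mul ((a61.mul a7).add (a6.mul (a1.mul a2))))))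
  have hd : ∀ g ∈ Ioo 0 (R+1), HasDerivAt H (H' g) g := by
    intro g hg
    have e1 := S.hpg' hv hg.1
    have e2 := S.hpgg' hv hg.1
    have hp := S.pos v hv g hg.1.le
    have w1 : HasDerivAt (fun g => Φ (p v g)) (Φ1 (p v g) * pg v g) g := HasDerivAt.comp g (F.d1 _ hp) e1
    have w2 : HasDerivAt (fun g => Φ1 (p v g)) (Φ2 (p v g) * pg v g) g := HasDerivAt.comp g (F.d2 _ hp) e1
    have e3 : HasDerivAt (fun g => κ * (g - gin)) (κ * 1) g := ((hasDerivAt_id g).sub_const gin).const_mul κ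
    exact (((((T.d1 g).mul (w2.mul e2)).const_mul α).sub (((T.d2 g).mul w1).const_mul α)).add (e3.mul ((T.d1 g).mul w1))).const_mul ℓ
  have hint := intervalIntegral.integral_eq_sub_of_hasDerivAt_of_le h0 cH hd (cH'.intervalIntegrable_of_Icc h0)
  have hHR : H (R+1) = 0 := by
    simp only [hH]; rw [T.supp (R+1) (by linarith), T.supp1 (R+1) (by linarith)]; ring
  have hH0 : H 0 ≤ 0 := by
    have hb := S.bc v hv
    have hc := F.conc _ (hpos 0 ⟨le_rfl, h0⟩)
    have : H 0 = ℓ * φ 0 * (κ * gin * (p v 0 * Φ1 (p v 0) - Φ (p v 0))) := by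
      simp only [hH]; rw [T.z]
      linear_combination ℓ * φ 0 * Φ1 (p v 0) * hb
    rw [this]
    have := T.nn 0 le_rfl; have := S.hκ; have := S.hgin
    refine mul_nonpos_of_nonneg_of_nonpos (by positivity) (mul_nonpos_of_nonneg_of_nonpos (by positivity) (by linarith))
  have hRd : Rd VE gL p (R+1) (ThP φ Φ c1 c2) (ThPd φ Φ Φ1 c1 c2 p pv) v =
      ∫ g in (0:ℝ)..(R+1), (H' g + (I1 VE gL gin α κ p φ φ1 φ2 Φ Φ1 c1 c2 v g + Ed α p pg φ Φ2 c1 c2 v g)) := by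
    unfold Rd
    apply intervalIntegral.integral_congr_ae
    refine Eventually.of_forall fun g hg => ?_
    rw [uIoc_of_le h0] at hg
    rw [prod_JThd S hv hg.1]
    simp only [hH', I1, Ed, Lst, ThP, ← hℓd]
    ring
  rw [hRd, intervalIntegral.integral_add (cH'.intervalIntegrable_of_Icc h0) (cI.intervalIntegrable_of_Icc h0), hint, hHR]
  linarith

lemma Ed_nonneg (S : Sys VF VE gL gin α κ p pg pgg pv) (T : TF φ φ1 φ2 R A) (F : CF Φ Φ1 Φ2 B L)
    {v g : ℝ} (hv : v ∈ Ioo 0 VF) (hg : 0 ≤ g) (hℓ : 0 ≤ c1 + c2 * v) : 0 ≤ Ed α p pg φ Φ2 c1 c2 v g := by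
  unfold Ed
  have := S.hα; have := T.nn g hg; have := F.neg2 _ (S.pos v hv g hg)
  rw [neg_nonneg]
  exact mul_nonpos_of_nonneg_of_nonpos (by positivity) (mul_nonpos_of_nonpos_of_nonneg this (by positivity))

lemma Lst_cont (T : TF φ φ1 φ2 R A) : Continuous (fun x : ℝ × ℝ => Lst VE gL gin α κ φ φ1 φ2 c1 c2 x.1 x.2) := by
  unfold Lst Jflux
  have := T.cont; have := T.cont1; have := T.c2
  fun_prop

lemma I1_meas (S : Sys VF VE gL gin α κ p pg pgg pv) (T : TF φ φ1 φ2 R A) (F : CF Φ Φ1 Φ2 B L) :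
    Measurable (fun x : ℝ × ℝ => I1 VE gL gin α κ p φ φ1 φ2 Φ Φ1 c1 c2 x.1 x.2) := by
  unfold I1
  have h1 : Measurable (fun x : ℝ × ℝ => p x.1 x.2) := S.meas
  have h2 : Measurable (fun x : ℝ × ℝ => Φ (p x.1 x.2)) := F.c0.measurable.comp h1
  have h3 : Measurable (fun x : ℝ × ℝ => Φ1 (p x.1 x.2)) := F.m1.comp h1
  have h4 := (Lst_cont T (VE := VE) (gL := gL) (gin := gin) (α := α) (κ := κ) (c1 := c1) (c2 := c2)).measurable
  have h5 : Measurable (fun x : ℝ × ℝ => φ x.2) := T.cont.measurable.comp measurable_snd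
  exact (h2.mul h4).sub ((((measurable_snd.add_const gL).add_const κ).mul (h2.sub (h1.mul h3))).mul
    (((measurable_fst.const_mul c2).const_add c1).mul h5))

lemma Ed_meas (S : Sys VF VE gL gin α κ p pg pgg pv) (T : TF φ φ1 φ2 R A) (F : CF Φ Φ1 Φ2 B L) :
    Measurable (fun x : ℝ × ℝ => Ed α p pg φ Φ2 c1 c2 x.1 x.2) := by
  unfold Ed
  have h1 : Measurable (fun x : ℝ × ℝ => p x.1 x.2) := S.meas
  have h1' : Measurable (fun x : ℝ × ℝ => pg x.1 x.2) := S.measpg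
  have h3 : Measurable (fun x : ℝ × ℝ => Φ2 (p x.1 x.2)) := F.m2.comp h1
  have h5 : Measurable (fun x : ℝ × ℝ => φ x.2) := T.cont.measurable.comp measurable_snd
  exact ((((((measurable_fst.const_mul c2).const_add c1).mul h5).const_mul α).mul (h3.mul (h1'.pow_const 2)))).neg

lemma I1_zero (T : TF φ φ1 φ2 R A) {v g : ℝ} (hg : R ≤ g) : I1 VE gL gin α κ p φ φ1 φ2 Φ Φ1 c1 c2 v g = 0 := by
  unfold I1 Lst; rw [T.supp g hg, T.supp1 g hg, T.supp2 g hg]; ring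
lemma Ed_zero (T : TF φ φ1 φ2 R A) {v g : ℝ} (hg : R ≤ g) : Ed α p pg φ Φ2 c1 c2 v g = 0 := by
  unfold Ed; rw [T.supp g hg]; ring

lemma Ioi_to_int {f : ℝ → ℝ} (hR : 0 < R) (hf : ∀ g, R ≤ g → f g = 0) :
    ∫ g in Ioi (0:ℝ), f g = ∫ g in (0:ℝ)..(R+1), f g := by
  rw [intervalIntegral.integral_of_le (by linarith)]
  apply setIntegral_eq_of_subset_of_forall_sdiff_eq_zero measurableSet_Ioi (fun x hx => hx.1)
  intro x hx
  apply hf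
  by_contra h
  exact hx.2 ⟨hx.1, by linarith⟩

lemma Lst_bdd (T : TF φ φ1 φ2 R A) (VF : ℝ) :
    ∃ C, 0 ≤ C ∧ ∀ v ∈ Icc 0 VF, ∀ g ∈ Icc 0 (R+1), |Lst VE gL gin α κ φ φ1 φ2 c1 c2 v g| ≤ C := by
  obtain ⟨C, hC⟩ := ((isCompact_Icc (a := (0:ℝ)) (b := VF)).prod (isCompact_Icc (a := (0:ℝ)) (b := R+1))).exists_bound_of_continuousOn
    (Lst_cont T (VE := VE) (gL := gL) (gin := gin) (α := α) (κ := κ) (c1 := c1) (c2 := c2)).continuousOn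
  exact ⟨max C 0, le_max_right _ _, fun v hv g hg => (hC (v,g) ⟨hv, hg⟩).trans (le_max_left _ _)⟩

/-- bound of the zero order term by `C * Φ` -/
lemma I1_bd (S : Sys VF VE gL gin α κ p pg pgg pv) (T : TF φ φ1 φ2 R A) :
    ∃ C, 0 ≤ C ∧ ∀ (Φ Φ1 Φ2 : ℝ → ℝ) (B L : ℝ), CF Φ Φ1 Φ2 B L → ∀ v ∈ Ioo 0 VF, ∀ g, 0 ≤ g →
      |I1 VE gL gin α κ p φ φ1 φ2 Φ Φ1 c1 c2 v g| ≤ C * Φ (p v g) := by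
  obtain ⟨C, hC0, hC⟩ := Lst_bdd T VF (VE := VE) (gL := gL) (gin := gin) (α := α) (κ := κ) (c1 := c1) (c2 := c2)
  have hcc : Continuous (fun x : ℝ × ℝ => (x.2 + gL + κ) * ((c1 + c2 * x.1) * φ x.2)) := by
    have := T.cont; fun_prop
  obtain ⟨C', hC'⟩ := ((isCompact_Icc (a := (0:ℝ)) (b := VF)).prod (isCompact_Icc (a := (0:ℝ)) (b := R+1))).exists_bound_of_continuousOn
    hcc.continuousOn
  refine ⟨C + max C' 0, by positivity, ?_⟩
  intro Φ Φ1 Φ2 B L F v hv g hg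
  have hp := S.pos v hv g hg
  have hΦ := F.nn _ hp.le
  rcases le_or_gt R g with h | h
  · rw [I1_zero T h, abs_zero]; positivity
  have hg' : g ∈ Icc 0 (R+1) := ⟨hg, by linarith⟩
  have hv' := Ioo_subset_Icc_self hv
  have k1 := hC v hv' g hg'
  have k2 : |(g + gL + κ) * ((c1 + c2 * v) * φ g)| ≤ max C' 0 := (hC' (v,g) ⟨hv', hg'⟩).trans (le_max_left _ _)
  have k3 := F.conc _ hp
  have k4 := mul_nonneg hp.le (F.nn1 _ hp)
  unfold I1
  have e : (g + gL + κ) * (Φ (p v g) - p v g * Φ1 (p v g)) * ((c1 + c2 * v) * φ g) =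
    ((g + gL + κ) * ((c1 + c2 * v) * φ g)) * (Φ (p v g) - p v g * Φ1 (p v g)) := by ring
  rw [e]
  refine (abs_sub _ _).trans ?_
  rw [abs_mul, abs_mul _ (Φ (p v g) - _), abs_of_nonneg hΦ, abs_of_nonneg (sub_nonneg.2 k3), add_mul C, mul_comm (Φ _)]
  refine add_le_add (mul_le_mul_of_nonneg_right k1 hΦ) (mul_le_mul k2 (sub_le_self _ k4) (sub_nonneg.2 k3) (le_max_right _ _))

lemma compact_intble {f : ℝ × ℝ → ℝ} {C : ℝ} (hf : Measurable f) (hz : ∀ x, R ≤ x.2 → f x = 0)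
    (hb : ∀ x ∈ Ioo t1 t2 ×ˢ Ioi (0:ℝ), |f x| ≤ C) : IntegrableOn f (Ioo t1 t2 ×ˢ Ioi (0:ℝ)) := by
  have : IntegrableOn f (Ioo t1 t2 ×ˢ Ioo (0:ℝ) R) := by
    refine Measure.integrableOn_of_bounded (M := C) ?_ hf.aestronglyMeasurable ?_
    · rw [Measure.volume_eq_prod, Measure.prod_prod]
      exact (ENNReal.mul_lt_top measure_Ioo_lt_top measure_Ioo_lt_top).ne
    · refine (ae_restrict_iff' (measurableSet_Ioo.prod measurableSet_Ioo)).2 (Eventually.of_forall fun x hx => hb x ⟨hx.1, hx.2.1⟩)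
  refine this.of_forall_sdiff_eq_zero (measurableSet_Ioo.prod measurableSet_Ioi) ?_
  intro x hx
  apply hz
  by_contra h
  exact hx.2 ⟨hx.1.1, hx.1.2, not_le.1 h⟩

theorem prod_ineq (S : Sys VF VE gL gin α κ p pg pgg pv) (T : TF φ φ1 φ2 R A) (F : CF Φ Φ1 Φ2 B L)
    (h1 : 0 ≤ t1) (h12 : t1 < t2) (h2 : t2 ≤ VF) (hℓ : ∀ v ∈ Icc t1 t2, 0 ≤ c1 + c2 * v) {K : ℝ} (hK : 0 ≤ K) :
    IntegrableOn (fun x : ℝ × ℝ => I1 VE gL gin α κ p φ φ1 φ2 Φ Φ1 c1 c2 x.1 x.2) (Ioo t1 t2 ×ˢ Ioi (0:ℝ)) ∧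
    (∀ v ∈ Ioo t1 t2, IntegrableOn (Ed α p pg φ Φ2 c1 c2 v) (Ioi 0)) ∧
    Measurable (fun v => ∫ g in Ioi (0:ℝ), Ed α p pg φ Φ2 c1 c2 v g) ∧
    (∫ x in Ioo t1 t2 ×ˢ Ioi (0:ℝ), I1 VE gL gin α κ p φ φ1 φ2 Φ Φ1 c1 c2 x.1 x.2) +
      ∫ v in Ioo t1 t2, min (∫ g in Ioi (0:ℝ), Ed α p pg φ Φ2 c1 c2 v g) K
     ≤ (c1 + c2 * t2) * Nf VE gL p φ Φ t2 - (c1 + c2 * t1) * Nf VE gL p φ Φ t1 := by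
  have hR := T.hR
  have h0 : (0:ℝ) ≤ R + 1 := by linarith
  have hoo : ∀ v ∈ Ioo t1 t2, v ∈ Ioo 0 VF := fun v hv => ⟨h1.trans_lt hv.1, hv.2.trans_le h2⟩
  obtain ⟨C, hC0, hC⟩ := I1_bd S T (c1 := c1) (c2 := c2)
  have hCB : ∀ v ∈ Ioo t1 t2, ∀ g, 0 ≤ g → |I1 VE gL gin α κ p φ φ1 φ2 Φ Φ1 c1 c2 v g| ≤ C * B := by
    intro v hv g hg
    refine (hC Φ Φ1 Φ2 B L F v (hoo v hv) g hg).trans ?_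
    have := F.bd _ (S.nonneg v g)
    gcongr
  have hI : IntegrableOn (fun x : ℝ × ℝ => I1 VE gL gin α κ p φ φ1 φ2 Φ Φ1 c1 c2 x.1 x.2) (Ioo t1 t2 ×ˢ Ioi (0:ℝ)) :=
    compact_intble (I1_meas S T F) (fun x hx => I1_zero T hx) (fun x hx => hCB x.1 hx.1 x.2 (le_of_lt hx.2))
  have hEi : ∀ v ∈ Ioo t1 t2, IntervalIntegrable (Ed α p pg φ Φ2 c1 c2 v) volume 0 (R+1) := by
    intro v hv'
    have hv := hoo v hv'
    have hpos : ∀ g ∈ Icc 0 (R+1), 0 < p v g := fun g hg => S.pos v hv g hg.1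
    have a1' : ContinuousOn (fun g => Φ2 (p v g)) (Icc 0 (R+1)) := F.c2.comp (S.contg v hv).continuousOn hpos
    have a2 := (S.contpg v hv).mono (Icc_subset_Ici_self : Icc 0 (R+1) ⊆ Ici 0)
    have a6 := T.cont.continuousOn (s := Icc 0 (R+1))
    have : ContinuousOn (Ed α p pg φ Φ2 c1 c2 v) (Icc 0 (R+1)) :=
      ((continuousOn_const.mul (continuousOn_const.mul a6)).mul (a1'.mul (a2.pow 2))).neg
    exact this.intervalIntegrable_of_Icc h0
  have hEi' : ∀ v ∈ Ioo t1 t2, IntegrableOn (Ed α p pg φ Φ2 c1 c2 v) (Ioi 0) := by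
    intro v hv
    refine ((intervalIntegrable_iff_integrableOn_Ioc_of_le h0).1 (hEi v hv)).of_forall_sdiff_eq_zero measurableSet_Ioi ?_
    intro x hx
    apply Ed_zero T
    by_contra h
    exact hx.2 ⟨hx.1, by linarith⟩
  have hEm : Measurable (fun v => ∫ g in Ioi (0:ℝ), Ed α p pg φ Φ2 c1 c2 v g) :=
    ((Ed_meas S T F).stronglyMeasurable.integral_prod_right (ν := volume.restrict (Ioi (0:ℝ)))).measurable
  have hIm : Measurable (fun v => ∫ g in Ioi (0:ℝ), I1 VE gL gin α κ p φ φ1 φ2 Φ Φ1 c1 c2 v g) :=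
    ((I1_meas S T F).stronglyMeasurable.integral_prod_right (ν := volume.restrict (Ioi (0:ℝ)))).measurable
  refine ⟨hI, hEi', hEm, ?_⟩
  obtain ⟨C0, hcls⟩ := prod_cls S T F h1 h2 hℓ
  have core := core_ineq S (G := R+1) (by linarith) h1 h12 h2 _ _ _ _ hcls
  set f1 : ℝ → ℝ := fun v => ∫ g in Ioi (0:ℝ), I1 VE gL gin α κ p φ φ1 φ2 Φ Φ1 c1 c2 v g with hf1
  set f2 : ℝ → ℝ := fun v => ∫ g in Ioi (0:ℝ), Ed α p pg φ Φ2 c1 c2 v g with hf2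
  have hf1b : ∀ v ∈ Ioo t1 t2, |f1 v| ≤ C * B * (R+1) := by
    intro v hv
    simp only [hf1]
    rw [Ioi_to_int hR (fun g hg => I1_zero T hg)]
    have := intervalIntegral.norm_integral_le_of_norm_le_const (a := 0) (b := R+1) (C := C * B)
      (f := fun g => I1 VE gL gin α κ p φ φ1 φ2 Φ Φ1 c1 c2 v g) (fun g hg => by
        rw [uIoc_of_le h0] at hg; exact hCB v hv g hg.1.le)
    rwa [sub_zero, abs_of_nonneg h0] at this
  have hf2n : ∀ v ∈ Ioo t1 t2, 0 ≤ f2 v := fun v hv => setIntegral_nonneg measurableSet_Ioi fun g hg =>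
    Ed_nonneg S T F (hoo v hv) (le_of_lt hg) (hℓ v (Ioo_subset_Icc_self hv))
  set b : ℝ → ℝ := (Ioo t1 t2).indicator (fun v => f1 v + min (f2 v) K) with hb
  have hbm : Measurable b := (hIm.add (hEm.min measurable_const)).indicator measurableSet_Ioo
  have hbb : ∀ v, |b v| ≤ C * B * (R+1) + K := by
    intro v
    have hB := F.hB
    by_cases hv : v ∈ Ioo t1 t2
    · simp only [hb]; rw [indicator_of_mem hv]
      refine (abs_add_le _ _).trans (add_le_add (hf1b v hv) ?_)
      rw [abs_of_nonneg (le_min (hf2n v hv) hK)]; exact min_le_right _ _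
    · simp only [hb]; rw [indicator_of_notMem hv, abs_zero]; positivity
  have := core b _ hbm hbb (fun v hv => by
    simp only [hb]; rw [indicator_of_mem hv]
    refine le_trans ?_ (rd_lower S T F (hoo v hv) (hℓ v (Ioo_subset_Icc_self hv)))
    rw [intervalIntegral.integral_add _ (hEi v hv)]
    · simp only [hf1, hf2]
      rw [Ioi_to_int hR (fun g hg => I1_zero T hg), Ioi_to_int hR (fun g hg => Ed_zero T hg)]
      gcongr; exact min_le_left _ _
    · rw [intervalIntegrable_iff_integrableOn_Ioc_of_le h0]
      refine Measure.integrableOn_of_bounded (M := C * B) measure_Ioc_lt_top.ne ?_ ?_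
      · exact ((I1_meas S T F).comp measurable_prodMk_left).aestronglyMeasurable
      · exact (ae_restrict_iff' measurableSet_Ioc).2 (Eventually.of_forall fun g hg => hCB v hv g hg.1.le))
  have hN : ∀ t, NN VE gL p (R+1) (ThP φ Φ c1 c2) t = (c1 + c2 * t) * Nf VE gL p φ Φ t := by
    intro t
    unfold NN Nf
    rw [Ioi_to_int hR (fun g hg => by rw [T.supp g hg]; ring), ← intervalIntegral.integral_const_mul]
    congr 1; ext g; unfold ThP; ring
  rw [hN, hN] at this
  refine le_trans (le_of_eq ?_) this
  rw [intervalIntegral.integral_of_le h12.le, ← integral_Ioc_eq_integral_Ioo, hb, setIntegral_indicator measurableSet_Ioo,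
    inter_eq_right.2 Ioo_subset_Ioc_self, integral_add]
  · rw [Measure.volume_eq_prod, setIntegral_prod _ (by rw [← Measure.volume_eq_prod]; exact hI), integral_Ioc_eq_integral_Ioo]
  · refine Measure.integrableOn_of_bounded (M := C * B * (R+1)) measure_Ioo_lt_top.ne hIm.aestronglyMeasurable ?_
    exact (ae_restrict_iff' measurableSet_Ioo).2 (Eventually.of_forall fun v hv => hf1b v hv)
  · refine Measure.integrableOn_of_bounded (M := K) measure_Ioo_lt_top.ne (hEm.min measurable_const).aestronglyMeasurable ?_
    refine (ae_restrict_iff' measurableSet_Ioo).2 (Eventually.of_forall fun v hv => ?_)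
    rw [Real.norm_eq_abs, abs_of_nonneg (le_min (hf2n v hv) hK)]; exact min_le_right _ _

end rd

/-! ### cutoffs -/

def chi (x : ℝ) : ℝ := max (1 - max (x - 1) 0 ^ 3) 0 ^ 3
def chi1 (x : ℝ) : ℝ := -9 * (max (1 - max (x - 1) 0 ^ 3) 0 ^ 2 * max (x - 1) 0 ^ 2)
def chi2 (x : ℝ) : ℝ := 54 * (max (1 - max (x - 1) 0 ^ 3) 0 * max (x - 1) 0 ^ 4) - 18 * (max (1 - max (x - 1) 0 ^ 3) 0 ^ 2 * max (x - 1) 0)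

lemma chi_hd (x : ℝ) : HasDerivAt chi (chi1 x) x := by
  have h1 : HasDerivAt (fun x : ℝ => max (x - 1) 0 ^ 3) ((1 + 2 : ℕ) * (max (x-1) 0) ^ (1 + 1) * 1) x :=
    HasDerivAt.comp (h₂ := fun x : ℝ => max x 0 ^ 3) (h := fun x : ℝ => x - 1) x (hasDerivAt_max_pow 1 (x-1)) ((hasDerivAt_id x).sub_const 1)
  have h2 := HasDerivAt.comp x (hasDerivAt_max_pow 1 (1 - max (x-1) 0 ^ 3)) (h1.const_sub 1)
  refine h2.congr_deriv ?_
  unfold chi1; push_cast; ring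

lemma chi1_hd (x : ℝ) : HasDerivAt chi1 (chi2 x) x := by
  have h1 : HasDerivAt (fun x : ℝ => max (x - 1) 0 ^ 3) ((1 + 2 : ℕ) * (max (x-1) 0) ^ (1 + 1) * 1) x :=
    HasDerivAt.comp (h₂ := fun x : ℝ => max x 0 ^ 3) (h := fun x : ℝ => x - 1) x (hasDerivAt_max_pow 1 (x-1)) ((hasDerivAt_id x).sub_const 1)
  have h2 := HasDerivAt.comp x (hasDerivAt_max_pow 0 (1 - max (x-1) 0 ^ 3)) (h1.const_sub 1)
  have h3 : HasDerivAt (fun x : ℝ => max (x - 1) 0 ^ 2) ((0 + 2 : ℕ) * (max (x-1) 0) ^ (0 + 1) * 1) x :=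
    HasDerivAt.comp (h₂ := fun x : ℝ => max x 0 ^ 2) (h := fun x : ℝ => x - 1) x (hasDerivAt_max_pow 0 (x-1)) ((hasDerivAt_id x).sub_const 1)
  have h4 := (h2.mul h3).const_mul (-9)
  refine h4.congr_deriv ?_
  simp only [Function.comp]
  unfold chi2; push_cast; ring

lemma chi2_cont : Continuous chi2 := by unfold chi2; fun_prop

lemma chi_one {x : ℝ} (hx : x ≤ 1) : chi x = 1 ∧ chi1 x = 0 ∧ chi2 x = 0 := by
  unfold chi chi1 chi2; rw [max_eq_right (by linarith : x - 1 ≤ 0)]; norm_num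

lemma chi_two {x : ℝ} (hx : 2 ≤ x) : chi x = 0 ∧ chi1 x = 0 ∧ chi2 x = 0 := by
  have h1 : 1 ≤ max (x-1) 0 ^ 3 := one_le_pow₀ (by rw [max_eq_left (by linarith)]; linarith)
  unfold chi chi1 chi2; rw [max_eq_right (by linarith : 1 - max (x-1) 0 ^ 3 ≤ 0)]; norm_num

lemma chi_bd (x : ℝ) : 0 ≤ chi x ∧ chi x ≤ 1 ∧ |chi1 x| ≤ 9 ∧ |chi2 x| ≤ 72 := by
  rcases le_or_gt 2 x with h | h
  · obtain ⟨a, b, c⟩ := chi_two h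
    rw [a, b, c]; norm_num
  unfold chi chi1 chi2
  set t := max (x-1) 0
  have t0 : 0 ≤ t := le_max_right _ _
  have t1 : t ≤ 1 := max_le (by linarith) zero_le_one
  set m := max (1 - t^3) 0
  have m0 : 0 ≤ m := le_max_right _ _
  have m1 : m ≤ 1 := max_le (by linarith [pow_nonneg t0 3]) zero_le_one
  have k1 : m^2 * t^2 ≤ 1 := mul_le_one₀ (pow_le_one₀ m0 m1) (by positivity) (pow_le_one₀ t0 t1)
  have k2 : m * t^4 ≤ 1 := mul_le_one₀ m1 (by positivity) (pow_le_one₀ t0 t1)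
  have k3 : m^2 * t ≤ 1 := mul_le_one₀ (pow_le_one₀ m0 m1) (by positivity) t1
  have k1' : 0 ≤ m^2 * t^2 := by positivity
  have k2' : 0 ≤ m * t^4 := by positivity
  have k3' : 0 ≤ m^2 * t := by positivity
  refine ⟨by positivity, pow_le_one₀ m0 m1, abs_le.2 ⟨by linarith, by linarith⟩, abs_le.2 ⟨by linarith, by linarith⟩⟩

/-- growing test functions -/
structure GF (φ φ1 φ2 : ℝ → ℝ) (A : ℝ) : Prop where
  d1 : ∀ g, HasDerivAt φ (φ1 g) g
  d2 : ∀ g, HasDerivAt φ1 (φ2 g) g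
  c2 : Continuous φ2
  nn : ∀ g, 0 ≤ g → 0 ≤ φ g
  z : φ1 0 = 0
  hA : 0 ≤ A
  b0 : ∀ g, 0 ≤ g → φ g ≤ A * (1 + g)
  b1 : ∀ g, 0 ≤ g → |φ1 g| ≤ A
  b2 : ∀ g, 0 ≤ g → |φ2 g| ≤ A

def cut (φ : ℝ → ℝ) (R g : ℝ) : ℝ := φ g * chi (g / R)
def cut1 (φ φ1 : ℝ → ℝ) (R g : ℝ) : ℝ := φ1 g * chi (g / R) + φ g * (chi1 (g / R) / R)
def cut2 (φ φ1 φ2 : ℝ → ℝ) (R g : ℝ) : ℝ := φ2 g * chi (g / R) + φ1 g * (chi1 (g / R) / R) +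
  (φ1 g * (chi1 (g / R) / R) + φ g * (chi2 (g / R) / R / R))

lemma GF.cut_TF {φ φ1 φ2 : ℝ → ℝ} {A R : ℝ} (T : GF φ φ1 φ2 A) (hR : 1 ≤ R) :
    TF (cut φ R) (cut1 φ φ1 R) (cut2 φ φ1 φ2 R) (2 * R) (235 * A) := by
  have hR0 : 0 < R := by linarith
  have hA := T.hA
  have e0 : ∀ g, HasDerivAt (fun g => g / R) (1 / R) g := fun g => (hasDerivAt_id g).div_const R
  have e1 : ∀ g, HasDerivAt (fun g => chi (g / R)) (chi1 (g/R) / R) g := fun g => by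
    have := HasDerivAt.comp g (chi_hd (g/R)) (e0 g)
    refine this.congr_deriv (by ring)
  have e2 : ∀ g, HasDerivAt (fun g => chi1 (g / R) / R) (chi2 (g/R) / R / R) g := fun g => by
    have := (HasDerivAt.comp g (chi1_hd (g/R)) (e0 g)).div_const R
    refine this.congr_deriv (by ring)
  have cφ : Continuous φ := continuous_iff_continuousAt.2 fun g => (T.d1 g).continuousAt
  have cφ1 : Continuous φ1 := continuous_iff_continuousAt.2 fun g => (T.d2 g).continuousAt
  have cc : Continuous chi := continuous_iff_continuousAt.2 fun g => (chi_hd g).continuousAt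
  have cc1 : Continuous chi1 := continuous_iff_continuousAt.2 fun g => (chi1_hd g).continuousAt
  have cc2 := chi2_cont
  have cφ2 := T.c2
  have h2 : ∀ g, 2 * R ≤ g → 2 ≤ g / R := fun g hg => by rw [le_div_iff₀ hR0]; exact hg
  have key1 : ∀ g, 0 ≤ g → |φ g * (chi1 (g/R) / R)| ≤ 27 * A := by
    intro g hg
    rcases le_or_gt (2*R) g with h | h
    · rw [(chi_two (h2 g h)).2.1]; simp; exact hA
    have a1 := T.b0 g hg
    have a2 := T.nn g hg
    have a3 := (chi_bd (g/R)).2.2.1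
    rw [abs_mul, abs_div, abs_of_nonneg a2, abs_of_pos hR0, ← mul_div_assoc, div_le_iff₀ hR0]
    calc φ g * |chi1 (g/R)| ≤ (A * (1 + g)) * 9 := by gcongr
      _ ≤ 27 * A * R := by nlinarith
  have key2 : ∀ g, 0 ≤ g → |φ g * (chi2 (g/R) / R / R)| ≤ 216 * A := by
    intro g hg
    rcases le_or_gt (2*R) g with h | h
    · rw [(chi_two (h2 g h)).2.2]; simp; exact hA
    have a1 := T.b0 g hg
    have a2 := T.nn g hg
    have a3 := (chi_bd (g/R)).2.2.2
    rw [abs_mul, abs_div, abs_div, abs_of_nonneg a2, abs_of_pos hR0, div_div, ← mul_div_assoc, div_le_iff₀ (by positivity)]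
    calc φ g * |chi2 (g/R)| ≤ (A * (1 + g)) * 72 := by gcongr
      _ ≤ A * (3 * R) * 72 := by gcongr; linarith
      _ = 216 * A * (R * 1) := by ring
      _ ≤ 216 * A * (R * R) := by gcongr
  have key3 : ∀ g, 0 ≤ g → |φ1 g * chi (g/R)| ≤ A := by
    intro g hg
    rw [abs_mul, abs_of_nonneg (chi_bd (g/R)).1]
    exact (mul_le_of_le_one_right (abs_nonneg _) (chi_bd _).2.1).trans (T.b1 g hg)
  have key4 : ∀ g, 0 ≤ g → |φ2 g * chi (g/R)| ≤ A := by
    intro g hg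
    rw [abs_mul, abs_of_nonneg (chi_bd (g/R)).1]
    exact (mul_le_of_le_one_right (abs_nonneg _) (chi_bd _).2.1).trans (T.b2 g hg)
  have key5 : ∀ g, 0 ≤ g → |φ1 g * (chi1 (g/R) / R)| ≤ 9 * A := by
    intro g hg
    have a1 := T.b1 g hg
    have a3 := (chi_bd (g/R)).2.2.1
    rw [abs_mul, abs_div, abs_of_pos hR0]
    have : |chi1 (g/R)| / R ≤ 9 := (div_le_self (abs_nonneg _) hR).trans a3
    rw [mul_comm 9 A]
    gcongr
  refine ⟨fun g => (T.d1 g).mul (e1 g), fun g => ((T.d2 g).mul (e1 g)).add ((T.d1 g).mul (e2 g)), ?_, ?_, ?_, by positivity, ?_, ?_, ?_, by positivity, ?_, ?_, ?_⟩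
  · unfold cut2; fun_prop
  · intro g hg; exact mul_nonneg (T.nn g hg) (chi_bd _).1
  · unfold cut1; rw [T.z, zero_div, (chi_one zero_le_one).2.1]; simp
  · intro g hg; unfold cut; rw [(chi_two (h2 g hg)).1]; simp
  · intro g hg; unfold cut1; rw [(chi_two (h2 g hg)).1, (chi_two (h2 g hg)).2.1]; simp
  · intro g hg; unfold cut2; rw [(chi_two (h2 g hg)).1, (chi_two (h2 g hg)).2.1, (chi_two (h2 g hg)).2.2]; simp
  · intro g hg
    unfold cut
    have := mul_le_of_le_one_right (T.nn g hg) (chi_bd (g/R)).2.1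
    have := T.b0 g hg
    have : 0 ≤ A * (1+g) := by positivity
    nlinarith
  · intro g hg; unfold cut1
    refine (abs_add_le _ _).trans ?_
    linarith [key1 g hg, key3 g hg]
  · intro g hg; unfold cut2
    refine (abs_add_le _ _).trans ((add_le_add (abs_add_le _ _) (abs_add_le _ _)).trans ?_)
    linarith [key2 g hg, key4 g hg, key5 g hg]

lemma GF_one : GF (fun _ => 1) (fun _ => 0) (fun _ => 0) 1 :=
  ⟨fun g => hasDerivAt_const g _, fun g => hasDerivAt_const g _, continuous_const, fun _ _ => zero_le_one, rfl, zero_le_one,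
    fun g hg => by linarith, fun g _ => by simp, fun g _ => by simp⟩

lemma cut_eq {φ : ℝ → ℝ} {R g : ℝ} (hR : 0 < R) (hg : g ≤ R) : cut φ R g = φ g := by
  unfold cut; rw [(chi_one (by rw [div_le_one hR]; exact hg)).1, mul_one]
lemma cut_eq1 {φ φ1 : ℝ → ℝ} {R g : ℝ} (hR : 0 < R) (hg : g ≤ R) : cut1 φ φ1 R g = φ1 g := by
  have h := chi_one (x := g / R) (by rw [div_le_one hR]; exact hg)
  unfold cut1; rw [h.1, h.2.1]; simp
lemma cut_eq2 {φ φ1 φ2 : ℝ → ℝ} {R g : ℝ} (hR : 0 < R) (hg : g ≤ R) : cut2 φ φ1 φ2 R g = φ2 g := by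
  have h := chi_one (x := g / R) (by rw [div_le_one hR]; exact hg)
  unfold cut2; rw [h.1, h.2.1, h.2.2]; simp

/-- pointwise size of the adjoint operator -/
lemma Lst_growth {VF VE gL gin α κ : ℝ} (hVF : 0 < VF) (hVE : VF < VE) (hgL : 0 < gL) (hgin : 0 < gin) (hα : 0 < α) (hκ : 0 < κ)
    {φ φ1 φ2 : ℝ → ℝ} {R A c1 c2 : ℝ} (T : TF φ φ1 φ2 R A)
    {v g : ℝ} (hv : v ∈ Icc 0 VF) (hg : 0 ≤ g) :
    |Lst VE gL gin α κ φ φ1 φ2 c1 c2 v g| ≤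
      A * ((gL * VF + VE) * |c2| + (|c1| + |c2| * VF) * (α + κ * (1 + gin))) * (1 + g) ^ 2 := by
  have hA := T.hA
  have hV0 : 0 < VE := by linarith
  have hJ : |Jflux VE gL v g| ≤ (gL * VF + VE) * (1 + g) := by
    unfold Jflux
    have h1 : gL * v ≤ gL * VF := by gcongr; exact hv.2
    have h2 : 0 ≤ gL * v := mul_nonneg hgL.le hv.1
    have h3 : g * (VE - v) ≤ g * VE := by gcongr; linarith [hv.1]
    have h4 : 0 ≤ g * (VE - v) := mul_nonneg hg (by linarith [hv.2])
    have h5 : 0 ≤ gL * VF * g := by positivity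
    rw [abs_le]; constructor <;> nlinarith
  have hℓ : |c1 + c2 * v| ≤ |c1| + |c2| * VF := by
    refine (abs_add_le _ _).trans ?_
    rw [abs_mul, abs_of_nonneg hv.1]; gcongr; exact hv.2
  have hgg : |g - gin| ≤ (1 + gin) * (1 + g) := by
    rw [abs_le]; constructor <;> nlinarith
  have h0 : |φ g| ≤ A * (1 + g) := by rw [abs_of_nonneg (T.nn g hg)]; exact T.b0 g hg
  have h1 := T.b1 g hg
  have h2 := T.b2 g hg
  unfold Lst
  refine (abs_add_le _ _).trans ?_
  have q1 : |Jflux VE gL v g * (c2 * φ g)| ≤ (gL * VF + VE) * (1 + g) * (|c2| * (A * (1 + g))) := by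
    rw [abs_mul, abs_mul]; gcongr
  have q2 : |α * φ2 g - κ * (g - gin) * φ1 g| ≤ A * (α + κ * (1 + gin)) * (1 + g) ^ 2 := by
    refine (abs_sub _ _).trans ?_
    rw [abs_mul, abs_mul, abs_mul, abs_of_pos hα, abs_of_pos hκ]
    calc α * |φ2 g| + κ * |g - gin| * |φ1 g| ≤ α * A + κ * ((1 + gin) * (1 + g)) * A := by gcongr
      _ ≤ α * A * (1+g)^2 + κ * ((1 + gin) * (1 + g)^2) * A := by
        have : 1 ≤ (1+g)^2 := one_le_pow₀ (by linarith)
        have k2 : 1 + g ≤ (1+g)^2 := by nlinarith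
        have k3 : 0 ≤ α * A := by positivity
        gcongr ?_ + _ * (_ * ?_) * _; nlinarith
      _ = _ := by ring
  rw [abs_mul (c1 + c2 * v)]
  calc _ ≤ (gL * VF + VE) * (1 + g) * (|c2| * (A * (1 + g))) + (|c1| + |c2| * VF) * (A * (α + κ * (1 + gin)) * (1 + g) ^ 2) := by gcongr
    _ = _ := by ring

open Topology

/-! ### the mass balance -/

lemma fatou_bd {X : Type*} [MeasurableSpace X] {μ : Measure X} {f : ℕ → X → ℝ} {F : X → ℝ} {C : ENNReal}
    (hm : ∀ n, AEMeasurable (f n) μ) (hl : ∀ᵐ x ∂μ, Tendsto (fun n => f n x) atTop (𝓝 (F x)))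
    (hb : ∀ᶠ n in atTop, ∫⁻ x, ENNReal.ofReal (f n x) ∂μ ≤ C) : ∫⁻ x, ENNReal.ofReal (F x) ∂μ ≤ C := by
  calc ∫⁻ x, ENNReal.ofReal (F x) ∂μ = ∫⁻ x, liminf (fun n => ENNReal.ofReal (f n x)) atTop ∂μ := by
        apply lintegral_congr_ae
        filter_upwards [hl] with x hx
        exact ((ENNReal.continuous_ofReal.tendsto _).comp hx).liminf_eq.symm
    _ ≤ liminf (fun n => ∫⁻ x, ENNReal.ofReal (f n x) ∂μ) atTop :=
        lintegral_liminf_le' fun n => (hm n).ennreal_ofReal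
    _ ≤ C := by
        refine liminf_le_of_frequently_le' hb.frequently

def Ek (k y : ℝ) : ℝ := k * (1 - exp (-y / k))

lemma expCF {k : ℝ} (hk : 0 < k) : CF (Ek k) (fun y => exp (-y/k)) (fun y => -(exp (-y/k) / k)) k 1 := by
  have e0 : ∀ y : ℝ, HasDerivAt (fun y => exp (-y/k)) (-(exp (-y/k)/k)) y := fun y => by
    have := ((hasDerivAt_id y).neg.div_const k).exp
    refine this.congr_deriv ?_
    simp only [Pi.neg_apply, id]; ring
  have hle : ∀ y : ℝ, 0 ≤ y → exp (-y/k) ≤ 1 := fun y hy => by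
    rw [exp_le_one_iff]; exact div_nonpos_of_nonpos_of_nonneg (by linarith) hk.le
  refine ⟨by unfold Ek; fun_prop, by fun_prop, by fun_prop, ?_, fun y _ => e0 y, by fun_prop, ?_, ?_, ?_, ?_, ?_, ?_⟩
  · intro y _
    have := ((e0 y).const_sub 1).const_mul k
    refine this.congr_deriv ?_
    field_simp
  · intro y hy; unfold Ek; exact mul_nonneg hk.le (by linarith [hle y hy])
  · intro y hy; unfold Ek; have := exp_pos (-y/k); nlinarith
  · intro y hy; exact (exp_pos _).le
  · intro y hy; exact hle y hy.le
  · intro y hy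
    unfold Ek
    have h := add_one_le_exp (y/k)
    have h2 : exp (-y/k) * exp (y/k) = 1 := by rw [← exp_add, neg_div, neg_add_cancel, exp_zero]
    have h3 := exp_pos (-y/k)
    have h4 : exp (-y/k) * (y/k + 1) ≤ 1 := (mul_le_mul_of_nonneg_left h h3.le).trans_eq h2
    have h6 : y * exp (-y/k) = k * (exp (-y/k) * (y/k)) := by field_simp
    rw [h6]
    exact mul_le_mul_of_nonneg_left (by linarith) hk.le
  · intro y hy; rw [neg_nonpos]; positivity

lemma Ek_le {k y : ℝ} (hk : 0 < k) : Ek k y ≤ y := by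
  unfold Ek
  have := add_one_le_exp (-y/k)
  calc k * (1 - exp (-y/k)) ≤ k * (-(-y/k)) := by gcongr; linarith
    _ = y := by field_simp

lemma Ek_ge {k y : ℝ} (hk : 0 < k) (hy : 0 ≤ y) : y - y ^ 2 / k ≤ Ek k y := by
  unfold Ek
  set x := y / k with hx
  have hx0 : 0 ≤ x := by positivity
  have h := add_one_le_exp x
  have h2 : exp (-y/k) * exp x = 1 := by rw [← exp_add, hx, neg_div, neg_add_cancel, exp_zero]
  have h3 := exp_pos (-y/k)
  have h5 : y = k * x := by rw [hx]; field_simp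
  have h6 : exp (-y/k) ≤ 1 - x + x ^ 2 := by
    have h4 : exp (-y/k) * (x + 1) ≤ 1 := (mul_le_mul_of_nonneg_left h h3.le).trans_eq h2
    have h7 : 1 ≤ (1 - x + x^2) * (x + 1) := by nlinarith [pow_nonneg hx0 3]
    exact le_of_mul_le_mul_right (h4.trans h7) (by positivity)
  calc y - y^2/k = k * (x - x^2) := by rw [hx]; field_simp
    _ ≤ k * (1 - exp (-y/k)) := mul_le_mul_of_nonneg_left (by linarith) hk.le

lemma tnat : Tendsto (fun n : ℕ => (n:ℝ) + 1) atTop atTop :=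
  tendsto_atTop_add_const_right _ _ tendsto_natCast_atTop_atTop

lemma Ek_lim {y : ℝ} (hy : 0 ≤ y) : Tendsto (fun n : ℕ => Ek (n+1) y) atTop (𝓝 y) := by
  refine tendsto_of_tendsto_of_tendsto_of_le_of_le (g := fun n : ℕ => y - y^2 / ((n:ℝ)+1)) ?_ tendsto_const_nhds
    (fun n => Ek_ge (by positivity) hy) (fun n => Ek_le (by positivity))
  have := (tendsto_const_nhds (x := y^2)).div_atTop tnat
  simpa using this.const_sub y

lemma exp_lim (y : ℝ) : Tendsto (fun n : ℕ => exp (-y/((n:ℝ)+1))) atTop (𝓝 1) := by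
  have := (tendsto_const_nhds (x := -y)).div_atTop tnat
  have h := (continuous_exp.tendsto 0).comp this
  rw [exp_zero] at h
  exact h

/-- boundary and integrability information -/
structure Bdy (VF VE gL : ℝ) (p : ℝ → ℝ → ℝ) : Prop where
  int : IntegrableOn (fun x : ℝ × ℝ => p x.1 x.2) (Ioo 0 VF ×ˢ Ioi (0:ℝ))
  bv : ∀ g, 0 < g → Jflux VE gL VF g * p VF g = Jflux VE gL 0 g * p 0 g
  low : ∀ g, 0 < g → g < gJ VE gL VF → p 0 g = 0 ∧ p VF g = 0

section mass
variable {VF VE gL gin α κ : ℝ} {p pg pgg pv : ℝ → ℝ → ℝ} {φ φ1 φ2 : ℝ → ℝ} {R A : ℝ}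
  {c1 c2 t1 t2 : ℝ}

lemma S_measp (S : Sys VF VE gL gin α κ p pg pgg pv) (v : ℝ) : Measurable (p v) := S.meas.comp measurable_prodMk_left

lemma Nint_mid (S : Sys VF VE gL gin α κ p pg pgg pv) (T : TF φ φ1 φ2 R A) {v : ℝ} (hv : v ∈ Ioo 0 VF) :
    IntegrableOn (fun g => Jflux VE gL v g * (φ g * p v g)) (Ioi 0) := by
  have h0 : (0:ℝ) ≤ R := T.hR.le
  have hc : Continuous (fun g => Jflux VE gL v g * (φ g * p v g)) :=
    (Jflux_contg VE gL v).mul (T.cont.mul (S.contg v hv))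
  refine ((intervalIntegrable_iff_integrableOn_Ioc_of_le h0).1 (hc.intervalIntegrable 0 R)).of_forall_sdiff_eq_zero measurableSet_Ioi ?_
  intro x hx
  have : R ≤ x := by
    by_contra h
    exact hx.2 ⟨hx.1, by linarith⟩
  rw [T.supp x this]; ring

lemma NE_int (S : Sys VF VE gL gin α κ p pg pgg pv) (T : TF φ φ1 φ2 R A) {Φ Φ1 Φ2 : ℝ → ℝ} {B L : ℝ} (F : CF Φ Φ1 Φ2 B L) (v : ℝ) :
    IntegrableOn (fun g => Jflux VE gL v g * (φ g * Φ (p v g))) (Ioi 0) := by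
  have h0 : (0:ℝ) ≤ R := T.hR.le
  have hc : Continuous (fun g => Jflux VE gL v g * φ g) := (Jflux_contg VE gL v).mul T.cont
  have : IntegrableOn (fun g => Jflux VE gL v g * φ g * Φ (p v g)) (Ioc 0 R) := by
    refine Integrable.mul_bdd (c := B) ((intervalIntegrable_iff_integrableOn_Ioc_of_le h0).1 (hc.intervalIntegrable 0 R)) ?_ ?_
    · exact (F.c0.measurable.comp (S_measp S v)).aestronglyMeasurable
    · refine Eventually.of_forall fun g => ?_
      rw [Real.norm_eq_abs, abs_of_nonneg (F.nn _ (S.nonneg v g))]; exact F.bd _ (S.nonneg v g)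
  have h2 := this.of_forall_sdiff_eq_zero (t := Ioi 0) measurableSet_Ioi (by
    intro x hx
    have : R ≤ x := by
      by_contra h
      exact hx.2 ⟨hx.1, by linarith⟩
    rw [T.supp x this]; ring)
  refine h2.congr_fun (fun g _ => by ring) measurableSet_Ioi

lemma Qsub (h1 : 0 ≤ t1) (h2 : t2 ≤ VF) : Ioo t1 t2 ×ˢ Ioi (0:ℝ) ⊆ Ioo 0 VF ×ˢ Ioi (0:ℝ) :=
  prod_mono (Ioo_subset_Ioo h1 h2) le_rfl

lemma Qmeas : MeasurableSet (Ioo t1 t2 ×ˢ Ioi (0:ℝ)) := measurableSet_Ioo.prod measurableSet_Ioi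

lemma pint_bd (S : Sys VF VE gL gin α κ p pg pgg pv) (Y : Bdy VF VE gL p) (h1 : 0 ≤ t1) (h2 : t2 ≤ VF) :
    ∫ x in Ioo t1 t2 ×ˢ Ioi (0:ℝ), p x.1 x.2 ≤ ∫ x in Ioo 0 VF ×ˢ Ioi (0:ℝ), p x.1 x.2 :=
  setIntegral_mono_set Y.int (Eventually.of_forall fun x => S.nonneg x.1 x.2) (Qsub h1 h2).eventuallyLE

lemma Nint_zero (S : Sys VF VE gL gin α κ p pg pgg pv) (Y : Bdy VF VE gL p) (T : TF φ φ1 φ2 R A) :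
    IntegrableOn (fun g => Jflux VE gL 0 g * (φ g * p 0 g)) (Ioi 0) := by
  have hVF := S.hVF
  have hVE := S.hVE
  obtain ⟨C, hC0, hC⟩ := I1_bd S T (c1 := 1) (c2 := 0)
  have hJ0 : ∀ g, Jflux VE gL 0 g = g * VE := fun g => by unfold Jflux; ring
  have hmid : VF/2 ∈ Ioo 0 VF := ⟨by linarith, by linarith⟩
  set M := (∫ g in Ioi (0:ℝ), |Jflux VE gL (VF/2) g * (φ g * p (VF/2) g)|) + C * ∫ x in Ioo 0 VF ×ˢ Ioi (0:ℝ), p x.1 x.2 with hM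
  have hbound : ∀ n : ℕ, Nf VE gL p φ (Ek (n+1)) 0 ≤ M := by
    intro n
    have hk : (0:ℝ) < (n:ℝ)+1 := by positivity
    have F := expCF hk
    obtain ⟨i1, -, -, i2⟩ := prod_ineq S T F (c1 := 1) (c2 := 0) (t1 := 0) (t2 := VF/2) le_rfl (by linarith) (by linarith) (fun v _ => by norm_num) le_rfl
    have i3 : 0 ≤ ∫ v in Ioo 0 (VF/2), min (∫ g in Ioi (0:ℝ), Ed α p pg φ (fun y => -(exp (-y/((n:ℝ)+1)) / ((n:ℝ)+1))) 1 0 v g) 0 := by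
      refine setIntegral_nonneg measurableSet_Ioo fun v hv => le_min ?_ le_rfl
      exact setIntegral_nonneg measurableSet_Ioi fun g hg => Ed_nonneg S T F ⟨hv.1, by linarith [hv.2]⟩ (le_of_lt hg) (by norm_num)
    have i4 : -(C * ∫ x in Ioo 0 VF ×ˢ Ioi (0:ℝ), p x.1 x.2) ≤ ∫ x in Ioo 0 (VF/2) ×ˢ Ioi (0:ℝ), I1 VE gL gin α κ p φ φ1 φ2 (Ek (n+1)) (fun y => exp (-y/((n:ℝ)+1))) 1 0 x.1 x.2 := by
      have h1 : 0 ≤ (0:ℝ) := le_rfl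
      have h2 : VF/2 ≤ VF := by linarith
      calc -(C * ∫ x in Ioo 0 VF ×ˢ Ioi (0:ℝ), p x.1 x.2) ≤ -(C * ∫ x in Ioo 0 (VF/2) ×ˢ Ioi (0:ℝ), p x.1 x.2) := by
            exact neg_le_neg (mul_le_mul_of_nonneg_left (pint_bd S Y h1 h2) hC0)
        _ = ∫ x in Ioo 0 (VF/2) ×ˢ Ioi (0:ℝ), -(C * p x.1 x.2) := by
            rw [integral_neg, integral_const_mul]
        _ ≤ _ := by
            refine setIntegral_mono_on ((Y.int.mono_set (Qsub h1 h2)).const_mul C).neg i1 Qmeas fun x hx => ?_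
            have := hC _ _ _ _ _ F x.1 ⟨hx.1.1, by linarith [hx.1.2]⟩ x.2 (le_of_lt hx.2)
            have h3 : C * Ek (n+1) (p x.1 x.2) ≤ C * p x.1 x.2 := by gcongr; exact Ek_le hk
            exact neg_le.1 ((neg_le_abs _).trans (this.trans h3))
    have i5 : Nf VE gL p φ (Ek (n+1)) (VF/2) ≤ ∫ g in Ioi (0:ℝ), |Jflux VE gL (VF/2) g * (φ g * p (VF/2) g)| := by
      unfold Nf
      refine setIntegral_mono_on (NE_int S T F _) (Nint_mid S T hmid).abs measurableSet_Ioi fun g hg => ?_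
      have a1 := F.nn _ (S.nonneg (VF/2) g)
      have a2 : Ek (n+1) (p (VF/2) g) ≤ p (VF/2) g := Ek_le hk
      refine (le_abs_self _).trans ?_
      rw [abs_mul, abs_mul, abs_mul, abs_mul, abs_of_nonneg a1, abs_of_nonneg (S.nonneg (VF/2) g)]
      gcongr
    simp only [zero_mul, add_zero, one_mul] at i2
    linarith
  have hmeas : ∀ n : ℕ, Measurable (fun g => Jflux VE gL 0 g * (φ g * Ek (n+1) (p 0 g))) := fun n =>
    (Jflux_contg VE gL 0).measurable.mul (T.cont.measurable.mul ((expCF (k := (n:ℝ)+1) (by positivity)).c0.measurable.comp (S_measp S 0)))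
  have hfat : ∫⁻ g in Ioi (0:ℝ), ENNReal.ofReal (Jflux VE gL 0 g * (φ g * p 0 g)) ≤ ENNReal.ofReal M := by
    refine fatou_bd (f := fun n g => Jflux VE gL 0 g * (φ g * Ek (n+1) (p 0 g))) (fun n => (hmeas n).aemeasurable) ?_ ?_
    · refine Eventually.of_forall fun g => ?_
      exact ((Ek_lim (S.nonneg 0 g)).const_mul _).const_mul _
    · refine Eventually.of_forall fun n => ?_
      have F := expCF (k := (n:ℝ)+1) (by positivity)
      rw [← ofReal_integral_eq_lintegral_ofReal (NE_int S T F 0)]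
      · exact ENNReal.ofReal_le_ofReal (hbound n)
      · refine (ae_restrict_iff' measurableSet_Ioi).2 (Eventually.of_forall fun g hg => ?_)
        have a1 := F.nn _ (S.nonneg 0 g)
        have a2 := T.nn g (le_of_lt hg)
        have a3 : (0:ℝ) < g := hg
        have : 0 < VE := by linarith
        simp only [hJ0, Pi.zero_apply]; positivity
  refine ⟨((Jflux_contg VE gL 0).measurable.mul (T.cont.measurable.mul (S_measp S 0))).aestronglyMeasurable, ?_⟩
  rw [hasFiniteIntegral_iff_ofReal]
  · exact hfat.trans_lt ENNReal.ofReal_lt_top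
  · refine (ae_restrict_iff' measurableSet_Ioi).2 (Eventually.of_forall fun g hg => ?_)
    have a1 := S.nonneg 0 g
    have a2 := T.nn g (le_of_lt hg)
    have a3 : (0:ℝ) < g := hg
    have : 0 < VE := by linarith
    simp only [hJ0, Pi.zero_apply]; positivity

lemma Nint (S : Sys VF VE gL gin α κ p pg pgg pv) (Y : Bdy VF VE gL p) (T : TF φ φ1 φ2 R A) {v : ℝ} (hv : v ∈ Icc 0 VF) :
    IntegrableOn (fun g => Jflux VE gL v g * (φ g * p v g)) (Ioi 0) := by
  rcases hv.1.eq_or_lt with h | h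
  · rw [← h]; exact Nint_zero S Y T
  rcases hv.2.eq_or_lt with h' | h'
  · rw [h']
    refine (Nint_zero S Y T).congr_fun (fun g hg => ?_) measurableSet_Ioi
    have := Y.bv g hg
    linear_combination -φ g * this
  · exact Nint_mid S T ⟨h, h'⟩

lemma Np_eq (Y : Bdy VF VE gL p) : Nf VE gL p φ (fun y => y) VF = Nf VE gL p φ (fun y => y) 0 := by
  unfold Nf
  refine setIntegral_congr_fun measurableSet_Ioi fun g hg => ?_
  have := Y.bv g hg
  simp only
  linear_combination φ g * this

lemma Nf_lim (S : Sys VF VE gL gin α κ p pg pgg pv) (Y : Bdy VF VE gL p) (T : TF φ φ1 φ2 R A) {v : ℝ} (hv : v ∈ Icc 0 VF) :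
    Tendsto (fun n : ℕ => Nf VE gL p φ (Ek (n+1)) v) atTop (𝓝 (Nf VE gL p φ (fun y => y) v)) := by
  unfold Nf
  refine tendsto_integral_of_dominated_convergence (fun g => |Jflux VE gL v g * (φ g * p v g)|) (fun n => ?_) (Nint S Y T hv).abs (fun n => ?_) ?_
  · exact (NE_int S T (expCF (k := (n:ℝ)+1) (by positivity)) v).1
  · refine Eventually.of_forall fun g => ?_
    have F := expCF (k := (n:ℝ)+1) (by positivity)
    have a1 := F.nn _ (S.nonneg v g)
    have a2 : Ek (n+1) (p v g) ≤ p v g := Ek_le (by positivity)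
    rw [Real.norm_eq_abs, abs_mul, abs_mul, abs_mul, abs_mul, abs_of_nonneg a1, abs_of_nonneg (S.nonneg v g)]
    gcongr
  · exact Eventually.of_forall fun g => ((Ek_lim (S.nonneg v g)).const_mul _).const_mul _

lemma pL_int (S : Sys VF VE gL gin α κ p pg pgg pv) (Y : Bdy VF VE gL p) (T : TF φ φ1 φ2 R A) (c1 c2 : ℝ) (h1 : 0 ≤ t1) (h2 : t2 ≤ VF) :
    IntegrableOn (fun x : ℝ × ℝ => p x.1 x.2 * Lst VE gL gin α κ φ φ1 φ2 c1 c2 x.1 x.2) (Ioo t1 t2 ×ˢ Ioi (0:ℝ)) := by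
  obtain ⟨C, hC0, hC⟩ := Lst_bdd T VF (VE := VE) (gL := gL) (gin := gin) (α := α) (κ := κ) (c1 := c1) (c2 := c2)
  refine Integrable.mul_bdd (c := C) (Y.int.mono_set (Qsub h1 h2)) (Lst_cont T).aestronglyMeasurable ?_
  refine (ae_restrict_iff' Qmeas).2 (Eventually.of_forall fun x hx => ?_)
  rcases le_or_gt R x.2 with h | h
  · unfold Lst; rw [T.supp _ h, T.supp1 _ h, T.supp2 _ h]; simpa using hC0
  · exact hC x.1 ⟨by linarith [hx.1.1], by linarith [hx.1.2]⟩ x.2 ⟨le_of_lt hx.2, by linarith⟩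

/-- slack in the mass balance -/
def Slk (VE gL gin α κ : ℝ) (p : ℝ → ℝ → ℝ) (φ φ1 φ2 : ℝ → ℝ) (c1 c2 t1 t2 : ℝ) : ℝ :=
  (c1 + c2 * t2) * Nf VE gL p φ (fun y => y) t2 - (c1 + c2 * t1) * Nf VE gL p φ (fun y => y) t1 -
    ∫ x in Ioo t1 t2 ×ˢ Ioi (0:ℝ), p x.1 x.2 * Lst VE gL gin α κ φ φ1 φ2 c1 c2 x.1 x.2

lemma mass_ineq (S : Sys VF VE gL gin α κ p pg pgg pv) (Y : Bdy VF VE gL p) (T : TF φ φ1 φ2 R A)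
    (h1 : 0 ≤ t1) (h12 : t1 ≤ t2) (h2 : t2 ≤ VF) (hℓ : ∀ v ∈ Icc t1 t2, 0 ≤ c1 + c2 * v) :
    0 ≤ Slk VE gL gin α κ p φ φ1 φ2 c1 c2 t1 t2 := by
  unfold Slk
  rcases h12.eq_or_lt with h | h12
  · subst h; simp
  rw [sub_nonneg]
  obtain ⟨C, hC0, hC⟩ := I1_bd S T (c1 := c1) (c2 := c2)
  have hoo : ∀ v ∈ Ioo t1 t2, v ∈ Ioo 0 VF := fun v hv => ⟨h1.trans_lt hv.1, hv.2.trans_le h2⟩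
  have key : ∀ n : ℕ, ∫ x in Ioo t1 t2 ×ˢ Ioi (0:ℝ), I1 VE gL gin α κ p φ φ1 φ2 (Ek (n+1)) (fun y => exp (-y/((n:ℝ)+1))) c1 c2 x.1 x.2 ≤
     (c1 + c2 * t2) * Nf VE gL p φ (Ek (n+1)) t2 - (c1 + c2 * t1) * Nf VE gL p φ (Ek (n+1)) t1 := by
    intro n
    have F := expCF (k := (n:ℝ)+1) (by positivity)
    obtain ⟨i1, -, -, i2⟩ := prod_ineq S T F h1 h12 h2 hℓ le_rfl
    have i3 : 0 ≤ ∫ v in Ioo t1 t2, min (∫ g in Ioi (0:ℝ), Ed α p pg φ (fun y => -(exp (-y/((n:ℝ)+1)) / ((n:ℝ)+1))) c1 c2 v g) 0 := by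
      refine setIntegral_nonneg measurableSet_Ioo fun v hv => le_min ?_ le_rfl
      exact setIntegral_nonneg measurableSet_Ioi fun g hg => Ed_nonneg S T F (hoo v hv) (le_of_lt hg) (hℓ v (Ioo_subset_Icc_self hv))
    linarith
  refine le_of_tendsto_of_tendsto ?_ (((Nf_lim S Y T ⟨h1.trans h12.le, h2⟩).const_mul _).sub ((Nf_lim S Y T ⟨h1, h12.le.trans h2⟩).const_mul _))
    (Eventually.of_forall key)
  refine tendsto_integral_of_dominated_convergence (fun x => C * p x.1 x.2) (fun n => ?_) ((Y.int.mono_set (Qsub h1 h2)).const_mul C) (fun n => ?_) ?_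
  · exact (I1_meas S T (expCF (k := (n:ℝ)+1) (by positivity))).aestronglyMeasurable
  · refine (ae_restrict_iff' Qmeas).2 (Eventually.of_forall fun x hx => ?_)
    refine (hC _ _ _ _ _ (expCF (k := (n:ℝ)+1) (by positivity)) x.1 (hoo _ hx.1) x.2 (le_of_lt hx.2)).trans ?_
    gcongr; exact Ek_le (by positivity)
  · refine Eventually.of_forall fun x => ?_
    have hp := S.nonneg x.1 x.2
    have a := Ek_lim hp
    have b := exp_lim (p x.1 x.2)
    have := (a.mul_const (Lst VE gL gin α κ φ φ1 φ2 c1 c2 x.1 x.2)).sub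
      (((a.sub (b.const_mul (p x.1 x.2))).const_mul (x.2 + gL + κ)).mul_const ((c1 + c2 * x.1) * φ x.2))
    unfold I1
    refine this.trans_eq ?_
    congr 1; ring

end mass

section masseq
variable {VF VE gL gin α κ : ℝ} {p pg pgg pv : ℝ → ℝ → ℝ} {φ φ1 φ2 : ℝ → ℝ} {R A : ℝ}
  {c1 c2 t1 t2 : ℝ}

lemma Slk_sub (S : Sys VF VE gL gin α κ p pg pgg pv) (Y : Bdy VF VE gL p) (T : TF φ φ1 φ2 R A)
    {χ χ1 χ2 : ℝ → ℝ} {R' A' : ℝ} (T' : TF χ χ1 χ2 R' A') (M : ℝ) (h1 : 0 ≤ t1) (h12 : t1 ≤ t2) (h2 : t2 ≤ VF) :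
    Slk VE gL gin α κ p (fun g => M * χ g - φ g) (fun g => M * χ1 g - φ1 g) (fun g => M * χ2 g - φ2 g) c1 c2 t1 t2 =
      M * Slk VE gL gin α κ p χ χ1 χ2 c1 c2 t1 t2 - Slk VE gL gin α κ p φ φ1 φ2 c1 c2 t1 t2 := by
  have hN : ∀ v ∈ Icc 0 VF, Nf VE gL p (fun g => M * χ g - φ g) (fun y => y) v =
      M * Nf VE gL p χ (fun y => y) v - Nf VE gL p φ (fun y => y) v := by
    intro v hv
    unfold Nf
    rw [← integral_const_mul, ← integral_sub ((Nint S Y T' hv).const_mul M) (Nint S Y T hv)]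
    congr 1; ext g; ring
  have hL : ∫ x in Ioo t1 t2 ×ˢ Ioi (0:ℝ), p x.1 x.2 * Lst VE gL gin α κ (fun g => M * χ g - φ g) (fun g => M * χ1 g - φ1 g) (fun g => M * χ2 g - φ2 g) c1 c2 x.1 x.2 =
     M * (∫ x in Ioo t1 t2 ×ˢ Ioi (0:ℝ), p x.1 x.2 * Lst VE gL gin α κ χ χ1 χ2 c1 c2 x.1 x.2) -
     ∫ x in Ioo t1 t2 ×ˢ Ioi (0:ℝ), p x.1 x.2 * Lst VE gL gin α κ φ φ1 φ2 c1 c2 x.1 x.2 := by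
    rw [← integral_const_mul, ← integral_sub ((pL_int S Y T' c1 c2 h1 h2).const_mul M) (pL_int S Y T c1 c2 h1 h2)]
    congr 1; ext x; unfold Lst; ring
  unfold Slk
  rw [hN t2 ⟨h1.trans h12, h2⟩, hN t1 ⟨h1, h12.trans h2⟩, hL]; ring

lemma Slk_lin (S : Sys VF VE gL gin α κ p pg pgg pv) (Y : Bdy VF VE gL p) (T : TF φ φ1 φ2 R A)
    (M : ℝ) (h1 : 0 ≤ t1) (h2 : t2 ≤ VF) :
    Slk VE gL gin α κ p φ φ1 φ2 (M - c1) (-c2) t1 t2 =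
      M * Slk VE gL gin α κ p φ φ1 φ2 1 0 t1 t2 - Slk VE gL gin α κ p φ φ1 φ2 c1 c2 t1 t2 := by
  have hL : ∫ x in Ioo t1 t2 ×ˢ Ioi (0:ℝ), p x.1 x.2 * Lst VE gL gin α κ φ φ1 φ2 (M - c1) (-c2) x.1 x.2 =
     M * (∫ x in Ioo t1 t2 ×ˢ Ioi (0:ℝ), p x.1 x.2 * Lst VE gL gin α κ φ φ1 φ2 1 0 x.1 x.2) -
     ∫ x in Ioo t1 t2 ×ˢ Ioi (0:ℝ), p x.1 x.2 * Lst VE gL gin α κ φ φ1 φ2 c1 c2 x.1 x.2 := by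
    rw [← integral_const_mul, ← integral_sub ((pL_int S Y T 1 0 h1 h2).const_mul M) (pL_int S Y T c1 c2 h1 h2)]
    congr 1; ext x; unfold Lst; ring
  unfold Slk
  rw [hL]; ring

lemma Slk_add (S : Sys VF VE gL gin α κ p pg pgg pv) (Y : Bdy VF VE gL p) (T : TF φ φ1 φ2 R A)
    {t3 : ℝ} (h1 : 0 ≤ t1) (h12 : t1 ≤ t2) (h23 : t2 ≤ t3) (h3 : t3 ≤ VF) :
    Slk VE gL gin α κ p φ φ1 φ2 c1 c2 t1 t2 + Slk VE gL gin α κ p φ φ1 φ2 c1 c2 t2 t3 = Slk VE gL gin α κ p φ φ1 φ2 c1 c2 t1 t3 := by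
  have key : ∀ a b : ℝ, 0 ≤ a → a ≤ b → b ≤ VF →
      (∫ x in Ioo a b ×ˢ Ioi (0:ℝ), p x.1 x.2 * Lst VE gL gin α κ φ φ1 φ2 c1 c2 x.1 x.2) =
      (∫ v in a..b, ∫ g in Ioi (0:ℝ), p v g * Lst VE gL gin α κ φ φ1 φ2 c1 c2 v g) ∧
      IntervalIntegrable (fun v => ∫ g in Ioi (0:ℝ), p v g * Lst VE gL gin α κ φ φ1 φ2 c1 c2 v g) volume a b := by
    intro a b ha hab hb
    have hi := pL_int S Y T c1 c2 ha hb
    constructor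
    · rw [Measure.volume_eq_prod, setIntegral_prod _ (by rw [← Measure.volume_eq_prod]; exact hi), intervalIntegral.integral_of_le hab,
        integral_Ioc_eq_integral_Ioo]
    · rw [intervalIntegrable_iff_integrableOn_Ioo_of_le hab]
      unfold IntegrableOn at hi
      rw [Measure.volume_eq_prod, ← Measure.prod_restrict] at hi
      exact hi.integral_prod_left
  have k1 := key t1 t2 h1 h12 (h23.trans h3)
  have k2 := key t2 t3 (h1.trans h12) h23 h3
  have k3 := key t1 t3 h1 (h12.trans h23) h3
  unfold Slk
  rw [k1.1, k2.1, k3.1, ← intervalIntegral.integral_add_adjacent_intervals k1.2 k2.2]; ring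

lemma chi_TF {R : ℝ} (hR : 1 ≤ R) : TF (cut (fun _ => 1) R) (cut1 (fun _ => 1) (fun _ => 0) R) (cut2 (fun _ => 1) (fun _ => 0) (fun _ => 0) R) (2*R) (235 * 1) :=
  GF_one.cut_TF hR

lemma Slk_chi_lim (S : Sys VF VE gL gin α κ p pg pgg pv) (Y : Bdy VF VE gL p) :
    Tendsto (fun n : ℕ => Slk VE gL gin α κ p (cut (fun _ => 1) ((n:ℝ)+1)) (cut1 (fun _ => 1) (fun _ => 0) ((n:ℝ)+1))
      (cut2 (fun _ => 1) (fun _ => 0) (fun _ => 0) ((n:ℝ)+1)) 1 0 0 VF) atTop (𝓝 0) := by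
  have hVF := S.hVF
  have hn : ∀ n : ℕ, 1 ≤ (n:ℝ) + 1 := fun n => by linarith [(Nat.cast_nonneg n : (0:ℝ) ≤ n)]
  have e : ∀ n : ℕ, Slk VE gL gin α κ p (cut (fun _ => 1) ((n:ℝ)+1)) (cut1 (fun _ => 1) (fun _ => 0) ((n:ℝ)+1))
      (cut2 (fun _ => 1) (fun _ => 0) (fun _ => 0) ((n:ℝ)+1)) 1 0 0 VF = -∫ x in Ioo 0 VF ×ˢ Ioi (0:ℝ), p x.1 x.2 * Lst VE gL gin α κ (cut (fun _ => 1) ((n:ℝ)+1)) (cut1 (fun _ => 1) (fun _ => 0) ((n:ℝ)+1))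
      (cut2 (fun _ => 1) (fun _ => 0) (fun _ => 0) ((n:ℝ)+1)) 1 0 x.1 x.2 := by
    intro n
    unfold Slk; rw [Np_eq Y]; ring
  simp only [e]
  suffices h : Tendsto (fun n : ℕ => ∫ x in Ioo 0 VF ×ˢ Ioi (0:ℝ), p x.1 x.2 * Lst VE gL gin α κ (cut (fun _ => 1) ((n:ℝ)+1)) (cut1 (fun _ => 1) (fun _ => 0) ((n:ℝ)+1))
      (cut2 (fun _ => 1) (fun _ => 0) (fun _ => 0) ((n:ℝ)+1)) 1 0 x.1 x.2) atTop (𝓝 (∫ x in Ioo 0 VF ×ˢ Ioi (0:ℝ), (fun _ : ℝ × ℝ => (0:ℝ)) x)) by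
    simpa using h.neg
  refine tendsto_integral_of_dominated_convergence (fun x : ℝ × ℝ => (α * 72 + κ * (18 + gin * 9)) * p x.1 x.2) (fun n => ?_) (Y.int.const_mul _) (fun n => ?_) ?_
  · exact (pL_int S Y (chi_TF (hn n)) 1 0 le_rfl le_rfl).1
  · refine (ae_restrict_iff' Qmeas).2 (Eventually.of_forall fun x hx => ?_)
    have hα := S.hα; have hκ := S.hκ; have hgin := S.hgin
    have hg : 0 < x.2 := hx.2
    set R : ℝ := (n:ℝ) + 1
    have hR : 1 ≤ R := hn n
    have hR0 : 0 < R := by linarith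
    have b1 : |x.2 * (chi1 (x.2/R) / R)| ≤ 18 := by
      rcases le_or_gt (2*R) x.2 with h | h
      · rw [(chi_two (by rw [le_div_iff₀ hR0]; exact h)).2.1]; simp
      rw [abs_mul, abs_div, abs_of_pos hg, abs_of_pos hR0, ← mul_div_assoc, div_le_iff₀ hR0]
      have := (chi_bd (x.2/R)).2.2.1
      calc x.2 * |chi1 (x.2/R)| ≤ (2*R) * 9 := by gcongr
        _ = _ := by ring
    have b2 : |chi1 (x.2/R) / R| ≤ 9 := by
      rw [abs_div, abs_of_pos hR0]; exact (div_le_self (abs_nonneg _) hR).trans (chi_bd _).2.2.1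
    have b3 : |chi2 (x.2/R) / R / R| ≤ 72 := by
      rw [abs_div, abs_div, abs_of_pos hR0]; exact (div_le_self (by positivity) hR).trans ((div_le_self (abs_nonneg _) hR).trans (chi_bd _).2.2.2)
    have e2 : Lst VE gL gin α κ (cut (fun _ => 1) R) (cut1 (fun _ => 1) (fun _ => 0) R) (cut2 (fun _ => 1) (fun _ => 0) (fun _ => 0) R) 1 0 x.1 x.2
      = α * (chi2 (x.2/R) / R / R) - κ * (x.2 * (chi1 (x.2/R) / R) - gin * (chi1 (x.2/R) / R)) := by
      unfold Lst cut cut1 cut2; ring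
    rw [Real.norm_eq_abs, abs_mul, abs_of_nonneg (S.nonneg _ _), mul_comm, e2]
    refine mul_le_mul_of_nonneg_right ?_ (S.nonneg _ _)
    refine (abs_sub _ _).trans ?_
    rw [abs_mul, abs_mul, abs_of_pos hα, abs_of_pos hκ]
    gcongr
    refine (abs_sub _ _).trans ?_
    rw [abs_mul gin, abs_of_pos hgin]
    gcongr
  · refine (ae_restrict_iff' Qmeas).2 (Eventually.of_forall fun x hx => ?_)
    refine tendsto_const_nhds.congr' ?_
    filter_upwards [tnat.eventually_ge_atTop x.2] with n hx
    have hR0 : 0 < (n:ℝ) + 1 := by linarith [hn n]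
    unfold Lst
    rw [cut_eq1 hR0 hx, cut_eq2 hR0 hx]; ring

theorem mass_eq (S : Sys VF VE gL gin α κ p pg pgg pv) (Y : Bdy VF VE gL p) (T : TF φ φ1 φ2 R A)
    (h1 : 0 ≤ t1) (h12 : t1 ≤ t2) (h2 : t2 ≤ VF) (hℓ : ∀ v ∈ Icc t1 t2, 0 ≤ c1 + c2 * v) :
    Slk VE gL gin α κ p φ φ1 φ2 c1 c2 t1 t2 = 0 := by
  have hVF := S.hVF
  have hn : ∀ n : ℕ, 1 ≤ (n:ℝ) + 1 := fun n => by linarith [(Nat.cast_nonneg n : (0:ℝ) ≤ n)]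
  have hR := T.hR
  have hA := T.hA
  refine le_antisymm ?_ (mass_ineq S Y T h1 h12 h2 hℓ)
  set M := A * (1 + R) with hM
  have hM0 : 0 ≤ M := by positivity
  set L0 := |c1| + |c2| * VF with hL0
  have hL0' : 0 ≤ L0 := by positivity
  have hℓ' : ∀ v ∈ Icc t1 t2, 0 ≤ (L0 - c1) + (-c2) * v := by
    intro v hv
    have e1 := le_abs_self c1
    have e2 : c2 * v ≤ |c2| * VF := by
      have := le_abs_self c2
      have := hv.2.trans h2
      have := h1.trans hv.1
      calc c2 * v ≤ |c2| * v := by gcongr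
        _ ≤ _ := by gcongr
    simp only [hL0]; linarith
  have hmain : ∀ᶠ n : ℕ in atTop, Slk VE gL gin α κ p φ φ1 φ2 c1 c2 t1 t2 ≤ M * (L0 * Slk VE gL gin α κ p (cut (fun _ => 1) ((n:ℝ)+1)) (cut1 (fun _ => 1) (fun _ => 0) ((n:ℝ)+1))
      (cut2 (fun _ => 1) (fun _ => 0) (fun _ => 0) ((n:ℝ)+1)) 1 0 0 VF) := by
    filter_upwards [tnat.eventually_ge_atTop R] with n hnR
    have Tχ := chi_TF (hn n)
    have T3 : TF (fun g => M * cut (fun _ => 1) ((n:ℝ)+1) g - φ g) (fun g => M * cut1 (fun _ => 1) (fun _ => 0) ((n:ℝ)+1) g - φ1 g)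
      (fun g => M * cut2 (fun _ => 1) (fun _ => 0) (fun _ => 0) ((n:ℝ)+1) g - φ2 g) (2 * ((n:ℝ)+1)) (M * (235 * 1) + A) := by
      refine ⟨fun g => ((Tχ.d1 g).const_mul M).sub (T.d1 g), fun g => ((Tχ.d2 g).const_mul M).sub (T.d2 g),
        (continuous_const.mul Tχ.c2).sub T.c2, ?_, ?_, Tχ.hR, ?_, ?_, ?_, by positivity, ?_, ?_, ?_⟩
      · intro g hg
        rcases le_or_gt g R with h | h
        · rw [cut_eq (by linarith) (h.trans hnR)]
          have : A * (1 + g) ≤ M := by simp only [hM]; gcongr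
          linarith [T.b0 g hg]
        · rw [T.supp g h.le, sub_zero]; exact mul_nonneg hM0 (Tχ.nn g hg)
      · simp only [Tχ.z, T.z]; ring
      · intro g hg; simp only [Tχ.supp g hg, T.supp g (by linarith [hn n])]; ring
      · intro g hg; simp only [Tχ.supp1 g hg, T.supp1 g (by linarith [hn n])]; ring
      · intro g hg; simp only [Tχ.supp2 g hg, T.supp2 g (by linarith [hn n])]; ring
      · intro g hg
        have := mul_le_mul_of_nonneg_left (Tχ.b0 g hg) hM0
        have := T.nn g hg
        have : 0 ≤ A * (1+g) := by positivity
        linarith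
      · intro g hg
        refine (abs_sub _ _).trans (add_le_add ?_ (T.b1 g hg))
        rw [abs_mul, abs_of_nonneg hM0]; exact mul_le_mul_of_nonneg_left (Tχ.b1 g hg) hM0
      · intro g hg
        refine (abs_sub _ _).trans (add_le_add ?_ (T.b2 g hg))
        rw [abs_mul, abs_of_nonneg hM0]; exact mul_le_mul_of_nonneg_left (Tχ.b2 g hg) hM0
    have i1 := mass_ineq S Y T3 h1 h12 h2 hℓ
    rw [Slk_sub S Y T Tχ M h1 h12 h2] at i1
    have i2 := mass_ineq S Y Tχ h1 h12 h2 hℓ'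
    rw [Slk_lin S Y Tχ L0 h1 h2] at i2
    have i3 := mass_ineq S Y Tχ (c1 := 1) (c2 := 0) le_rfl h1 (h12.trans h2) (fun v _ => by norm_num)
    have i4 := mass_ineq S Y Tχ (c1 := 1) (c2 := 0) (h1.trans h12) h2 le_rfl (fun v _ => by norm_num)
    have i5 := Slk_add S Y Tχ (c1 := 1) (c2 := 0) le_rfl h1 h12 h2
    have i6 := Slk_add S Y Tχ (c1 := 1) (c2 := 0) le_rfl (h1.trans h12) h2 le_rfl
    refine (sub_nonneg.1 i1).trans (mul_le_mul_of_nonneg_left ((sub_nonneg.1 i2).trans (mul_le_mul_of_nonneg_left ?_ hL0')) hM0)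
    linarith
  have hlim := ((Slk_chi_lim S Y).const_mul L0).const_mul M
  rw [mul_zero, mul_zero] at hlim
  exact ge_of_tendsto hlim hmain

end masseq

/-- truncated power `G` -/
def Gk1 (q k y : ℝ) : ℝ := q * Ek k y ^ (q - 1)
def Gk (q k y : ℝ) : ℝ := ∫ s in (0:ℝ)..y, Gk1 q k s
def Gk2 (q k y : ℝ) : ℝ := q * (q - 1) * (Ek k y ^ (q - 2) * exp (-y/k))
def Lk (q k : ℝ) : ℝ := q * k ^ (q - 1)

section Gsec
variable {q k : ℝ}

lemma Ek_nn (hk : 0 < k) {y : ℝ} (hy : 0 ≤ y) : 0 ≤ Ek k y := (expCF hk).nn y hy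
lemma Ek_lek (hk : 0 < k) {y : ℝ} (hy : 0 ≤ y) : Ek k y ≤ k := (expCF hk).bd y hy
lemma Ek_pos (hk : 0 < k) {y : ℝ} (hy : 0 < y) : 0 < Ek k y := by
  unfold Ek
  have : exp (-y/k) < 1 := by rw [exp_lt_one_iff]; exact div_neg_of_neg_of_pos (by linarith) hk
  exact mul_pos hk (by linarith)
lemma Ek_mono (hk : 0 < k) {y y' : ℝ} (hy : 0 ≤ y) (h : y ≤ y') : Ek k y ≤ Ek k y' := (expCF hk).mono hy h

lemma Gk1_cont (hq : 1 < q) (hk : 0 < k) : Continuous (Gk1 q k) := by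
  unfold Gk1
  exact continuous_const.mul ((expCF hk).c0.rpow_const (fun _ => Or.inr (by linarith)))

lemma Gk1_nn (hq : 1 < q) (hk : 0 < k) {y : ℝ} (hy : 0 ≤ y) : 0 ≤ Gk1 q k y :=
  mul_nonneg (by linarith) (rpow_nonneg (Ek_nn hk hy) _)

lemma Gk1_mono (hq : 1 < q) (hk : 0 < k) {y y' : ℝ} (hy : 0 ≤ y) (h : y ≤ y') : Gk1 q k y ≤ Gk1 q k y' :=
  mul_le_mul_of_nonneg_left (rpow_le_rpow (Ek_nn hk hy) (Ek_mono hk hy h) (by linarith)) (by linarith)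

lemma Gk1_le (hq : 1 < q) (hk : 0 < k) {y : ℝ} (hy : 0 ≤ y) : Gk1 q k y ≤ q * y ^ (q - 1) :=
  mul_le_mul_of_nonneg_left (rpow_le_rpow (Ek_nn hk hy) (Ek_le hk) (by linarith)) (by linarith)

lemma Gk1_leL (hq : 1 < q) (hk : 0 < k) {y : ℝ} (hy : 0 ≤ y) : Gk1 q k y ≤ Lk q k :=
  mul_le_mul_of_nonneg_left (rpow_le_rpow (Ek_nn hk hy) (Ek_lek hk hy) (by linarith)) (by linarith)

lemma Gk_hd (hq : 1 < q) (hk : 0 < k) (y : ℝ) : HasDerivAt (Gk q k) (Gk1 q k y) y :=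
  intervalIntegral.integral_hasDerivAt_right ((Gk1_cont hq hk).intervalIntegrable _ _)
    ((Gk1_cont hq hk).stronglyMeasurableAtFilter _ _) (Gk1_cont hq hk).continuousAt

lemma Gk_cont (hq : 1 < q) (hk : 0 < k) : Continuous (Gk q k) :=
  continuous_iff_continuousAt.2 fun y => (Gk_hd hq hk y).continuousAt

lemma Gk_zero : Gk q k 0 = 0 := by unfold Gk; simp

lemma Gk_nn (hq : 1 < q) (hk : 0 < k) {y : ℝ} (hy : 0 ≤ y) : 0 ≤ Gk q k y :=
  intervalIntegral.integral_nonneg hy fun s hs => Gk1_nn hq hk hs.1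

lemma int_pow (hq : 1 < q) {y : ℝ} (hy : 0 ≤ y) : ∫ s in (0:ℝ)..y, q * s ^ (q - 1) = y ^ q := by
  rw [intervalIntegral.integral_const_mul, integral_rpow (Or.inl (by linarith))]
  have : q ≠ 0 := by linarith
  simp only [sub_add_cancel, zero_rpow this, sub_zero]; field_simp

lemma pow_cont (hq : 1 < q) : Continuous (fun s : ℝ => q * s ^ (q - 1)) :=
  continuous_const.mul (continuous_id.rpow_const (fun _ => Or.inr (by linarith)))

lemma Gk_le (hq : 1 < q) (hk : 0 < k) {y : ℝ} (hy : 0 ≤ y) : Gk q k y ≤ y ^ q := by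
  rw [← int_pow hq hy]
  exact intervalIntegral.integral_mono_on hy ((Gk1_cont hq hk).intervalIntegrable _ _) ((pow_cont hq).intervalIntegrable _ _)
    fun s hs => Gk1_le hq hk hs.1

lemma Gk_le_mul (hq : 1 < q) (hk : 0 < k) {y : ℝ} (hy : 0 ≤ y) : Gk q k y ≤ y * Gk1 q k y := by
  have := intervalIntegral.integral_mono_on hy ((Gk1_cont hq hk).intervalIntegrable _ _) (continuous_const.intervalIntegrable (u := fun _ => Gk1 q k y) (μ := volume) _ _)
    fun s hs => Gk1_mono hq hk hs.1 hs.2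
  simpa [Gk] using this

lemma yGk1_le (hq : 1 < q) (hk : 0 < k) {y : ℝ} (hy : 0 ≤ y) : y * Gk1 q k y ≤ q * y ^ q := by
  have h := mul_le_mul_of_nonneg_left (Gk1_le hq hk hy) hy
  have e : y ^ q = y * y ^ (q - 1) := by
    rcases hy.eq_or_lt with h0 | h0
    · rw [← h0, zero_rpow (by linarith), zero_mul]
    · rw [rpow_sub_one h0.ne']; field_simp
  rw [e]; linarith

lemma Gk_lim (hq : 1 < q) {y : ℝ} (hy : 0 ≤ y) : Tendsto (fun n : ℕ => Gk q ((n:ℝ)+1) y) atTop (𝓝 (y ^ q)) := by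
  rw [← int_pow hq hy]
  unfold Gk
  refine intervalIntegral.tendsto_integral_filter_of_dominated_convergence (fun s => q * s ^ (q-1)) ?_ ?_ ((pow_cont hq).intervalIntegrable _ _) ?_
  · exact Eventually.of_forall fun n => (Gk1_cont hq (by positivity)).aestronglyMeasurable
  · refine Eventually.of_forall fun n => Eventually.of_forall fun s hs => ?_
    rw [uIoc_of_le hy] at hs
    rw [Real.norm_eq_abs, abs_of_nonneg (Gk1_nn hq (by positivity) hs.1.le)]
    exact Gk1_le hq (by positivity) hs.1.le
  · refine Eventually.of_forall fun s hs => ?_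
    rw [uIoc_of_le hy] at hs
    exact ((Ek_lim hs.1.le).rpow_const (Or.inr (by linarith))).const_mul q

lemma Gk2_lim {y : ℝ} (hy : 0 < y) : Tendsto (fun n : ℕ => Gk2 q ((n:ℝ)+1) y) atTop (𝓝 (q * (q-1) * y ^ (q-2))) := by
  unfold Gk2
  have := (((Ek_lim hy.le).rpow_const (p := q - 2) (Or.inl hy.ne')).mul (exp_lim y)).const_mul (q * (q - 1))
  simpa using this

lemma Gk2_nn (hq : 1 < q) (hk : 0 < k) {y : ℝ} (hy : 0 ≤ y) : 0 ≤ Gk2 q k y := by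
  unfold Gk2
  have := rpow_nonneg (Ek_nn hk hy) (q-2)
  have := exp_pos (-y/k)
  have : 0 < q - 1 := by linarith
  positivity

lemma Gk_ratio (hq : 1 < q) (hk : 0 < k) {y y' : ℝ} (hy : 0 ≤ y) (h : y ≤ y') : y' * Gk q k y ≤ y * Gk q k y' := by
  rcases (hy.trans h).eq_or_lt with h0 | h0
  · have : y = 0 := by linarith
    rw [← h0, this, Gk_zero]
  have hc : ConvexOn ℝ (Ici 0) (Gk q k) := by
    refine MonotoneOn.convexOn_of_deriv (convex_Ici 0) (Gk_cont hq hk).continuousOn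
      (fun x _ => (Gk_hd hq hk x).differentiableAt.differentiableWithinAt) ?_
    intro a ha b hb hab
    rw [interior_Ici] at ha
    rw [(Gk_hd hq hk a).deriv, (Gk_hd hq hk b).deriv]
    exact Gk1_mono hq hk (le_of_lt ha) hab
  have ha : 0 ≤ 1 - y/y' := by rw [sub_nonneg, div_le_one h0]; exact h
  have hb : 0 ≤ y/y' := by positivity
  have := hc.2 (mem_Ici.2 (le_refl (0:ℝ))) (mem_Ici.2 h0.le) ha hb (by ring)
  simp only [smul_eq_mul, mul_zero, zero_add, Gk_zero] at this
  have e : y / y' * y' = y := by field_simp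
  rw [e, div_mul_eq_mul_div, le_div_iff₀ h0] at this
  linarith

lemma Gk_mono (hq : 1 < q) (hk : 0 < k) {y y' : ℝ} (hy : 0 ≤ y) (h : y ≤ y') : Gk q k y ≤ Gk q k y' := by
  have hi := fun a b : ℝ => (Gk1_cont hq hk).intervalIntegrable (μ := volume) a b
  have h2 : Gk q k y' - Gk q k y = ∫ s in y..y', Gk1 q k s := by
    unfold Gk; rw [intervalIntegral.integral_interval_sub_left (hi _ _) (hi _ _)]
  have : 0 ≤ ∫ s in y..y', Gk1 q k s := intervalIntegral.integral_nonneg h fun s hs => Gk1_nn hq hk (hy.trans hs.1)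
  linarith

lemma bern {x r : ℝ} (hx0 : 0 ≤ x) (hx : x ≤ 1) (hr : 0 < r) : 1 - (1 - x) ^ r ≤ (r + 1) * x := by
  rcases le_total 1 r with h | h
  · have := one_add_mul_self_le_rpow_one_add (s := -x) (by linarith) h
    rw [← sub_eq_add_neg] at this
    nlinarith
  · have : (1 - x) ^ (1:ℝ) ≤ (1 - x) ^ r := by
      rcases (sub_nonneg.2 hx).eq_or_lt with h0 | h0
      · rw [← h0, zero_rpow one_ne_zero]; exact rpow_nonneg le_rfl _
      · exact rpow_le_rpow_of_exponent_ge h0 (by linarith) h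
    rw [rpow_one] at this
    nlinarith

lemma GCF (hq : 1 < q) (hk : 0 < k) : CF (fun y => Lk q k * y - Gk q k y) (fun y => Lk q k - Gk1 q k y) (fun y => -Gk2 q k y)
    (Lk q k * q * k) (Lk q k) := by
  have hL : 0 ≤ Lk q k := mul_nonneg (by linarith) (rpow_nonneg hk.le _)
  have hE := expCF hk
  have hi := fun a b : ℝ => (Gk1_cont hq hk).intervalIntegrable (μ := volume) a b
  have hci := fun (c a b : ℝ) => (continuous_const.intervalIntegrable (u := fun _ => c) (μ := volume) a b)
  have e : ∀ y, Lk q k * y - Gk q k y = ∫ s in (0:ℝ)..y, (Lk q k - Gk1 q k s) := by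
    intro y
    rw [intervalIntegral.integral_sub (hci _ _ _) (hi _ _)]
    simp [Gk, mul_comm]
  have hmE : Measurable (Ek k) := hE.c0.measurable
  refine ⟨(continuous_const.mul continuous_id).sub (Gk_cont hq hk), (continuous_const.sub (Gk1_cont hq hk)).measurable, ?_, ?_, ?_, ?_, ?_, ?_, ?_, ?_, ?_, ?_⟩
  · unfold Gk2; fun_prop
  · intro y _
    have := ((hasDerivAt_id y).const_mul (Lk q k)).sub (Gk_hd hq hk y)
    exact this.congr_deriv (by simp)
  · intro y hy
    have h1 := ((hE.d1 y hy).rpow_const (p := q - 1) (Or.inl (Ek_pos hk hy).ne')).const_mul q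
    refine (h1.const_sub (Lk q k)).congr_deriv ?_
    unfold Gk2
    rw [show q - 1 - 1 = q - 2 by ring]; ring
  · unfold Gk2
    have : ContinuousOn (fun y => Ek k y ^ (q-2)) (Ioi 0) := hE.c0.continuousOn.rpow_const fun y hy => Or.inl (Ek_pos hk hy).ne'
    exact (continuousOn_const.mul (this.mul (by fun_prop))).neg
  · intro y hy
    simp only [e]
    exact intervalIntegral.integral_nonneg hy fun s hs => by linarith [Gk1_leL hq hk hs.1]
  · intro y hy
    simp only [e]
    have hx : ∀ s, 0 ≤ s → Lk q k - Gk1 q k s ≤ Lk q k * q * exp (-s/k) := by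
      intro s hs
      have h1 := hE.bd1 s
      have h1 : exp (-s/k) ≤ 1 := by rw [exp_le_one_iff]; exact div_nonpos_of_nonpos_of_nonneg (by linarith) hk.le
      have h2 := bern (exp_pos (-s/k)).le h1 (r := q - 1) (by linarith)
      have h3 : Gk1 q k s = Lk q k * (1 - exp (-s/k)) ^ (q-1) := by
        unfold Gk1 Ek Lk; rw [mul_rpow hk.le (by linarith)]; ring
      rw [h3]
      calc _ = Lk q k * (1 - (1 - exp (-s/k)) ^ (q-1)) := by ring
        _ ≤ Lk q k * ((q - 1 + 1) * exp (-s/k)) := by gcongr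
        _ = _ := by ring
    have hci : Continuous (fun s => Lk q k * q * exp (-s/k)) := by fun_prop
    have h4 := intervalIntegral.integral_mono_on hy ((continuous_const.sub (Gk1_cont hq hk)).intervalIntegrable (μ := volume) 0 y) (hci.intervalIntegrable (μ := volume) 0 y) fun s hs => hx s hs.1
    refine h4.trans ?_
    rw [intervalIntegral.integral_const_mul]
    have h5 : ∫ s in (0:ℝ)..y, exp (-s/k) = Ek k y - Ek k 0 := by
      refine intervalIntegral.integral_eq_sub_of_hasDerivAt (fun s _ => ?_) (Continuous.intervalIntegrable (by fun_prop) _ _)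
      unfold Ek
      have := (((hasDerivAt_id s).neg.div_const k).exp.const_sub 1).const_mul k
      refine this.congr_deriv ?_
      simp only [Pi.neg_apply, id]; field_simp
    rw [h5]
    have h6 := Ek_lek hk hy
    have h7 := Ek_nn hk (le_refl (0:ℝ))
    have h8 : 0 ≤ Lk q k * q := mul_nonneg hL (by linarith)
    exact mul_le_mul_of_nonneg_left (by linarith) h8
  · intro y hy; linarith [Gk1_leL hq hk hy.le]
  · intro y hy; linarith [Gk1_nn hq hk hy.le]
  · intro y hy
    linarith [Gk_le_mul hq hk hy.le]
  · intro y hy; linarith [Gk2_nn hq hk hy.le]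
end Gsec

section energy
variable {VF VE gL gin α κ : ℝ} {p pg pgg pv : ℝ → ℝ → ℝ} {φ φ1 φ2 : ℝ → ℝ} {R A : ℝ}
  {c1 c2 t1 t2 q k K : ℝ}

/-- `u = p^q` weighted density -/
def Wd (gL q : ℝ) (p : ℝ → ℝ → ℝ) (x : ℝ × ℝ) : ℝ := (x.2 + gL) ^ 2 * p x.1 x.2 ^ q

def Ken (VF VE gL gin α κ c1 c2 : ℝ) : ℝ :=
  ((gL * VF + VE) * |c2| + (|c1| + |c2| * VF) * (α + κ * (1 + gin))) * (1 + 1/gL)^2 +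
    (1 + κ / gL) * (1 + 1/gL) * (|c1| + |c2| * VF)

lemma Ken_nn (hVF : 0 < VF) (hVE : VF < VE) (hgL : 0 < gL) (hgin : 0 < gin) (hα : 0 < α) (hκ : 0 < κ) :
    0 ≤ Ken VF VE gL gin α κ c1 c2 := by
  have : 0 < VE := by linarith
  unfold Ken; positivity

lemma NG_int (S : Sys VF VE gL gin α κ p pg pgg pv) (Y : Bdy VF VE gL p) (T : TF φ φ1 φ2 R A) (hq : 1 < q) (hk : 0 < k)
    {v : ℝ} (hv : v ∈ Icc 0 VF) : IntegrableOn (fun g => Jflux VE gL v g * (φ g * Gk q k (p v g))) (Ioi 0) := by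
  have := ((Nint S Y T hv).const_mul (Lk q k)).sub (NE_int S T (GCF hq hk) v)
  refine this.congr (Eventually.of_forall fun g => ?_)
  simp only [Pi.sub_apply]; ring

lemma NG_eq (S : Sys VF VE gL gin α κ p pg pgg pv) (Y : Bdy VF VE gL p) (T : TF φ φ1 φ2 R A) (hq : 1 < q) (hk : 0 < k)
    {v : ℝ} (hv : v ∈ Icc 0 VF) : Nf VE gL p φ (fun y => Lk q k * y - Gk q k y) v =
      Lk q k * Nf VE gL p φ (fun y => y) v - Nf VE gL p φ (Gk q k) v := by
  unfold Nf
  rw [← integral_const_mul, ← integral_sub ((Nint S Y T hv).const_mul _) (NG_int S Y T hq hk hv)]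
  congr 1; ext g; ring

theorem energy (S : Sys VF VE gL gin α κ p pg pgg pv) (Y : Bdy VF VE gL p) (T : TF φ φ1 φ2 R A) (hq : 1 < q) (hk : 0 < k)
    (hd : IntegrableOn (Wd gL q p) (Ioo 0 VF ×ˢ Ioi (0:ℝ)))
    (h1 : 0 ≤ t1) (h12 : t1 < t2) (h2 : t2 ≤ VF) (hℓ : ∀ v ∈ Icc t1 t2, 0 ≤ c1 + c2 * v) (hK : 0 ≤ K) :
    (c1 + c2 * t2) * Nf VE gL p φ (Gk q k) t2 - (c1 + c2 * t1) * Nf VE gL p φ (Gk q k) t1 +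
      ∫ v in Ioo t1 t2, min (∫ g in Ioi (0:ℝ), Ed α p pg φ (fun y => -Gk2 q k y) c1 c2 v g) K
     ≤ A * Ken VF VE gL gin α κ c1 c2 * (q * ∫ x in Ioo 0 VF ×ˢ Ioi (0:ℝ), Wd gL q p x) := by
  have hVF := S.hVF; have hVE := S.hVE; have hgL := S.hgL; have hgin := S.hgin; have hα := S.hα; have hκ := S.hκ
  have hA := T.hA
  have hVE0 : 0 < VE := by linarith
  obtain ⟨i1, -, -, i2⟩ := prod_ineq S T (GCF hq hk) h1 h12 h2 hℓ hK
  have i3 := mass_eq S Y T h1 h12.le h2 hℓ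
  rw [NG_eq S Y T hq hk ⟨h1.trans h12.le, h2⟩, NG_eq S Y T hq hk ⟨h1, h12.le.trans h2⟩] at i2
  unfold Slk at i3
  have hpL := pL_int S Y T c1 c2 h1 h2
  have i4 : -(A * Ken VF VE gL gin α κ c1 c2 * (q * ∫ x in Ioo 0 VF ×ˢ Ioi (0:ℝ), Wd gL q p x)) ≤
     (∫ x in Ioo t1 t2 ×ˢ Ioi (0:ℝ), I1 VE gL gin α κ p φ φ1 φ2 (fun y => Lk q k * y - Gk q k y) (fun y => Lk q k - Gk1 q k y) c1 c2 x.1 x.2) -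
      Lk q k * ∫ x in Ioo t1 t2 ×ˢ Ioi (0:ℝ), p x.1 x.2 * Lst VE gL gin α κ φ φ1 φ2 c1 c2 x.1 x.2 := by
    have hd' := hd.mono_set (Qsub h1 h2)
    have j1 : ∫ x in Ioo t1 t2 ×ˢ Ioi (0:ℝ), Wd gL q p x ≤ ∫ x in Ioo 0 VF ×ˢ Ioi (0:ℝ), Wd gL q p x := by
      refine setIntegral_mono_set hd ?_ (Qsub h1 h2).eventuallyLE
      refine (ae_restrict_iff' Qmeas).2 (Eventually.of_forall fun x hx => ?_)
      exact mul_nonneg (sq_nonneg _) (rpow_nonneg (S.nonneg _ _) _)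
    have hKn : 0 ≤ A * Ken VF VE gL gin α κ c1 c2 := mul_nonneg hA (Ken_nn hVF hVE hgL hgin hα hκ)
    have hq0 : 0 ≤ q := by linarith
    calc -(A * Ken VF VE gL gin α κ c1 c2 * (q * ∫ x in Ioo 0 VF ×ˢ Ioi (0:ℝ), Wd gL q p x)) ≤
          -(A * Ken VF VE gL gin α κ c1 c2 * (q * ∫ x in Ioo t1 t2 ×ˢ Ioi (0:ℝ), Wd gL q p x)) := by gcongr
      _ = ∫ x in Ioo t1 t2 ×ˢ Ioi (0:ℝ), -(A * Ken VF VE gL gin α κ c1 c2 * (q * Wd gL q p x)) := by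
          rw [integral_neg, integral_const_mul, integral_const_mul]
      _ ≤ ∫ x in Ioo t1 t2 ×ˢ Ioi (0:ℝ), (I1 VE gL gin α κ p φ φ1 φ2 (fun y => Lk q k * y - Gk q k y) (fun y => Lk q k - Gk1 q k y) c1 c2 x.1 x.2 -
           Lk q k * (p x.1 x.2 * Lst VE gL gin α κ φ φ1 φ2 c1 c2 x.1 x.2)) := by
          refine setIntegral_mono_on ((hd'.const_mul q).const_mul _).neg (i1.sub (hpL.const_mul _)) Qmeas fun x hx => ?_
          obtain ⟨v, g⟩ := x
          have hv : v ∈ Icc t1 t2 := ⟨hx.1.1.le, hx.1.2.le⟩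
          have hv' : v ∈ Icc 0 VF := ⟨h1.trans hv.1, hv.2.trans h2⟩
          have hg : 0 ≤ g := le_of_lt hx.2
          have hy := S.nonneg v g
          have a1 := Gk_nn hq hk hy
          have a2 := Gk_le hq hk hy
          have a3 := Gk_le_mul hq hk hy
          have a4 := yGk1_le hq hk hy
          have a5 := Lst_growth hVF hVE hgL hgin hα hκ T (c1 := c1) (c2 := c2) hv' hg
          have a6 := T.b0 g hg
          have a7 := T.nn g hg
          have a8 := hℓ v hv
          have a9 : c1 + c2 * v ≤ |c1| + |c2| * VF := by
            refine add_le_add (le_abs_self _) ?_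
            have := le_abs_self c2
            calc c2 * v ≤ |c2| * v := by have := hv'.1; gcongr
              _ ≤ _ := by have := hv'.2; gcongr
          have hu : 0 ≤ p v g ^ q := rpow_nonneg hy _
          have b1 : 1 + g ≤ (1 + 1/gL) * (g + gL) := by
            have : (1 + 1/gL) * (g + gL) = g + gL + g / gL + 1 := by field_simp; ring
            have : 0 ≤ g / gL := by positivity
            linarith
          have b2 : g + gL + κ ≤ (1 + κ/gL) * (g + gL) := by
            have : (1 + κ/gL) * (g + gL) = g + gL + κ + κ * (g / gL) := by field_simp; ring
            have : 0 ≤ κ * (g / gL) := by positivity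
            linarith
          set c0 := (gL * VF + VE) * |c2| + (|c1| + |c2| * VF) * (α + κ * (1 + gin)) with hc0
          have c0n : 0 ≤ c0 := by positivity
          have d1 : Gk q k (p v g) * Lst VE gL gin α κ φ φ1 φ2 c1 c2 v g ≤ A * (c0 * (1 + 1/gL)^2) * (q * ((g + gL)^2 * p v g ^ q)) := by
            calc Gk q k (p v g) * Lst VE gL gin α κ φ φ1 φ2 c1 c2 v g ≤ Gk q k (p v g) * |Lst VE gL gin α κ φ φ1 φ2 c1 c2 v g| := by
                  gcongr; exact le_abs_self _
              _ ≤ p v g ^ q * (A * c0 * (1 + g)^2) := by gcongr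
              _ ≤ p v g ^ q * (A * c0 * ((1 + 1/gL) * (g + gL))^2) := by gcongr
              _ = 1 * (p v g ^ q * (A * c0 * ((1 + 1/gL) * (g + gL))^2)) := by ring
              _ ≤ q * (p v g ^ q * (A * c0 * ((1 + 1/gL) * (g + gL))^2)) := by gcongr
              _ = _ := by ring
          have d2 : (g + gL + κ) * (p v g * Gk1 q k (p v g) - Gk q k (p v g)) * ((c1 + c2 * v) * φ g) ≤
              A * ((1 + κ / gL) * (1 + 1/gL) * (|c1| + |c2| * VF)) * (q * ((g + gL)^2 * p v g ^ q)) := by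
            calc (g + gL + κ) * (p v g * Gk1 q k (p v g) - Gk q k (p v g)) * ((c1 + c2 * v) * φ g) ≤
                ((1 + κ/gL) * (g + gL)) * (q * p v g ^ q) * ((|c1| + |c2| * VF) * (A * ((1 + 1/gL) * (g + gL)))) := by
                  have hx1 : 0 ≤ p v g * Gk1 q k (p v g) - Gk q k (p v g) := by linarith
                  have hx2 : p v g * Gk1 q k (p v g) - Gk q k (p v g) ≤ q * p v g ^ q := by linarith
                  have hx3 : φ g ≤ A * ((1 + 1/gL) * (g + gL)) := a6.trans (by gcongr)
                  gcongr
              _ = _ := by ring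
          have hfin : -(A * Ken VF VE gL gin α κ c1 c2 * (q * ((g + gL)^2 * p v g ^ q))) ≤
             -(Gk q k (p v g) * Lst VE gL gin α κ φ φ1 φ2 c1 c2 v g) - (g + gL + κ) * (p v g * Gk1 q k (p v g) - Gk q k (p v g)) * ((c1 + c2 * v) * φ g) := by
            unfold Ken; rw [← hc0]; linarith
          simp only [Wd, I1]
          refine hfin.trans (le_of_eq ?_)
          ring
      _ = _ := by rw [integral_sub i1 (hpL.const_mul _), integral_const_mul]
  have i5 : Lk q k * ((c1 + c2 * t2) * Nf VE gL p φ (fun y => y) t2 - (c1 + c2 * t1) * Nf VE gL p φ (fun y => y) t1 -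
    ∫ x in Ioo t1 t2 ×ˢ Ioi (0:ℝ), p x.1 x.2 * Lst VE gL gin α κ φ φ1 φ2 c1 c2 x.1 x.2) = 0 := by rw [i3, mul_zero]
  linarith

end energy

def rho (b g : ℝ) : ℝ := max (g - b) 0 ^ 3 / (1 + max (g - b) 0 ^ 2)
def rho1 (b g : ℝ) : ℝ := (3 * max (g - b) 0 ^ 2 + max (g - b) 0 ^ 4) / (1 + max (g - b) 0 ^ 2) ^ 2
def rho2 (b g : ℝ) : ℝ := (6 * max (g - b) 0 - 2 * max (g - b) 0 ^ 3) / (1 + max (g - b) 0 ^ 2) ^ 3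

lemma rho_GF {b e : ℝ} (hb : 0 ≤ b) (he : 0 ≤ e) (he1 : e ≤ 1) : GF (fun g => e + rho b g) (rho1 b) (rho2 b) 8 := by
  have hs : ∀ g, HasDerivAt (fun g => g - b) 1 g := fun g => (hasDerivAt_id g).sub_const b
  have m2 : ∀ g, HasDerivAt (fun g => max (g - b) 0 ^ 2) (2 * max (g - b) 0) g := fun g => by
    have := HasDerivAt.comp g (hasDerivAt_max_pow 0 (g - b)) (hs g)
    exact this.congr_deriv (by push_cast; ring)
  have m3 : ∀ g, HasDerivAt (fun g => max (g - b) 0 ^ 3) (3 * max (g - b) 0 ^ 2) g := fun g => by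
    have := HasDerivAt.comp g (hasDerivAt_max_pow 1 (g - b)) (hs g)
    exact this.congr_deriv (by push_cast; ring)
  have m4 : ∀ g, HasDerivAt (fun g => max (g - b) 0 ^ 4) (4 * max (g - b) 0 ^ 3) g := fun g => by
    have := HasDerivAt.comp g (hasDerivAt_max_pow 2 (g - b)) (hs g)
    exact this.congr_deriv (by push_cast; ring)
  have hmn : ∀ g, 0 ≤ max (g - b) 0 := fun g => le_max_right _ _
  refine ⟨?_, ?_, ?_, ?_, ?_, by norm_num, ?_, ?_, ?_⟩
  · intro g
    have := ((m3 g).div ((m2 g).const_add 1) (by positivity)).const_add e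
    refine this.congr_deriv ?_
    unfold rho1; congr 1; ring
  · intro g
    have := (((m2 g).const_mul 3).add (m4 g)).div (((m2 g).const_add 1).pow 2) (by simp only [Pi.pow_apply]; positivity)
    refine this.congr_deriv ?_
    unfold rho2
    simp only [Pi.add_apply, Pi.pow_apply]
    rw [div_eq_div_iff (by positivity) (by positivity)]
    push_cast; ring
  · unfold rho2
    refine Continuous.div (by fun_prop) (by fun_prop) (fun g => by positivity)
  · intro g _
    unfold rho; have := hmn g; positivity
  · unfold rho1; rw [max_eq_right (by linarith)]; norm_num
  · intro g hg
    have h1 := hmn g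
    have h2 : max (g - b) 0 ≤ g := max_le (by linarith) hg
    have : rho b g ≤ g := by
      unfold rho
      rw [div_le_iff₀ (by positivity)]
      set m := max (g - b) 0
      calc m^3 ≤ m * (1 + m^2) := by linarith
        _ ≤ _ := by gcongr
    linarith
  · intro g _
    unfold rho1
    set m := max (g - b) 0
    have h1 : 0 ≤ m := hmn g
    rw [abs_of_nonneg (by positivity), div_le_iff₀ (by positivity)]
    linarith [sq_nonneg m, sq_nonneg (m^2)]
  · intro g _
    unfold rho2
    set m := max (g - b) 0
    have h1 : 0 ≤ m := hmn g
    rw [abs_div, abs_of_nonneg (by positivity : 0 ≤ (1 + m^2)^3), div_le_iff₀ (by positivity)]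
    have hx : |6 * m - 2 * m ^3| ≤ 6 * m + 2 * m^3 := by
      refine (abs_sub _ _).trans ?_
      rw [abs_of_nonneg (by positivity), abs_of_nonneg (by positivity)]
    refine hx.trans ?_
    have e1 : m ≤ 1 + m^2 := by nlinarith [sq_nonneg (m-1)]
    have e2 : 1 ≤ 1 + m^2 := by linarith [sq_nonneg m]
    calc 6 * m + 2 * m^3 ≤ 6 * (1+m^2)^3 + 2 * (1+m^2)^3 := by
          gcongr
          calc m ≤ (1+m^2) := e1
            _ ≤ _ := le_self_pow₀ e2 (by norm_num)
      _ = _ := by ring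

lemma rho_mono {b g : ℝ} (hb : 0 ≤ b) : rho b g ≤ rho 0 g := by
  unfold rho
  have h : max (g - b) 0 ≤ max (g - 0) 0 := max_le_max (by linarith) le_rfl
  have h0 : 0 ≤ max (g - b) 0 := le_max_right _ _
  set m := max (g - b) 0
  set M := max (g - 0) 0
  have h0' : 0 ≤ M := h0.trans h
  rw [div_le_div_iff₀ (by positivity) (by positivity)]
  have e1 : m^3 ≤ M^3 := by gcongr
  have e2 : m^2 * M^2 * m ≤ m^2 * M^2 * M := by gcongr
  nlinarith

def lam (b g : ℝ) : ℝ := max (b^2 - g^2) 0 ^ 3 / b^4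
def lam1 (b g : ℝ) : ℝ := -6 * g * max (b^2 - g^2) 0 ^ 2 / b^4
def lam2 (b g : ℝ) : ℝ := (24 * g^2 * max (b^2 - g^2) 0 - 6 * max (b^2 - g^2) 0 ^ 2) / b^4

lemma lam_TF {b gF : ℝ} (hb : 0 < b) (hbF : b ≤ gF) : TF (lam b) (lam1 b) (lam2 b) b (gF^2 + 6 * gF + 30) := by
  have hs : ∀ g, HasDerivAt (fun g => b^2 - g^2) (-(2*g)) g := fun g => by
    have := ((hasDerivAt_id g).pow 2).const_sub (b^2)
    exact this.congr_deriv (by simp)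
  have m2 : ∀ g, HasDerivAt (fun g => max (b^2 - g^2) 0 ^ 2) (-4 * g * max (b^2 - g^2) 0) g := fun g => by
    have := HasDerivAt.comp g (hasDerivAt_max_pow 0 (b^2 - g^2)) (hs g)
    exact this.congr_deriv (by push_cast; ring)
  have m3 : ∀ g, HasDerivAt (fun g => max (b^2 - g^2) 0 ^ 3) (-6 * g * max (b^2 - g^2) 0 ^ 2) g := fun g => by
    have := HasDerivAt.comp g (hasDerivAt_max_pow 1 (b^2 - g^2)) (hs g)
    exact this.congr_deriv (by push_cast; ring)
  have hmn : ∀ g, 0 ≤ max (b^2 - g^2) 0 := fun g => le_max_right _ _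
  have hmb : ∀ g, max (b^2 - g^2) 0 ≤ b^2 := fun g => max_le (by linarith [sq_nonneg g]) (by positivity)
  have hz : ∀ g, b ≤ g → max (b^2 - g^2) 0 = 0 := fun g hg => max_eq_right (by nlinarith)
  have hgF : 0 < gF := by linarith
  refine ⟨?_, ?_, ?_, ?_, ?_, hb, ?_, ?_, ?_, by positivity, ?_, ?_, ?_⟩
  · intro g; exact (m3 g).div_const _
  · intro g
    have := (((hasDerivAt_id g).const_mul (-6)).mul (m2 g)).div_const (b^4)
    refine this.congr_deriv ?_
    unfold lam2; simp only [id]; ring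
  · unfold lam2; fun_prop
  · intro g _; unfold lam; have := hmn g; positivity
  · unfold lam1; simp
  · intro g hg; unfold lam; simp [hz g hg]
  · intro g hg; unfold lam1; simp [hz g hg]
  · intro g hg; unfold lam2; simp [hz g hg]
  · intro g hg
    have h : lam b g ≤ gF^2 := by
      unfold lam
      rw [div_le_iff₀ (by positivity)]
      calc _ ≤ (b^2)^3 := by have := hmb g; have := hmn g; gcongr
        _ = b^2 * b^4 := by ring
        _ ≤ _ := by gcongr
    nlinarith
  · intro g hg
    rcases le_or_gt b g with h | h
    · unfold lam1; simp [hz g h]; positivity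
    unfold lam1
    have h1 := hmb g; have h2 := hmn g
    have : |-6 * g * max (b^2 - g^2) 0 ^ 2 / b^4| ≤ 6 * gF := by
      rw [abs_div, abs_mul, abs_mul, abs_of_nonneg hg, abs_of_nonneg (by positivity : 0 ≤ max (b^2 - g^2) 0 ^ 2), abs_of_pos (by positivity : 0 < b^4),
        div_le_iff₀ (by positivity)]
      norm_num only [abs_neg, abs_of_pos]
      calc 6 * g * max (b^2 - g^2) 0 ^ 2 ≤ 6 * gF * (b^2)^2 := by gcongr; linarith
        _ = _ := by ring
    nlinarith
  · intro g hg
    rcases le_or_gt b g with h | h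
    · unfold lam2; simp [hz g h]; positivity
    unfold lam2
    have h1 := hmb g; have h2 := hmn g
    set m := max (b^2 - g^2) 0
    have : |(24 * g^2 * m - 6 * m^2) / b^4| ≤ 30 := by
      rw [abs_div, abs_of_pos (by positivity : 0 < b^4), div_le_iff₀ (by positivity)]
      refine (abs_sub _ _).trans ?_
      rw [abs_of_nonneg (by positivity), abs_of_nonneg (by positivity)]
      calc 24 * g^2 * m + 6 * m^2 ≤ 24 * b^2 * b^2 + 6 * (b^2)^2 := by gcongr
        _ = _ := by ring
    nlinarith

section bdy
variable {VF VE gL gin α κ : ℝ} {p pg pgg pv : ℝ → ℝ → ℝ} {φ φ1 φ2 : ℝ → ℝ} {R A : ℝ}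
  {c1 c2 t1 t2 q k K : ℝ}

lemma J_fac (hVE : VF < VE) {v : ℝ} (hv : v ≤ VF) (g : ℝ) : Jflux VE gL v g = (VE - v) * (g - gJ VE gL v) := by
  unfold Jflux gJ
  have : VE - v ≠ 0 := by linarith
  field_simp; ring

lemma Bcmp (S : Sys VF VE gL gin α κ p pg pgg pv) (Y : Bdy VF VE gL p) (hq : 1 < q) (hk : 0 < k) {g : ℝ} (hg : 0 < g) :
    0 ≤ Jflux VE gL 0 g * Gk q k (p 0 g) ∧ Jflux VE gL 0 g * Gk q k (p 0 g) ≤ Jflux VE gL VF g * Gk q k (p VF g) := by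
  have hVF := S.hVF; have hVE := S.hVE; have hgL := S.hgL
  have hV0 : 0 < VE := by linarith
  have hJ0 : Jflux VE gL 0 g = g * VE := by unfold Jflux; ring
  have hp0 := S.nonneg 0 g
  have hpF := S.nonneg VF g
  have hG0 := Gk_nn hq hk hp0
  have hGF := Gk_nn hq hk hpF
  refine ⟨by rw [hJ0]; positivity, ?_⟩
  rcases lt_or_ge g (gJ VE gL VF) with h | h
  · obtain ⟨a, b⟩ := Y.low g hg h
    rw [a, b, Gk_zero]; simp
  have hJF : 0 ≤ Jflux VE gL VF g := by rw [J_fac hVE le_rfl]; exact mul_nonneg (by linarith) (by linarith)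
  rcases hp0.eq_or_lt with h0 | h0
  · rw [← h0, Gk_zero, mul_zero]; positivity
  have hb := Y.bv g hg
  have hJle : Jflux VE gL VF g ≤ Jflux VE gL 0 g := by
    unfold Jflux; nlinarith [mul_pos hgL hVF, mul_pos hg hVF]
  have hJ0p : 0 < Jflux VE gL 0 g := by rw [hJ0]; positivity
  have hJFp : 0 < Jflux VE gL VF g := by
    rcases hJF.eq_or_lt with h' | h'
    · rw [← h', zero_mul] at hb
      have := mul_pos hJ0p h0; linarith
    · exact h'
  have hpp : p 0 g ≤ p VF g := by
    by_contra hc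
    push Not at hc
    have : Jflux VE gL VF g * p VF g < Jflux VE gL 0 g * p 0 g :=
      calc _ < Jflux VE gL VF g * p 0 g := by gcongr
        _ ≤ _ := by gcongr
    linarith
  have hr := mul_le_mul_of_nonneg_left (Gk_ratio hq hk hp0 hpp) hJF
  have : p 0 g * (Jflux VE gL 0 g * Gk q k (p 0 g)) ≤ p 0 g * (Jflux VE gL VF g * Gk q k (p VF g)) := by
    calc _ = (Jflux VE gL 0 g * p 0 g) * Gk q k (p 0 g) := by ring
      _ = (Jflux VE gL VF g * p VF g) * Gk q k (p 0 g) := by rw [hb]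
      _ = Jflux VE gL VF g * (p VF g * Gk q k (p 0 g)) := by ring
      _ ≤ _ := hr
      _ = _ := by ring
  exact le_of_mul_le_mul_left this h0

lemma NBcmp (S : Sys VF VE gL gin α κ p pg pgg pv) (Y : Bdy VF VE gL p) (T : TF φ φ1 φ2 R A) (hq : 1 < q) (hk : 0 < k) :
    0 ≤ Nf VE gL p φ (Gk q k) 0 ∧ Nf VE gL p φ (Gk q k) 0 ≤ Nf VE gL p φ (Gk q k) VF := by
  have hVF := S.hVF
  unfold Nf
  constructor
  · refine setIntegral_nonneg measurableSet_Ioi fun g hg => ?_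
    have := mul_nonneg (T.nn g (le_of_lt hg)) (Bcmp S Y hq hk hg).1
    linarith
  · refine setIntegral_mono_on (NG_int S Y T hq hk ⟨le_rfl, hVF.le⟩) (NG_int S Y T hq hk ⟨hVF.le, le_rfl⟩) measurableSet_Ioi fun g hg => ?_
    have := mul_le_mul_of_nonneg_left (Bcmp S Y hq hk hg).2 (T.nn g (le_of_lt hg))
    linarith

lemma min_nn (S : Sys VF VE gL gin α κ p pg pgg pv) (T : TF φ φ1 φ2 R A) (hq : 1 < q) (hk : 0 < k)
    (h1 : 0 ≤ t1) (h2 : t2 ≤ VF) (hℓ : ∀ v ∈ Icc t1 t2, 0 ≤ c1 + c2 * v) (hK : 0 ≤ K) :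
    0 ≤ ∫ v in Ioo t1 t2, min (∫ g in Ioi (0:ℝ), Ed α p pg φ (fun y => -Gk2 q k y) c1 c2 v g) K := by
  refine setIntegral_nonneg measurableSet_Ioo fun v hv => le_min ?_ hK
  exact setIntegral_nonneg measurableSet_Ioi fun g hg => Ed_nonneg S T (GCF hq hk) ⟨h1.trans_lt hv.1, hv.2.trans_le h2⟩ (le_of_lt hg) (hℓ v ⟨hv.1.le, hv.2.le⟩)

/-- constant for `X` -/
def Kx (VF VE gL gin α κ : ℝ) : ℝ :=
  235 * 8 * Ken VF VE gL gin α κ 0 1 / VF + 235 * 8 * Ken VF VE gL gin α κ 1 0 +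
   (gJ VE gL VF ^ 2 + 6 * gJ VE gL VF + 30) * Ken VF VE gL gin α κ 1 0

lemma gJ_le (hVE : VF < VE) (hgL : 0 < gL) {v : ℝ} (hv : v ∈ Icc 0 VF) : gJ VE gL v ≤ gJ VE gL VF := by
  unfold gJ
  have h1 := hv.1; have h2 := hv.2
  have : 0 < VE - VF := by linarith
  have : 0 ≤ gL * VF := mul_nonneg hgL.le (h1.trans h2)
  gcongr

lemma XN (S : Sys VF VE gL gin α κ p pg pgg pv) (Y : Bdy VF VE gL p) (hq : 1 < q) (hk : 0 < k)
    (hd : IntegrableOn (Wd gL q p) (Ioo 0 VF ×ˢ Ioi (0:ℝ))) (hR : 1 ≤ R) {v : ℝ} (hv : v ∈ Ioo 0 VF) :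
    Nf VE gL p (cut (fun g => 0 + rho (gJ VE gL v) g) R) (Gk q k) v - Nf VE gL p (lam (gJ VE gL v)) (Gk q k) v ≤
     Kx VF VE gL gin α κ * (q * ∫ x in Ioo 0 VF ×ˢ Ioi (0:ℝ), Wd gL q p x) := by
  have hVF := S.hVF; have hVE := S.hVE; have hgL := S.hgL
  set D := q * ∫ x in Ioo 0 VF ×ˢ Ioi (0:ℝ), Wd gL q p x with hD
  have hb : 0 < gJ VE gL v := by unfold gJ; have := hv.1; have : 0 < VE - v := by linarith [hv.2]
                                 positivity
  have Tω := (rho_GF (le_refl (0:ℝ)) zero_le_one le_rfl).cut_TF hR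
  have Tr := (rho_GF (e := 0) hb.le le_rfl zero_le_one).cut_TF hR
  have Tl := lam_TF hb (gJ_le hVE hgL ⟨hv.1.le, hv.2.le⟩)
  have a1 := energy (c1 := 0) (c2 := 1) S Y Tω hq hk hd le_rfl hVF le_rfl (fun v hv => by linarith [hv.1]) (le_refl 0)
  have b1 := min_nn (c1 := 0) (c2 := 1) S Tω hq hk le_rfl le_rfl (fun v hv => by linarith [hv.1]) (le_refl 0)
  have a2 := energy (c1 := 1) (c2 := 0) S Y Tr hq hk hd le_rfl hv.1 hv.2.le (fun v hv => by norm_num) (le_refl 0)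
  have b2 := min_nn (c1 := 1) (c2 := 0) S Tr hq hk le_rfl hv.2.le (fun v hv => by norm_num) (le_refl 0)
  have a3 := energy (c1 := 1) (c2 := 0) S Y Tl hq hk hd hv.1.le hv.2 le_rfl (fun v hv => by norm_num) (le_refl 0)
  have b3 := min_nn (c1 := 1) (c2 := 0) S Tl hq hk hv.1.le le_rfl (fun v hv => by norm_num) (le_refl 0)
  have n1 := NBcmp S Y Tr hq hk
  have n2 := NBcmp S Y Tl hq hk
  have n3 : Nf VE gL p (cut (fun g => 0 + rho (gJ VE gL v) g) R) (Gk q k) VF ≤ Nf VE gL p (cut (fun g => 1 + rho 0 g) R) (Gk q k) VF := by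
    unfold Nf
    refine setIntegral_mono_on (NG_int S Y Tr hq hk ⟨hVF.le, le_rfl⟩) (NG_int S Y Tω hq hk ⟨hVF.le, le_rfl⟩) measurableSet_Ioi fun g hg => ?_
    have h1 := Bcmp S Y hq hk hg
    have h2 := rho_mono (g := g) hb.le
    have h3 := (chi_bd (g/R)).1
    unfold cut
    have h4 : (0 + rho (gJ VE gL v) g) * chi (g/R) ≤ (1 + rho 0 g) * chi (g/R) := by gcongr; norm_num
    have := mul_le_mul_of_nonneg_right h4 (h1.1.trans h1.2)
    linarith
  simp only [zero_mul, one_mul, add_zero, zero_add, ← hD] at a1 a2 a3 b1 b2 b3 n1 n2 n3 ⊢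
  have a1' : Nf VE gL p (cut (fun g => 1 + rho 0 g) R) (Gk q k) VF ≤ 235 * 8 * Ken VF VE gL gin α κ 0 1 / VF * D := by
    rw [div_mul_eq_mul_div, le_div_iff₀ hVF]; linarith
  unfold Kx
  linarith [n1.1, n1.2, n2.1, n2.2]

end bdy

lemma liminf_min_nat {a : ℕ → ENNReal} : liminf a atTop ≤ liminf (fun n => min (a n) (ENNReal.ofReal ((n:ℝ)+1))) atTop := by
  refine le_of_forall_lt_imp_le_of_dense fun c hc => ?_
  have h1 := eventually_lt_of_lt_liminf hc
  have hct : c ≠ ⊤ := (hc.trans_le le_top).ne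
  refine le_liminf_of_le (by isBoundedDefault) ?_
  filter_upwards [h1, tnat.eventually_ge_atTop c.toReal] with n hn hn2
  refine le_min hn.le ?_
  rw [← ENNReal.ofReal_toReal hct]
  exact ENNReal.ofReal_le_ofReal hn2

section
variable {VF VE gL gin α κ : ℝ} {p pg pgg pv : ℝ → ℝ → ℝ} {q : ℝ}

def ed (q : ℝ) (p pg : ℝ → ℝ → ℝ) (v g : ℝ) : ℝ := q^2 * (p v g ^ (q-2) * pg v g ^ 2)

def Ke (VF VE gL gin α κ : ℝ) : ℝ := 4 / α * (235 * 1 * Ken VF VE gL gin α κ 1 0)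

theorem grad_bd (S : Sys VF VE gL gin α κ p pg pgg pv) (Y : Bdy VF VE gL p) (hq : 4/3 ≤ q)
    (hd : IntegrableOn (Wd gL q p) (Ioo 0 VF ×ˢ Ioi (0:ℝ))) :
    ∫⁻ v in Ioo 0 VF, ∫⁻ g in Ioi (0:ℝ), ENNReal.ofReal (ed q p pg v g) ≤
      ENNReal.ofReal (Ke VF VE gL gin α κ * (q * ∫ x in Ioo 0 VF ×ˢ Ioi (0:ℝ), Wd gL q p x)) := by
  have hVF := S.hVF; have hα := S.hα
  have hq1 : 1 < q := by linarith
  set D := q * ∫ x in Ioo 0 VF ×ˢ Ioi (0:ℝ), Wd gL q p x with hD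
  have hn : ∀ n : ℕ, 1 ≤ (n:ℝ) + 1 := fun n => by linarith [(Nat.cast_nonneg n : (0:ℝ) ≤ n)]
  have hk : ∀ n : ℕ, 0 < (n:ℝ) + 1 := fun n => by positivity
  let E : ℕ → ℝ → ℝ → ℝ := fun n v g => Ed α p pg (cut (fun _ => 1) ((n:ℝ)+1)) (fun y => -Gk2 q ((n:ℝ)+1) y) 1 0 v g
  have hpr := fun n : ℕ => prod_ineq S (chi_TF (hn n)) (GCF hq1 (hk n)) (c1 := 1) (c2 := 0) le_rfl hVF le_rfl (fun v hv => by norm_num) (hk n).le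
  have hnn : ∀ n : ℕ, ∀ v ∈ Ioo 0 VF, ∀ g, 0 ≤ g → 0 ≤ E n v g := fun n v hv g hg =>
    Ed_nonneg S (chi_TF (hn n)) (GCF hq1 (hk n)) hv hg (by norm_num)
  have hmin : ∀ n : ℕ, ∫⁻ v in Ioo 0 VF, ENNReal.ofReal (min (∫ g in Ioi (0:ℝ), E n v g) ((n:ℝ)+1)) ≤
      ENNReal.ofReal (235 * 1 * Ken VF VE gL gin α κ 1 0 * D) := by
    intro n
    have h1 := energy (c1 := 1) (c2 := 0) S Y (chi_TF (hn n)) hq1 (hk n) hd le_rfl hVF le_rfl (fun v hv => by norm_num) (hk n).le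
    have h2 := NBcmp S Y (chi_TF (hn n)) hq1 (hk n)
    simp only [zero_mul, one_mul, add_zero] at h1
    have h3 : ∫ v in Ioo 0 VF, min (∫ g in Ioi (0:ℝ), E n v g) ((n:ℝ)+1) ≤ 235 * 1 * Ken VF VE gL gin α κ 1 0 * D := by
      simp only [E]; linarith
    have hnn' : ∀ v ∈ Ioo 0 VF, 0 ≤ min (∫ g in Ioi (0:ℝ), E n v g) ((n:ℝ)+1) := fun v hv =>
      le_min (setIntegral_nonneg measurableSet_Ioi fun g hg => hnn n v hv g (le_of_lt hg)) (hk n).le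
    have hi : IntegrableOn (fun v => min (∫ g in Ioi (0:ℝ), E n v g) ((n:ℝ)+1)) (Ioo 0 VF) := by
      refine Measure.integrableOn_of_bounded (M := (n:ℝ)+1) (by simp) ((hpr n).2.2.1.min measurable_const).aestronglyMeasurable ?_
      refine (ae_restrict_iff' measurableSet_Ioo).2 (Eventually.of_forall fun v hv => ?_)
      rw [Real.norm_eq_abs, abs_of_nonneg (hnn' v hv)]; exact min_le_right _ _
    rw [← ofReal_integral_eq_lintegral_ofReal hi ((ae_restrict_iff' measurableSet_Ioo).2 (Eventually.of_forall hnn'))]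
    exact ENNReal.ofReal_le_ofReal h3
  have hmE : ∀ n, Measurable (fun x : ℝ × ℝ => E n x.1 x.2) := fun n => Ed_meas S (chi_TF (hn n)) (GCF hq1 (hk n))
  have hv1 : ∀ v ∈ Ioo 0 VF, ENNReal.ofReal (α / 4) * ∫⁻ g in Ioi (0:ℝ), ENNReal.ofReal (ed q p pg v g) ≤
      liminf (fun n : ℕ => ENNReal.ofReal (min (∫ g in Ioi (0:ℝ), E n v g) ((n:ℝ)+1))) atTop := by
    intro v hv
    have e1 : ∀ n : ℕ, ENNReal.ofReal (min (∫ g in Ioi (0:ℝ), E n v g) ((n:ℝ)+1)) = min (∫⁻ g in Ioi (0:ℝ), ENNReal.ofReal (E n v g)) (ENNReal.ofReal ((n:ℝ)+1)) := by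
      intro n
      rw [← ofReal_integral_eq_lintegral_ofReal ((hpr n).2.1 v hv) ((ae_restrict_iff' measurableSet_Ioi).2 (Eventually.of_forall fun g hg => hnn n v hv g (le_of_lt hg)))]
      exact (ENNReal.ofReal_mono).map_min
    simp only [e1]
    refine le_trans ?_ liminf_min_nat
    rw [← lintegral_const_mul' _ _ ENNReal.ofReal_ne_top]
    refine le_trans (lintegral_mono_ae ?_) (lintegral_liminf_le fun n => ((hmE n).comp measurable_prodMk_left).ennreal_ofReal)
    refine (ae_restrict_iff' measurableSet_Ioi).2 (Eventually.of_forall fun g hg => ?_)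
    have hg0 : (0:ℝ) < g := hg
    have hy := S.pos v hv g hg0.le
    have hl : Tendsto (fun n : ℕ => E n v g) atTop (𝓝 (α * (q * (q-1) * p v g ^ (q-2) * pg v g ^2))) := by
      have h := (((Gk2_lim (q := q) hy).mul_const (pg v g ^2)).const_mul α)
      refine h.congr' ?_
      filter_upwards [tnat.eventually_ge_atTop g] with n hng
      simp only [E, Ed, cut_eq (hk n) hng]; ring
    have hl2 := ((ENNReal.continuous_ofReal.tendsto _).comp hl).liminf_eq
    simp only [Function.comp_def] at hl2
    rw [hl2, ← ENNReal.ofReal_mul (by positivity)]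
    apply ENNReal.ofReal_le_ofReal
    unfold ed
    have hpp : 0 ≤ p v g ^ (q-2) * pg v g ^ 2 := mul_nonneg (rpow_nonneg hy.le _) (sq_nonneg _)
    have hqq : q^2 ≤ 4 * (q * (q-1)) := by nlinarith
    calc α / 4 * (q^2 * (p v g ^ (q-2) * pg v g ^ 2)) ≤ α / 4 * (4 * (q * (q-1)) * (p v g ^ (q-2) * pg v g ^ 2)) := by gcongr
      _ = _ := by ring
  have hmain : ENNReal.ofReal (α / 4) * ∫⁻ v in Ioo 0 VF, ∫⁻ g in Ioi (0:ℝ), ENNReal.ofReal (ed q p pg v g) ≤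
      ENNReal.ofReal (235 * 1 * Ken VF VE gL gin α κ 1 0 * D) := by
    rw [← lintegral_const_mul' _ _ ENNReal.ofReal_ne_top]
    calc _ ≤ ∫⁻ v in Ioo 0 VF, liminf (fun n : ℕ => ENNReal.ofReal (min (∫ g in Ioi (0:ℝ), E n v g) ((n:ℝ)+1))) atTop :=
          lintegral_mono_ae ((ae_restrict_iff' measurableSet_Ioo).2 (Eventually.of_forall hv1))
      _ ≤ liminf (fun n : ℕ => ∫⁻ v in Ioo 0 VF, ENNReal.ofReal (min (∫ g in Ioi (0:ℝ), E n v g) ((n:ℝ)+1))) atTop :=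
          lintegral_liminf_le fun n => ((hpr n).2.2.1.min measurable_const).ennreal_ofReal
      _ ≤ liminf (fun n : ℕ => ENNReal.ofReal (235 * 1 * Ken VF VE gL gin α κ 1 0 * D)) atTop := liminf_le_liminf (Eventually.of_forall hmin)
      _ = _ := by simp
  calc ∫⁻ v in Ioo 0 VF, ∫⁻ g in Ioi (0:ℝ), ENNReal.ofReal (ed q p pg v g)
      = ENNReal.ofReal (4/α) * (ENNReal.ofReal (α / 4) * ∫⁻ v in Ioo 0 VF, ∫⁻ g in Ioi (0:ℝ), ENNReal.ofReal (ed q p pg v g)) := by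
        rw [← mul_assoc, ← ENNReal.ofReal_mul (by positivity), show 4/α * (α/4) = 1 by field_simp, ENNReal.ofReal_one, one_mul]
    _ ≤ ENNReal.ofReal (4/α) * ENNReal.ofReal (235 * 1 * Ken VF VE gL gin α κ 1 0 * D) := by gcongr
    _ = _ := by rw [← ENNReal.ofReal_mul (by positivity)]; unfold Ke; congr 1; ring

theorem X_bd (S : Sys VF VE gL gin α κ p pg pgg pv) (Y : Bdy VF VE gL p) (hq : 1 < q)
    (hd : IntegrableOn (Wd gL q p) (Ioo 0 VF ×ˢ Ioi (0:ℝ))) {v : ℝ} (hv : v ∈ Ioo 0 VF) :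
    ∫⁻ g in Ioi (0:ℝ), ENNReal.ofReal (Jflux VE gL v g * ((rho (gJ VE gL v) g - lam (gJ VE gL v) g) * p v g ^ q)) ≤
      ENNReal.ofReal (Kx VF VE gL gin α κ * (q * ∫ x in Ioo 0 VF ×ˢ Ioi (0:ℝ), Wd gL q p x)) := by
  have hVF := S.hVF; have hVE := S.hVE; have hgL := S.hgL
  have hn : ∀ n : ℕ, 1 ≤ (n:ℝ) + 1 := fun n => by linarith [(Nat.cast_nonneg n : (0:ℝ) ≤ n)]
  have hk : ∀ n : ℕ, 0 < (n:ℝ) + 1 := fun n => by positivity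
  have hv' : v ∈ Icc 0 VF := ⟨hv.1.le, hv.2.le⟩
  have hb : 0 < gJ VE gL v := by
    unfold gJ; have := hv.1; have : 0 < VE - v := by linarith [hv.2]
    positivity
  have Tr := fun n => (rho_GF (e := 0) hb.le le_rfl zero_le_one).cut_TF (hn n)
  have Tl := lam_TF hb (gJ_le hVE hgL hv')
  have hi1 := fun n : ℕ => NG_int S Y (Tr n) hq (hk n) hv'
  have hi2 := fun n : ℕ => NG_int S Y Tl hq (hk n) hv'
  refine fatou_bd (f := fun n g => Jflux VE gL v g * (cut (fun g => 0 + rho (gJ VE gL v) g) ((n:ℝ)+1) g * Gk q ((n:ℝ)+1) (p v g)) -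
     Jflux VE gL v g * (lam (gJ VE gL v) g * Gk q ((n:ℝ)+1) (p v g))) (fun n => ((hi1 n).sub (hi2 n)).1.aemeasurable) ?_ ?_
  · refine Eventually.of_forall fun g => ?_
    have h := (((Gk_lim hq (S.nonneg v g)).const_mul (rho (gJ VE gL v) g - lam (gJ VE gL v) g)).const_mul (Jflux VE gL v g))
    refine h.congr' ?_
    filter_upwards [tnat.eventually_ge_atTop g] with n hng
    rw [cut_eq (hk n) hng]; ring
  · refine Eventually.of_forall fun n => ?_
    have hi3 : IntegrableOn (fun g => Jflux VE gL v g * (cut (fun g => 0 + rho (gJ VE gL v) g) ((n:ℝ)+1) g * Gk q ((n:ℝ)+1) (p v g)) -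
     Jflux VE gL v g * (lam (gJ VE gL v) g * Gk q ((n:ℝ)+1) (p v g))) (Ioi (0:ℝ)) := (hi1 n).sub (hi2 n)
    rw [← ofReal_integral_eq_lintegral_ofReal hi3]
    · refine ENNReal.ofReal_le_ofReal ?_
      rw [integral_sub (hi1 n) (hi2 n)]
      exact XN S Y hq (hk n) hd (hn n) hv
    · refine (ae_restrict_iff' measurableSet_Ioi).2 (Eventually.of_forall fun g hg => ?_)
      have hg0 : (0:ℝ) < g := hg
      have hG := Gk_nn hq (hk n) (S.nonneg v g)
      have hVv : 0 < VE - v := by linarith [hv.2]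
      simp only [Pi.zero_apply]
      rw [J_fac hVE hv'.2]
      rcases le_total (gJ VE gL v) g with h | h
      · rw [Tl.supp g h]
        have h1 := (Tr n).nn g hg0.le
        have : 0 ≤ g - gJ VE gL v := by linarith
        have : 0 ≤ (VE - v) * (g - gJ VE gL v) * (cut (fun g => 0 + rho (gJ VE gL v) g) ((n:ℝ)+1) g * Gk q ((n:ℝ)+1) (p v g)) := by positivity
        linarith
      · have h1 : cut (fun g => 0 + rho (gJ VE gL v) g) ((n:ℝ)+1) g = 0 := by
          simp only [cut, rho]; rw [max_eq_right (by linarith)]; norm_num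
        rw [h1]
        have := Tl.nn g hg0.le
        have : 0 ≤ gJ VE gL v - g := by linarith
        have : 0 ≤ (VE - v) * (gJ VE gL v - g) * (lam (gJ VE gL v) g * Gk q ((n:ℝ)+1) (p v g)) := by positivity
        linarith

def cw (VF VE gL : ℝ) : ℝ := (VE - VF)⁻¹ * (2 * (1 + gJ VE gL VF + gL)^2 + gJ VE gL VF * (gJ VE gL VF + gL)^2)

lemma weight (hVF : 0 < VF) (hVE : VF < VE) (hgL : 0 < gL) {v g δ : ℝ} (hv : v ∈ Ioo 0 VF) (hg : 0 < g) (hδ : 0 < δ) (hδ1 : δ ≤ 1)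
    (hgd : δ ≤ |g - gJ VE gL v|) :
    δ ^ 4 * (g + gL) ^ 2 ≤ cw VF VE gL * (Jflux VE gL v g * (rho (gJ VE gL v) g - lam (gJ VE gL v) g)) := by
  have hv' : v ∈ Icc 0 VF := ⟨hv.1.le, hv.2.le⟩
  have hVv : 0 < VE - v := by linarith [hv.2]
  have hVV : 0 < VE - VF := by linarith
  have hb : 0 < gJ VE gL v := by unfold gJ; have := hv.1; positivity
  have hbF := gJ_le hVE hgL hv'
  rw [J_fac hVE hv'.2]
  set b := gJ VE gL v
  set gF := gJ VE gL VF
  have hgF : 0 < gF := by linarith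
  have hdiv : 1 ≤ (VE - VF)⁻¹ * (VE - v) := by
    rw [inv_mul_eq_div, one_le_div hVV]; linarith [hv.2]
  rcases le_total b g with h | h
  · rw [abs_of_nonneg (by linarith)] at hgd
    rw [(lam_TF hb hbF).supp g h, sub_zero]
    unfold rho
    rw [max_eq_left (by linarith)]
    set r := g - b with hr
    have hr0 : 0 < r := by linarith
    have k1 : δ^4 * (1 + r)^2 * (1 + r^2) ≤ 4 * r^4 * (1+r^2) := by
      have : δ^4 * (1+r)^2 ≤ 4 * r^4 := by
        rcases le_total r 1 with h1 | h1
        · calc δ^4 * (1+r)^2 ≤ r^4 * (1+1)^2 := by gcongr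
            _ = _ := by ring
        · calc δ^4 * (1+r)^2 ≤ 1^4 * (r + r)^2 := by gcongr
            _ = 4 * r^2 := by ring
            _ ≤ 4 * r^4 := by gcongr; norm_num
      gcongr
    have k2 : δ^4 * (1 + r^2) ≤ 2 * r^4 := by
      rcases le_total r 1 with h1 | h1
      · calc δ^4 * (1+r^2) ≤ r^4 * (1+1^2) := by gcongr
          _ = _ := by ring
      · calc δ^4 * (1+r^2) ≤ 1^4 * (r^2 + r^2) := by gcongr; exact one_le_pow₀ h1
          _ = 2 * r^2 := by ring
          _ ≤ 2 * r^4 := by gcongr; norm_num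
    have k3 : δ^4 * (g+gL)^2 ≤ 2 * (1 + gF + gL)^2 * (r * (r^3/(1+r^2))) := by
      have e : r * (r^3/(1+r^2)) = r^4/(1+r^2) := by ring
      rw [e, ← mul_div_assoc, le_div_iff₀ (by positivity)]
      have hgg : g + gL = r + b + gL := by rw [hr]; ring
      rcases le_total r 1 with h1 | h1
      · calc δ^4 * (g+gL)^2 * (1+r^2) = (δ^4 * (1+r^2)) * (r + b + gL)^2 := by rw [hgg]; ring
          _ ≤ (2 * r^4) * (1 + gF + gL)^2 := by gcongr
          _ = _ := by ring
      · calc δ^4 * (g+gL)^2 * (1+r^2) = δ^4 * (r + b + gL)^2 * (1 + r^2) := by rw [hgg]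
          _ ≤ 1^4 * (r + r * gF + r * gL)^2 * (r^2+r^2) := by
              have : b ≤ r * gF := by nlinarith
              have : gL ≤ r * gL := by nlinarith
              have : 1 ≤ r^2 := one_le_pow₀ h1
              gcongr
          _ = _ := by ring
    have k4 : 0 ≤ r * (r^3/(1+r^2)) := by positivity
    calc δ^4 * (g+gL)^2 ≤ 2 * (1 + gF + gL)^2 * (r * (r^3/(1+r^2))) := k3
      _ ≤ (2 * (1 + gF + gL)^2 + gF * (gF+gL)^2) * (r * (r^3/(1+r^2))) := by
          gcongr; have : 0 ≤ gF * (gF+gL)^2 := by positivity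
          linarith
      _ = 1 * ((2 * (1 + gF + gL)^2 + gF * (gF+gL)^2) * (r * (r^3/(1+r^2)))) := by ring
      _ ≤ ((VE - VF)⁻¹ * (VE - v)) * ((2 * (1 + gF + gL)^2 + gF * (gF+gL)^2) * (r * (r^3/(1+r^2)))) := by gcongr
      _ = _ := by unfold cw; ring
  · rw [abs_sub_comm, abs_of_nonneg (by linarith)] at hgd
    have h0 : rho b g = 0 := by unfold rho; rw [max_eq_right (by linarith)]; norm_num
    rw [h0, zero_sub]
    unfold lam
    rw [max_eq_left (by nlinarith)]
    set r := b - g with hr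
    have hr0 : 0 < r := by linarith
    have k1 : r^3 / gF ≤ (b^2 - g^2)^3/b^4 := by
      rw [div_le_div_iff₀ hgF (by positivity)]
      have e : b^2 - g^2 = r * (b + g) := by rw [hr]; ring
      rw [e, mul_pow]
      calc r^3 * b^4 = r^3 * b^3 * b := by ring
        _ ≤ r^3 * (b+g)^3 * gF := by gcongr; linarith
    have k3 : δ^4 * (g+gL)^2 ≤ gF * (gF + gL)^2 * (r * ((b^2 - g^2)^3/b^4)) := by
      calc δ^4 * (g+gL)^2 ≤ r^4 * (gF+gL)^2 := by gcongr; linarith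
        _ = gF * (gF + gL)^2 * (r * (r^3/gF)) := by field_simp
        _ ≤ _ := by gcongr
    have k4 : 0 ≤ (b^2 - g^2)^3/b^4 := le_trans (by positivity) k1
    calc δ^4 * (g+gL)^2 ≤ gF * (gF+gL)^2 * (r * ((b^2 - g^2)^3/b^4)) := k3
      _ ≤ (2 * (1 + gF + gL)^2 + gF * (gF+gL)^2) * (r * ((b^2 - g^2)^3/b^4)) := by
          gcongr; have : 0 ≤ 2 * (1 + gF + gL)^2 := by positivity
          linarith
      _ = 1 * ((2 * (1 + gF + gL)^2 + gF * (gF+gL)^2) * (r * ((b^2 - g^2)^3/b^4))) := by ring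
      _ ≤ ((VE - VF)⁻¹ * (VE - v)) * ((2 * (1 + gF + gL)^2 + gF * (gF+gL)^2) * (r * ((b^2 - g^2)^3/b^4))) := by gcongr
      _ = _ := by unfold cw; rw [hr]; ring
end

def Ci (β C1 C2 : ℝ) : ℝ := (1 + C1) ^ (β - 1) + (C2^2*C1 + 2*C2) * (1 + C1 * (C2^2*C1 + 2*C2)) ^ (β-1)

lemma Ci_pos {β C1 C2 : ℝ} (hC1 : 0 ≤ C1) (hC2 : 0 ≤ C2) : 0 < Ci β C1 C2 := by
  unfold Ci; positivity

lemma interp {β C1 C2 m E s : ℝ} (hβ1 : 1 < β) (hβ2 : β < 4/3) (hC1 : 0 ≤ C1) (hC2 : 0 ≤ C2) (hm : 0 ≤ m) (hmE : m ≤ E) (hs : 0 ≤ s)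
    (hsm : s^2 ≤ C1 * (m * E)) (h : ∀ δ, 0 < δ → δ ≤ 1 → m * δ^4 ≤ C2 * (δ^5 * s + 1)) :
    m * s ^ (β - 1) ≤ Ci β C1 C2 * (1 + E) := by
  have hE : 0 ≤ E := hm.trans hmE
  have hb : 0 ≤ β - 1 := by linarith
  set C3 := C2^2*C1 + 2*C2 with hC3
  have hC30 : 0 ≤ C3 := by positivity
  have p1 : 0 ≤ (1 + C1) ^ (β - 1) := by positivity
  have p2 : 0 ≤ C3 * (1 + C1 * C3) ^ (β-1) := by positivity
  rcases le_total E 1 with h1 | h1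
  · have hs1 : s ≤ 1 + C1 := by
      have : C1 * (m * E) ≤ C1 * 1 := by
        gcongr; nlinarith
      nlinarith
    have : m * s ^ (β - 1) ≤ 1 * (1 + C1) ^ (β - 1) := by gcongr; linarith
    unfold Ci
    rw [← hC3]
    nlinarith
  · set x := E ^ ((1:ℝ)/6) with hx
    have hx1 : 1 ≤ x := one_le_rpow h1 (by norm_num)
    have hx0 : 0 < x := by linarith
    have hxE : E = x ^ 6 := by
      rw [hx, ← rpow_natCast, ← rpow_mul hE]; norm_num
    have h2 := h (1/x) (by positivity) (by rw [div_le_one hx0]; exact hx1)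
    have h3 : m * x ≤ C2 * (s + x^5) := by
      have : (m * (1/x)^4) * x^5 ≤ (C2 * ((1/x)^5 * s + 1)) * x^5 := by gcongr
      calc m * x = (m * (1/x)^4) * x^5 := by field_simp
        _ ≤ _ := this
        _ = _ := by field_simp
    have h4 : m ≤ C3 * x^4 := by
      have a1 : C2 * s ≤ (m * x + C2^2*C1*x^5)/2 := by
        apply abs_le_of_sq_le_sq' _ (by positivity) |>.2
        calc (C2 * s)^2 = C2^2 * s^2 := by ring
          _ ≤ C2^2 * (C1 * (m * E)) := by gcongr
          _ = C2^2 * C1 * m * x^6 := by rw [hxE]; ring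
          _ ≤ _ := by nlinarith [sq_nonneg (m * x - C2^2*C1*x^5)]
      have a2 : m * x ≤ (C3 * x^4) * x := by rw [hC3]; nlinarith
      exact le_of_mul_le_mul_right a2 hx0
    have h5 : s ≤ (1 + C1 * C3) * x^5 := by
      apply abs_le_of_sq_le_sq' _ (by positivity) |>.2
      calc s^2 ≤ C1 * (m * E) := hsm
        _ ≤ C1 * ((C3 * x^4) * x^6) := by rw [hxE]; gcongr
        _ = (C1 * C3) * x^10 := by ring
        _ ≤ (1 + C1 * C3)^2 * x^10 := by
            gcongr; nlinarith [mul_nonneg hC1 hC30]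
        _ = _ := by ring
    have h6 : (x^5) ^ (β-1) ≤ x^2 := by
      rw [← rpow_natCast, ← rpow_mul hx0.le, ← rpow_natCast]
      apply rpow_le_rpow_of_exponent_le hx1
      push_cast; linarith
    have : m * s ^ (β - 1) ≤ C3 * (1 + C1 * C3) ^ (β-1) * E := by
      calc m * s ^ (β - 1) ≤ (C3 * x^4) * ((1 + C1 * C3) * x^5) ^ (β-1) := by gcongr
        _ = (C3 * x^4) * ((1 + C1 * C3) ^ (β-1) * (x^5) ^ (β-1)) := by rw [mul_rpow (by positivity) (by positivity)]
        _ ≤ (C3 * x^4) * ((1 + C1 * C3) ^ (β-1) * x^2) := by gcongr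
        _ = _ := by rw [hxE]; ring
    unfold Ci
    rw [← hC3]
    nlinarith

/-- sup bound from the one dimensional Sobolev embedding -/
lemma sup_bd {u u' : ℝ → ℝ} {g : ℝ} (hu : ∀ h ∈ Icc g (g+1), HasDerivAt u (u' h) h) (hc : ContinuousOn u' (Icc g (g+1)))
    (F : ℝ → ℝ) (hF : IntegrableOn F (Icc g (g+1))) (hb : ∀ h ∈ Icc g (g+1), |u h| + |u' h| ≤ F h) : u g ≤ ∫ h in Icc g (g+1), F h := by
  have hle : g ≤ g + 1 := by linarith
  have hcu : ContinuousOn u (Icc g (g+1)) := fun h hh => (hu h hh).continuousAt.continuousWithinAt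
  have hcc : ContinuousOn (fun h => -u h + (g+1-h) * u' h) (Icc g (g+1)) := by fun_prop
  have hii : IntervalIntegrable (fun h => -u h + (g+1-h) * u' h) volume g (g+1) := by
    apply ContinuousOn.intervalIntegrable; rwa [uIcc_of_le hle]
  have h1 := intervalIntegral.integral_eq_sub_of_hasDerivAt (f := fun h => (g+1-h) * u h) (f' := fun h => -u h + (g+1-h) * u' h) (a := g) (b := g+1)
    (by intro h hh
        rw [uIcc_of_le hle] at hh
        have := ((hasDerivAt_id h).const_sub (g+1)).mul (hu h hh)
        refine this.congr_deriv ?_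
        simp) hii
  have h2 : u g = ∫ h in g..(g+1), -(-u h + (g+1-h) * u' h) := by
    rw [intervalIntegral.integral_neg, h1]; ring
  rw [h2, intervalIntegral.integral_of_le hle, ← integral_Icc_eq_integral_Ioc]
  have hi : IntegrableOn (fun h => -(-u h + (g+1-h) * u' h)) (Icc g (g+1)) := hcc.neg.integrableOn_Icc
  refine setIntegral_mono_on hi hF measurableSet_Icc fun h hh => ?_
  refine le_trans ?_ (hb h hh)
  have e1 := le_abs_self (u h)
  have e2 : -((g+1-h) * u' h) ≤ |u' h| := by
    have := neg_abs_le ((g+1-h) * u' h)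
    have h3 : |(g+1-h) * u' h| ≤ 1 * |u' h| := by
      rw [abs_mul]; gcongr
      rw [abs_le]; constructor <;> linarith [hh.1, hh.2]
    linarith
  linarith

section
variable {VF VE gL gin α κ : ℝ} {p pg pgg pv : ℝ → ℝ → ℝ} {q β : ℝ}

lemma cw_nn (hVF : 0 < VF) (hVE : VF < VE) (hgL : 0 < gL) : 0 ≤ cw VF VE gL := by
  have : 0 < VE - VF := by linarith
  unfold cw gJ; positivity

lemma Kx_nn (hVF : 0 < VF) (hVE : VF < VE) (hgL : 0 < gL) (hgin : 0 < gin) (hα : 0 < α) (hκ : 0 < κ) : 0 ≤ Kx VF VE gL gin α κ := by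
  have h1 := Ken_nn (c1 := 0) (c2 := 1) hVF hVE hgL hgin hα hκ
  have h2 := Ken_nn (c1 := 1) (c2 := 0) hVF hVE hgL hgin hα hκ
  have : 0 < VE - VF := by linarith
  have h3 : 0 < gJ VE gL VF := by unfold gJ; positivity
  unfold Kx; positivity

lemma Ke_nn (hVF : 0 < VF) (hVE : VF < VE) (hgL : 0 < gL) (hgin : 0 < gin) (hα : 0 < α) (hκ : 0 < κ) : 0 ≤ Ke VF VE gL gin α κ := by
  have h2 := Ken_nn (c1 := 1) (c2 := 0) hVF hVE hgL hgin hα hκ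
  unfold Ke; positivity

def C1f (gL : ℝ) : ℝ := (1 + 2/gL^2)^2
def C2f (VF VE gL gin α κ : ℝ) : ℝ := 2 * (gJ VE gL VF + 1 + gL)^2 + cw VF VE gL * Kx VF VE gL gin α κ

lemma sup_u (S : Sys VF VE gL gin α κ p pg pgg pv) (hq : 1 < q) {v : ℝ} (hv : v ∈ Ioo 0 VF)
    (hie : IntegrableOn (fun g => ed q p pg v g) (Ioi 0)) (hiw : IntegrableOn (fun g => Wd gL q p (v,g)) (Ioi 0))
    {g : ℝ} (hg : 0 < g) {t : ℝ} (ht : 0 < t) :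
    p v g ^ q ≤ (∫ g in Ioi (0:ℝ), Wd gL q p (v,g)) / gL^2 + t * (∫ g in Ioi (0:ℝ), ed q p pg v g) + (∫ g in Ioi (0:ℝ), Wd gL q p (v,g)) / (gL^2 * t) := by
  have hgL := S.hgL
  have hsub : Icc g (g+1) ⊆ Ioi (0:ℝ) := fun h hh => lt_of_lt_of_le hg hh.1
  have hiF : IntegrableOn (fun g => Wd gL q p (v,g) / gL^2 + t * ed q p pg v g + Wd gL q p (v,g) / (gL^2 * t)) (Ioi 0) :=
    ((hiw.div_const _).add (hie.const_mul _)).add (hiw.div_const _)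
  have hpp : ∀ h ∈ Ioi (0:ℝ), 0 < p v h := fun h hh => S.pos v hv h (le_of_lt hh)
  have hwn : ∀ h ∈ Ioi (0:ℝ), 0 ≤ Wd gL q p (v,h) := fun h hh => mul_nonneg (sq_nonneg _) (rpow_nonneg (hpp h hh).le _)
  have hen : ∀ h ∈ Ioi (0:ℝ), 0 ≤ ed q p pg v h := fun h hh => mul_nonneg (sq_nonneg _) (mul_nonneg (rpow_nonneg (hpp h hh).le _) (sq_nonneg _))
  have h1 := sup_bd (u := fun h => p v h ^ q) (u' := fun h => pg v h * q * p v h ^ (q-1)) (g := g)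
    (fun h hh => (S.hpg' hv (hsub hh)).rpow_const (Or.inl (hpp h (hsub hh)).ne'))
    (by
      have c1 : ContinuousOn (pg v) (Icc g (g+1)) := (S.contpg v hv).mono (hsub.trans Ioi_subset_Ici_self)
      have c2 : ContinuousOn (fun h => p v h ^ (q-1)) (Icc g (g+1)) :=
        (S.contg v hv).continuousOn.rpow_const fun h hh => Or.inl (hpp h (hsub hh)).ne'
      fun_prop) _ (hiF.mono_set hsub) (by
      intro h hh
      have hp := hpp h (hsub hh)
      set u := p v h ^ q with hu
      have hu0 : 0 < u := rpow_pos_of_pos hp _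
      have he := hen h (hsub hh)
      have huw : u ≤ Wd gL q p (v,h) / gL^2 := by
        rw [le_div_iff₀ (by positivity)]
        unfold Wd
        have : gL^2 ≤ (h+gL)^2 := by
          have : 0 < h := hsub hh
          gcongr; linarith
        simp only; rw [← hu]; nlinarith
      have hsq : (pg v h * q * p v h ^ (q-1))^2 = ed q p pg v h * u := by
        have : (p v h ^ (q-1))^2 = p v h ^ (q-2) * u := by
          rw [hu, ← rpow_natCast, ← rpow_mul hp.le, ← rpow_add hp]; congr 1; push_cast; ring
        unfold ed
        rw [mul_pow, this]; ring
      have h2 : |pg v h * q * p v h ^ (q-1)| ≤ t * ed q p pg v h + u / t := by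
        apply abs_le_of_sq_le_sq _ (by positivity)
        rw [hsq]
        have : (t * ed q p pg v h) * (u/t) = ed q p pg v h * u := by field_simp
        have a1 : 0 ≤ t * ed q p pg v h := by positivity
        have a2 : 0 ≤ u / t := by positivity
        nlinarith
      have h3 : u / t ≤ Wd gL q p (v,h) / (gL^2 * t) := by
        rw [← div_div]; gcongr
      rw [abs_of_pos hu0]
      linarith)
  refine h1.trans ?_
  calc _ ≤ ∫ g in Ioi (0:ℝ), (Wd gL q p (v,g) / gL^2 + t * ed q p pg v g + Wd gL q p (v,g) / (gL^2 * t)) := by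
        refine setIntegral_mono_set hiF ?_ hsub.eventuallyLE
        refine (ae_restrict_iff' measurableSet_Ioi).2 (Eventually.of_forall fun h hh => ?_)
        have := hwn h hh; have := hen h hh
        simp only [Pi.zero_apply]; positivity
    _ = _ := by
        have hi4 : IntegrableOn (fun g => Wd gL q p (v,g) / gL^2 + t * ed q p pg v g) (Ioi 0) := (hiw.div_const _).add (hie.const_mul _)
        rw [integral_add hi4 (hiw.div_const _), integral_add (hiw.div_const _) (hie.const_mul _),
          integral_div, integral_div, integral_const_mul]

lemma split_bd (S : Sys VF VE gL gin α κ p pg pgg pv) (Y : Bdy VF VE gL p) (hq : 1 < q)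
    (hd : IntegrableOn (Wd gL q p) (Ioo 0 VF ×ˢ Ioi (0:ℝ))) {v : ℝ} (hv : v ∈ Ioo 0 VF)
    (hiw : IntegrableOn (fun g => Wd gL q p (v,g)) (Ioi 0)) {s : ℝ} (hs0 : 0 ≤ s) (hs : ∀ g, 0 < g → p v g ^ q ≤ s)
    {D : ℝ} (hD : D = q * ∫ x in Ioo 0 VF ×ˢ Ioi (0:ℝ), Wd gL q p x) (hD0 : 0 < D) {δ : ℝ} (hδ : 0 < δ) (hδ1 : δ ≤ 1) :
    (∫ g in Ioi (0:ℝ), Wd gL q p (v,g)) * δ^4 ≤ 2 * (gJ VE gL VF + 1 + gL)^2 * (δ^5 * s) + cw VF VE gL * Kx VF VE gL gin α κ * D := by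
  have hVF := S.hVF; have hVE := S.hVE; have hgL := S.hgL
  have hv' : v ∈ Icc 0 VF := ⟨hv.1.le, hv.2.le⟩
  have hcw := cw_nn hVF hVE hgL
  have hKx := Kx_nn hVF hVE hgL S.hgin S.hα S.hκ
  have hbF := gJ_le hVE hgL hv'
  have hb0 : 0 < gJ VE gL v := by
    unfold gJ; have := hv.1; have : 0 < VE - v := by linarith [hv.2]
    positivity
  set b := gJ VE gL v with hb
  set gF := gJ VE gL VF
  have hwn : ∀ h ∈ Ioi (0:ℝ), 0 ≤ Wd gL q p (v,h) := fun h hh => mul_nonneg (sq_nonneg _) (rpow_nonneg (S.nonneg v h) _)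
  have hX := X_bd S Y hq hd hv
  rw [← hD] at hX
  set c := δ^4 * ((gF + 1 + gL)^2 * s) with hc
  have hc0 : 0 ≤ c := by positivity
  rw [← ENNReal.ofReal_le_ofReal_iff (by positivity)]
  calc ENNReal.ofReal ((∫ g in Ioi (0:ℝ), Wd gL q p (v,g)) * δ^4)
      = ∫⁻ g in Ioi (0:ℝ), ENNReal.ofReal (Wd gL q p (v,g) * δ^4) := by
        rw [← integral_mul_const]
        refine ofReal_integral_eq_lintegral_ofReal (hiw.mul_const _) ((ae_restrict_iff' measurableSet_Ioi).2 (Eventually.of_forall fun h hh => ?_))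
        have := hwn h hh
        simp only [Pi.zero_apply]; positivity
    _ ≤ ∫⁻ g in Ioi (0:ℝ), ((Icc (b-δ) (b+δ)).indicator (fun _ => ENNReal.ofReal c) g +
          ENNReal.ofReal (cw VF VE gL) * ENNReal.ofReal (Jflux VE gL v g * ((rho (gJ VE gL v) g - lam (gJ VE gL v) g) * p v g ^ q))) := by
        refine lintegral_mono_ae ((ae_restrict_iff' measurableSet_Ioi).2 (Eventually.of_forall fun g hg => ?_))
        have hg0 : (0:ℝ) < g := hg
        have hu0 : 0 ≤ p v g ^ q := rpow_nonneg (S.nonneg v g) _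
        by_cases hgI : g ∈ Icc (b-δ) (b+δ)
        · rw [indicator_of_mem hgI]
          refine le_add_right (ENNReal.ofReal_le_ofReal ?_)
          rw [hc]; unfold Wd; simp only
          have h1 : (g + gL)^2 ≤ (gF + 1 + gL)^2 := by
            gcongr; linarith [hgI.2]
          have h2 := hs g hg0
          calc (g + gL)^2 * p v g ^ q * δ^4 ≤ (gF + 1 + gL)^2 * s * δ^4 := by gcongr
            _ = _ := by ring
        · rw [indicator_of_notMem hgI, zero_add, ← ENNReal.ofReal_mul hcw]
          apply ENNReal.ofReal_le_ofReal
          have hgd : δ ≤ |g - b| := by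
            by_contra hcon
            push Not at hcon
            rw [abs_lt] at hcon
            exact hgI ⟨by linarith [hcon.1], by linarith [hcon.2]⟩
          have hw := weight hVF hVE hgL hv hg0 hδ hδ1 hgd
          unfold Wd; simp only
          calc (g + gL)^2 * p v g ^ q * δ^4 = (δ^4 * (g+gL)^2) * p v g ^ q := by ring
            _ ≤ (cw VF VE gL * (Jflux VE gL v g * (rho (gJ VE gL v) g - lam (gJ VE gL v) g))) * p v g ^ q := by gcongr
            _ = _ := by ring
    _ = (∫⁻ g in Ioi (0:ℝ), (Icc (b-δ) (b+δ)).indicator (fun _ => ENNReal.ofReal c) g) +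
          ENNReal.ofReal (cw VF VE gL) * ∫⁻ g in Ioi (0:ℝ), ENNReal.ofReal (Jflux VE gL v g * ((rho (gJ VE gL v) g - lam (gJ VE gL v) g) * p v g ^ q)) := by
        rw [lintegral_add_left (measurable_const.indicator measurableSet_Icc), lintegral_const_mul' _ _ ENNReal.ofReal_ne_top]
    _ ≤ ENNReal.ofReal c * ENNReal.ofReal (2*δ) + ENNReal.ofReal (cw VF VE gL) * ENNReal.ofReal (Kx VF VE gL gin α κ * D) := by
        gcongr
        calc _ ≤ ∫⁻ g, (Icc (b-δ) (b+δ)).indicator (fun _ => ENNReal.ofReal c) g := setLIntegral_le_lintegral _ _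
          _ = _ := by
            rw [lintegral_indicator_const measurableSet_Icc, Real.volume_Icc]; congr 2; ring
    _ = _ := by
        rw [← ENNReal.ofReal_mul hc0, ← ENNReal.ofReal_mul hcw, ← ENNReal.ofReal_add (by positivity) (by positivity)]
        congr 1; rw [hc]; ring

theorem per_v (S : Sys VF VE gL gin α κ p pg pgg pv) (Y : Bdy VF VE gL p) (hq : 1 < q) (hβ1 : 1 < β) (hβ2 : β < 4/3)
    (hd : IntegrableOn (Wd gL q p) (Ioo 0 VF ×ˢ Ioi (0:ℝ))) {v : ℝ} (hv : v ∈ Ioo 0 VF)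
    {D : ℝ} (hD : D = q * ∫ x in Ioo 0 VF ×ˢ Ioi (0:ℝ), Wd gL q p x) (hD0 : 0 < D) :
    ∫⁻ g in Ioi (0:ℝ), ENNReal.ofReal ((g + gL)^2 * p v g ^ (β*q)) ≤
      ENNReal.ofReal (Ci β (C1f gL) (C2f VF VE gL gin α κ) * D ^ β) *
        (1 + ENNReal.ofReal (1/D) * ((∫⁻ g in Ioi (0:ℝ), ENNReal.ofReal (ed q p pg v g)) + ∫⁻ g in Ioi (0:ℝ), ENNReal.ofReal (Wd gL q p (v,g)))) := by
  have hVF := S.hVF; have hVE := S.hVE; have hgL := S.hgL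
  have hcw := cw_nn hVF hVE hgL
  have hKx := Kx_nn hVF hVE hgL S.hgin S.hα S.hκ
  have hC1 : 0 ≤ C1f gL := sq_nonneg _
  have hC2 : 0 ≤ C2f VF VE gL gin α κ := by unfold C2f; positivity
  have hCi := Ci_pos (β := β) hC1 hC2
  have hDβ : 0 < D ^ β := rpow_pos_of_pos hD0 _
  have hpos : ENNReal.ofReal (Ci β (C1f gL) (C2f VF VE gL gin α κ) * D ^ β) ≠ 0 := by
    rw [Ne, ENNReal.ofReal_eq_zero, not_le]; positivity
  have hpos2 : ENNReal.ofReal (1/D) ≠ 0 := by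
    rw [Ne, ENNReal.ofReal_eq_zero, not_le]; positivity
  set A := ∫⁻ g in Ioi (0:ℝ), ENNReal.ofReal (ed q p pg v g) with hA
  set B := ∫⁻ g in Ioi (0:ℝ), ENNReal.ofReal (Wd gL q p (v,g)) with hB
  by_cases hAB : A + B = ⊤
  · rw [hAB, ENNReal.mul_top hpos2, add_top, ENNReal.mul_top hpos]; exact le_top
  rw [ENNReal.add_eq_top, not_or] at hAB
  have hpp : ∀ h ∈ Ioi (0:ℝ), 0 < p v h := fun h hh => S.pos v hv h (le_of_lt hh)
  have hwn : ∀ h ∈ Ioi (0:ℝ), 0 ≤ Wd gL q p (v,h) := fun h hh => mul_nonneg (sq_nonneg _) (rpow_nonneg (hpp h hh).le _)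
  have hen : ∀ h ∈ Ioi (0:ℝ), 0 ≤ ed q p pg v h := fun h hh => mul_nonneg (sq_nonneg _) (mul_nonneg (rpow_nonneg (hpp h hh).le _) (sq_nonneg _))
  have mp : Measurable (p v) := S.meas.comp measurable_prodMk_left
  have mpg : Measurable (pg v) := S.measpg.comp measurable_prodMk_left
  have hie : IntegrableOn (fun g => ed q p pg v g) (Ioi 0) := by
    refine ⟨?_, ?_⟩
    · unfold ed; apply Measurable.aestronglyMeasurable; fun_prop
    · rw [hasFiniteIntegral_iff_ofReal ((ae_restrict_iff' measurableSet_Ioi).2 (Eventually.of_forall hen))]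
      exact lt_top_iff_ne_top.2 hAB.1
  have hiw : IntegrableOn (fun g => Wd gL q p (v,g)) (Ioi 0) := by
    refine ⟨?_, ?_⟩
    · unfold Wd; apply Measurable.aestronglyMeasurable; simp only; fun_prop
    · rw [hasFiniteIntegral_iff_ofReal ((ae_restrict_iff' measurableSet_Ioi).2 (Eventually.of_forall hwn))]
      exact lt_top_iff_ne_top.2 hAB.2
  have hAe := ofReal_integral_eq_lintegral_ofReal hie ((ae_restrict_iff' measurableSet_Ioi).2 (Eventually.of_forall hen))
  have hBm := ofReal_integral_eq_lintegral_ofReal hiw ((ae_restrict_iff' measurableSet_Ioi).2 (Eventually.of_forall hwn))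
  rw [← hA] at hAe
  rw [← hB] at hBm
  set e := ∫ g in Ioi (0:ℝ), ed q p pg v g with he
  set m := ∫ g in Ioi (0:ℝ), Wd gL q p (v,g) with hm
  have he0 : 0 ≤ e := setIntegral_nonneg measurableSet_Ioi hen
  have hm0 : 0 < m := by
    rw [hm, setIntegral_pos_iff_support_of_nonneg_ae ((ae_restrict_iff' measurableSet_Ioi).2 (Eventually.of_forall hwn)) hiw]
    have : Function.support (fun g => Wd gL q p (v,g)) ∩ Ioi 0 = Ioi 0 := by
      apply inter_eq_right.2
      intro g hg
      have hg0 : (0:ℝ) < g := hg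
      exact (mul_pos (by simp only []; positivity) (rpow_pos_of_pos (hpp g hg) _)).ne'
    rw [this]; simp
  set E := e + m with hE
  have hE0 : 0 < E := by positivity
  set r := sqrt (m * E) with hr
  have hr0 : 0 < r := sqrt_pos.2 (by positivity)
  have hr2 : r^2 = m * E := sq_sqrt (by positivity)
  have hmr : m ≤ r := by
    apply le_sqrt_of_sq_le; nlinarith
  set s := (1 + 2/gL^2) * r with hs
  have hs0 : 0 ≤ s := by positivity
  have hsup : ∀ g, 0 < g → p v g ^ q ≤ s := by
    intro g hg
    have h := sup_u S hq hv hie hiw hg (t := r / E) (by positivity)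
    rw [← he, ← hm] at h
    have h1 : r / E * e ≤ r := by
      calc r / E * e ≤ r / E * E := by gcongr; linarith
        _ = r := by field_simp
    have h2 : m / (gL^2 * (r / E)) = r / gL^2 := by
      field_simp; rw [hr2]
    have h3 : m / gL^2 ≤ r / gL^2 := by gcongr
    have h4 : s = r / gL^2 + r + r / gL^2 := by rw [hs]; ring
    linarith
  have hint := interp (β := β) (C1 := C1f gL) (C2 := C2f VF VE gL gin α κ) (m := m / D) (E := E / D) (s := s / D) hβ1 hβ2 hC1 hC2
    (by positivity) (by gcongr; linarith) (by positivity)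
    (by rw [div_pow, hs, mul_pow, hr2]; unfold C1f; apply le_of_eq; field_simp)
    (by
      intro δ hδ hδ1
      have h := split_bd S Y hq hd hv hiw hs0 hsup hD hD0 hδ hδ1
      rw [← hm] at h
      have k : m / D * δ^4 ≤ 2 * (gJ VE gL VF + 1 + gL)^2 * (δ^5 * (s / D)) + cw VF VE gL * Kx VF VE gL gin α κ := by
        rw [div_mul_eq_mul_div, div_le_iff₀ hD0]
        calc _ ≤ _ := h
          _ = _ := by field_simp
      have n1 : 0 ≤ cw VF VE gL * Kx VF VE gL gin α κ := by positivity
      have n2 : 0 ≤ 2 * (gJ VE gL VF + 1 + gL)^2 := by positivity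
      have n3 : 0 ≤ δ^5 * (s / D) := by positivity
      unfold C2f
      nlinarith [mul_nonneg n1 n3])
  have hfin : m * s ^ (β-1) ≤ Ci β (C1f gL) (C2f VF VE gL gin α κ) * D ^ β * (1 + 1/D * (e + m)) := by
    have e1 : D ^ β * (m / D * (s / D) ^ (β - 1)) = m * s ^ (β - 1) := by
      rw [div_rpow hs0 hD0.le, rpow_sub_one hD0.ne']
      field_simp
    rw [← e1]
    calc D ^ β * (m / D * (s / D) ^ (β - 1)) ≤ D ^ β * (Ci β (C1f gL) (C2f VF VE gL gin α κ) * (1 + E / D)) := by gcongr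
      _ = _ := by rw [hE]; ring
  calc ∫⁻ g in Ioi (0:ℝ), ENNReal.ofReal ((g + gL)^2 * p v g ^ (β*q))
      ≤ ∫⁻ g in Ioi (0:ℝ), ENNReal.ofReal (s ^ (β-1)) * ENNReal.ofReal (Wd gL q p (v,g)) := by
        refine lintegral_mono_ae ((ae_restrict_iff' measurableSet_Ioi).2 (Eventually.of_forall fun g hg => ?_))
        rw [← ENNReal.ofReal_mul (by positivity)]
        apply ENNReal.ofReal_le_ofReal
        unfold Wd; simp only
        have hu0 : 0 < p v g ^ q := rpow_pos_of_pos (hpp g hg) _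
        have e1 : p v g ^ (β*q) = (p v g ^ q) ^ (β - 1) * p v g ^ q := by
          rw [mul_comm β q, rpow_mul (hpp g hg).le, ← rpow_add_one hu0.ne']; congr 1; ring
        rw [e1]
        have : (p v g ^ q) ^ (β - 1) ≤ s ^ (β-1) := rpow_le_rpow hu0.le (hsup g hg) (by linarith)
        calc (g+gL)^2 * ((p v g ^ q) ^ (β - 1) * p v g ^ q) ≤ (g+gL)^2 * (s ^ (β-1) * p v g ^ q) := by gcongr
          _ = _ := by ring
    _ = ENNReal.ofReal (m * s ^ (β-1)) := by
        rw [lintegral_const_mul' _ _ ENNReal.ofReal_ne_top, ← hB, ← hBm, ← ENNReal.ofReal_mul (by positivity), mul_comm]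
    _ ≤ ENNReal.ofReal (Ci β (C1f gL) (C2f VF VE gL gin α κ) * D ^ β * (1 + 1/D * (e + m))) := ENNReal.ofReal_le_ofReal hfin
    _ = _ := by
        rw [← hAe, ← hBm, ENNReal.ofReal_mul (p := _ * D ^ β) (by positivity), ENNReal.ofReal_add (by positivity) (by positivity), ENNReal.ofReal_one,
          ENNReal.ofReal_mul (p := 1/D) (by positivity), ENNReal.ofReal_add he0 hm0.le]

def Cfin (VF VE gL gin α κ β : ℝ) : ℝ := Ci β (C1f gL) (C2f VF VE gL gin α κ) * (VF + (Ke VF VE gL gin α κ + 1))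

theorem gain (S : Sys VF VE gL gin α κ p pg pgg pv) (Y : Bdy VF VE gL p) (hq : 4/3 ≤ q) (hβ1 : 1 < β) (hβ2 : β < 4/3)
    (hd : IntegrableOn (Wd gL q p) (Ioo 0 VF ×ˢ Ioi (0:ℝ))) :
    ∫⁻ x in Ioo 0 VF ×ˢ Ioi (0:ℝ), ENNReal.ofReal ((x.2 + gL)^2 * p x.1 x.2 ^ (β*q)) ≤
      ENNReal.ofReal (Cfin VF VE gL gin α κ β * q ^ β) * ENNReal.ofReal (∫ x in Ioo 0 VF ×ˢ Ioi (0:ℝ), Wd gL q p x) ^ β := by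
  have hVF := S.hVF; have hVE := S.hVE; have hgL := S.hgL
  have hcw := cw_nn hVF hVE hgL
  have hKx := Kx_nn hVF hVE hgL S.hgin S.hα S.hκ
  have hKe := Ke_nn hVF hVE hgL S.hgin S.hα S.hκ
  have hC1 : 0 ≤ C1f gL := sq_nonneg _
  have hC2 : 0 ≤ C2f VF VE gL gin α κ := by unfold C2f; positivity
  have hCi := Ci_pos (β := β) hC1 hC2
  have hq1 : 1 < q := by linarith
  have hq0 : 0 < q := by linarith
  set R := Ioo 0 VF ×ˢ Ioi (0:ℝ) with hR
  have hRm : MeasurableSet R := measurableSet_Ioo.prod measurableSet_Ioi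
  have hwn : ∀ x ∈ R, 0 ≤ Wd gL q p x := fun x hx => mul_nonneg (sq_nonneg _) (rpow_nonneg (S.nonneg _ _) _)
  have hae := (ae_restrict_iff' (μ := volume) hRm).2 (Eventually.of_forall hwn)
  have hm : Measurable (fun x : ℝ × ℝ => p x.1 x.2) := S.meas
  have hd0 : 0 < ∫ x in R, Wd gL q p x := by
    rw [setIntegral_pos_iff_support_of_nonneg_ae hae hd]
    have : Function.support (Wd gL q p) ∩ R = R := by
      apply inter_eq_right.2
      intro x hx
      have hg0 : (0:ℝ) < x.2 := hx.2
      exact (mul_pos (by positivity) (rpow_pos_of_pos (S.pos _ hx.1 _ hg0.le) _)).ne'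
    rw [this, hR, Measure.volume_eq_prod, Measure.prod_prod]; simp [hVF]
  set d := ∫ x in R, Wd gL q p x with hdd
  have hD0 : 0 < q * d := by positivity
  have hDb : 0 < (q*d) ^ β := rpow_pos_of_pos hD0 _
  have hvol : (volume.restrict R : Measure (ℝ × ℝ)) = (volume.restrict (Ioo 0 VF)).prod (volume.restrict (Ioi (0:ℝ))) := by
    rw [hR, Measure.volume_eq_prod, Measure.prod_restrict]
  have mW : Measurable (Wd gL q p) := by unfold Wd; fun_prop
  have mE : Measurable (fun x : ℝ × ℝ => ed q p pg x.1 x.2) := by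
    have : Measurable (fun x : ℝ × ℝ => pg x.1 x.2) := S.measpg
    unfold ed; fun_prop
  have hB : ∫⁻ v in Ioo 0 VF, ∫⁻ g in Ioi (0:ℝ), ENNReal.ofReal (Wd gL q p (v,g)) = ENNReal.ofReal d := by
    rw [hdd, ofReal_integral_eq_lintegral_ofReal hd hae, hvol, lintegral_prod _ mW.ennreal_ofReal.aemeasurable]
  have hA := grad_bd S Y hq hd
  rw [← hR, ← hdd] at hA
  have mA : Measurable (fun v => ∫⁻ g in Ioi (0:ℝ), ENNReal.ofReal (ed q p pg v g)) := mE.ennreal_ofReal.lintegral_prod_right'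
  have mB : Measurable (fun v => ∫⁻ g in Ioi (0:ℝ), ENNReal.ofReal (Wd gL q p (v,g))) := mW.ennreal_ofReal.lintegral_prod_right'
  set c := Ci β (C1f gL) (C2f VF VE gL gin α κ) * (q*d) ^ β with hc
  calc ∫⁻ x in R, ENNReal.ofReal ((x.2 + gL)^2 * p x.1 x.2 ^ (β*q))
      = ∫⁻ v in Ioo 0 VF, ∫⁻ g in Ioi (0:ℝ), ENNReal.ofReal ((g + gL)^2 * p v g ^ (β*q)) := by
        rw [hvol, lintegral_prod]
        apply Measurable.aemeasurable; fun_prop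
    _ ≤ ∫⁻ v in Ioo 0 VF, ENNReal.ofReal c *
        (1 + ENNReal.ofReal (1/(q*d)) * ((∫⁻ g in Ioi (0:ℝ), ENNReal.ofReal (ed q p pg v g)) + ∫⁻ g in Ioi (0:ℝ), ENNReal.ofReal (Wd gL q p (v,g)))) :=
        lintegral_mono_ae ((ae_restrict_iff' measurableSet_Ioo).2 (Eventually.of_forall fun v hv => per_v S Y hq1 hβ1 hβ2 hd hv rfl hD0))
    _ = ENNReal.ofReal c * (ENNReal.ofReal VF + ENNReal.ofReal (1/(q*d)) * ((∫⁻ v in Ioo 0 VF, ∫⁻ g in Ioi (0:ℝ), ENNReal.ofReal (ed q p pg v g)) + ENNReal.ofReal d)) := by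
        rw [lintegral_const_mul' _ _ ENNReal.ofReal_ne_top, lintegral_add_left measurable_const, lintegral_const_mul' _ _ ENNReal.ofReal_ne_top,
          lintegral_add_left mA, hB]
        simp
    _ ≤ ENNReal.ofReal c * (ENNReal.ofReal VF + ENNReal.ofReal (1/(q*d)) * (ENNReal.ofReal (Ke VF VE gL gin α κ * (q * d)) + ENNReal.ofReal (q * d))) := by
        gcongr; nlinarith
    _ = ENNReal.ofReal (c * (VF + 1/(q*d) * (Ke VF VE gL gin α κ * (q * d) + q * d))) := by
        have hc0 : 0 ≤ c := by positivity
        rw [ENNReal.ofReal_mul (p := c) hc0, ENNReal.ofReal_add (by positivity) (by positivity), ENNReal.ofReal_mul (p := 1/(q*d)) (by positivity),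
          ENNReal.ofReal_add (by positivity) (by positivity)]
    _ = _ := by
        rw [ENNReal.ofReal_rpow_of_pos hd0, ← ENNReal.ofReal_mul (by unfold Cfin; positivity)]
        congr 1
        rw [hc, mul_rpow hq0.le hd0.le]; unfold Cfin
        field_simp
end

section
variable {VF VE gL gin a σE : ℝ} {p : ℝ → ℝ → ℝ}

/-- clamped extension of the solution -/
def ph (VF : ℝ) (p : ℝ → ℝ → ℝ) (v g : ℝ) : ℝ := p (max 0 (min v VF)) (max g 0)

open Classical in
def phg (VF : ℝ) (p : ℝ → ℝ → ℝ) (v g : ℝ) : ℝ :=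
  if v ∈ Ioo 0 VF ∧ 0 ≤ g then derivWithin (p v) (Ici 0) g else 0

lemma clamp_mem (hVF : 0 < VF) (v : ℝ) : max 0 (min v VF) ∈ Icc 0 VF :=
  ⟨le_max_left _ _, max_le hVF.le (min_le_right _ _)⟩

lemma clamp_eq {v : ℝ} (hv : v ∈ Icc 0 VF) : max 0 (min v VF) = v := by
  rw [min_eq_left hv.2, max_eq_right hv.1]

lemma ph_eq {v g : ℝ} (hv : v ∈ Icc 0 VF) (hg : 0 ≤ g) : ph VF p v g = p v g := by
  unfold ph; rw [clamp_eq hv, max_eq_left hg]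

lemma ph_contv (hVF : 0 < VF) (H : StatSol VF VE gL gin a σE p) (g : ℝ) : Continuous (fun v => ph VF p v g) := by
  unfold ph
  exact (H.cont_v (max g 0) (mem_Ici.2 (le_max_right _ _))).comp_continuous (by fun_prop) (clamp_mem hVF)

lemma ph_contg (H : StatSol VF VE gL gin a σE p) {v : ℝ} (hv : v ∈ Ioo 0 VF) : Continuous (ph VF p v) := by
  have h : ph VF p v = fun g => p v (max g 0) := by
    funext g; unfold ph; rw [clamp_eq ⟨hv.1.le, hv.2.le⟩]
  rw [h]
  exact (H.smooth_g v hv).continuousOn.comp_continuous (by fun_prop) (fun g => mem_Ici.2 (le_max_right _ _))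

lemma ph_nonneg (hVF : 0 < VF) (H : StatSol VF VE gL gin a σE p) (v g : ℝ) : 0 ≤ ph VF p v g := by
  unfold ph
  set w := max 0 (min v VF)
  have hw : w ∈ Icc 0 VF := clamp_mem hVF v
  have hg : max g 0 ∈ Ici (0:ℝ) := mem_Ici.2 (le_max_right _ _)
  have hcl := (H.cont_v _ hg).preimage_isClosed_of_isClosed isClosed_Icc (isClosed_Ici (a := (0:ℝ)))
  have hsub : Ioo 0 VF ⊆ Icc 0 VF ∩ (fun v => p v (max g 0)) ⁻¹' Ici 0 := fun x hx => ⟨Ioo_subset_Icc_self hx, H.nonneg x hx _ hg⟩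
  have h := hcl.closure_subset_iff.2 hsub
  rw [closure_Ioo hVF.ne] at h
  exact (h hw).2

lemma ph_meas (hVF : 0 < VF) (H : StatSol VF VE gL gin a σE p) : Measurable (Function.uncurry (ph VF p)) := by
  refine measurable_uncurry_of_continuous_of_measurable (ph_contv hVF H) fun v => ?_
  have hw : max 0 (min v VF) ∈ Icc 0 VF := clamp_mem hVF v
  have e : ph VF p v = ph VF p (max 0 (min v VF)) := by
    funext g; unfold ph; rw [clamp_eq hw]
  rw [e]
  rw [← closure_Ioo hVF.ne] at hw
  obtain ⟨x, hx, hxl⟩ := mem_closure_iff_seq_limit.1 hw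
  refine measurable_of_tendsto_metrizable (f := fun n => ph VF p (x n)) (fun n => (ph_contg H (hx n)).measurable) ?_
  rw [tendsto_pi_nhds]
  intro g
  exact ((ph_contv hVF H g).tendsto _).comp hxl

lemma phg_eq {v g : ℝ} (hv : v ∈ Ioo 0 VF) (hg : 0 ≤ g) : phg VF p v g = derivWithin (p v) (Ici 0) g := by
  unfold phg; rw [if_pos ⟨hv, hg⟩]

lemma ph_hpg (H : StatSol VF VE gL gin a σE p) {v g : ℝ} (hv : v ∈ Ioo 0 VF) (hg : 0 ≤ g) :
    HasDerivWithinAt (ph VF p v) (phg VF p v g) (Ici 0) g := by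
  rw [phg_eq hv hg]
  have h := ((H.smooth_g v hv).differentiableOn (by norm_num) g hg).hasDerivWithinAt
  exact h.congr (fun x hx => ph_eq ⟨hv.1.le, hv.2.le⟩ hx) (ph_eq ⟨hv.1.le, hv.2.le⟩ hg)

lemma ph_measpg (hVF : 0 < VF) (H : StatSol VF VE gL gin a σE p) : Measurable (Function.uncurry (phg VF p)) := by
  have hm := ph_meas hVF H
  let R : Set (ℝ × ℝ) := Ioo 0 VF ×ˢ Ici 0
  have hR : MeasurableSet R := measurableSet_Ioo.prod measurableSet_Ici
  let f : ℕ → ℝ × ℝ → ℝ := fun n x => R.indicator (fun x => (1/((n:ℝ)+1))⁻¹ * (Function.uncurry (ph VF p) (x.1, x.2 + 1/((n:ℝ)+1)) - Function.uncurry (ph VF p) x)) x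
  refine measurable_of_tendsto_metrizable (f := f) (fun n => ?_) ?_
  · refine Measurable.indicator ?_ hR
    have h1 : Measurable (fun x : ℝ × ℝ => (x.1, x.2 + 1/((n:ℝ)+1))) := by fun_prop
    exact measurable_const.mul ((hm.comp h1).sub hm)
  · rw [tendsto_pi_nhds]
    rintro ⟨v, g⟩
    by_cases hx : (v, g) ∈ R
    · have hv : v ∈ Ioo 0 VF := hx.1
      have hg : 0 ≤ g := hx.2
      have h := (ph_hpg H hv hg).mono (Ioi_subset_Ici_self.trans (Ici_subset_Ici.2 hg) : Ioi g ⊆ Ici 0)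
      rw [hasDerivWithinAt_iff_tendsto_slope' (by simp)] at h
      have ht : Tendsto (fun n : ℕ => g + 1/((n:ℝ)+1)) atTop (𝓝[>] g) := by
        rw [tendsto_nhdsWithin_iff]
        refine ⟨?_, Eventually.of_forall fun n => ?_⟩
        · simpa using tendsto_one_div_add_atTop_nhds_zero_nat.const_add g
        · have : (0:ℝ) < 1/((n:ℝ)+1) := by positivity
          simp only [mem_Ioi]; linarith
      refine (h.comp ht).congr fun n => ?_
      simp only [f, indicator_of_mem hx, Function.comp, slope_def_field, Function.uncurry]
      rw [add_sub_cancel_left, div_eq_inv_mul]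
    · have h0 : Function.uncurry (phg VF p) (v, g) = 0 := by
        simp only [Function.uncurry, phg]
        rw [if_neg]
        exact fun h => hx ⟨h.1, h.2⟩
      rw [h0]
      simp only [f, indicator_of_notMem hx]
      exact tendsto_const_nhds

lemma ph_sys (hVF : 0 < VF) (hVE : VF < VE) (hgL : 0 < gL) (hgin : 0 < gin) (ha : 0 < a) (hσE : 0 < σE)
    (H : StatSol VF VE gL gin a σE p) (hpos : ∀ v ∈ Ioo 0 VF, ∀ g ∈ Ici (0:ℝ), 0 < p v g) :
    Sys VF VE gL gin (a/σE) (1/σE) (ph VF p) (phg VF p) (fun v => derivWithin (derivWithin (p v) (Ici 0)) (Ici 0))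
      (fun v g => deriv (fun v' => p v' g) v) := by
  have hd1 : ∀ v ∈ Ioo 0 VF, ContDiffOn ℝ 1 (derivWithin (p v) (Ici 0)) (Ici 0) := fun v hv =>
    (H.smooth_g v hv).derivWithin (uniqueDiffOn_Ici 0) (by norm_num)
  have hcl : ∀ v ∈ Ioo 0 VF, v ∈ Icc 0 VF := fun v hv => ⟨hv.1.le, hv.2.le⟩
  refine ⟨hVF, hVE, hgL, hgin, by positivity, by positivity, ph_nonneg hVF H, ?_, ph_contv hVF H, ph_meas hVF H, ph_measpg hVF H, ?_, ?_, ?_, ?_, ?_, ?_, ?_, ?_⟩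
  · intro v hv g hg; rw [ph_eq (hcl v hv) hg]; exact hpos v hv g hg
  · exact fun v hv => ph_contg H hv
  · intro v hv
    exact (hd1 v hv).continuousOn.congr fun g hg => phg_eq hv hg
  · intro v hv
    exact (hd1 v hv).continuousOn_derivWithin (uniqueDiffOn_Ici 0) le_rfl
  · exact fun v hv g hg => ph_hpg H hv hg
  · intro v hv g hg
    have h := ((hd1 v hv).differentiableOn (by norm_num) g hg).hasDerivWithinAt
    exact h.congr (fun x hx => phg_eq hv hx) (phg_eq hv hg)
  · intro v hv g hg
    refine (H.diff_v v hv g hg).hasDerivAt.congr_of_eventuallyEq ?_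
    filter_upwards [Ioo_mem_nhds hv.1 hv.2] with x hx
    exact ph_eq (hcl x hx) hg.le
  · intro v hv g hg
    have hn : Ici (0:ℝ) ∈ 𝓝 g := Ici_mem_nhds hg
    have hpde := H.pde v hv g hg
    have e1 : deriv (fun v' => Jflux VE gL v' g * p v' g) v = (-gL - g) * p v g + Jflux VE gL v g * deriv (fun v' => p v' g) v := by
      have hJ : HasDerivAt (fun v' => Jflux VE gL v' g) (-gL - g) v := by
        unfold Jflux
        have := ((hasDerivAt_id v).const_mul (-gL)).add (((hasDerivAt_id v).const_sub VE).const_mul g)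
        refine this.congr_deriv ?_
        ring
      exact (hJ.mul (H.diff_v v hv g hg).hasDerivAt).deriv
    have hpd : HasDerivAt (p v) (derivWithin (p v) (Ici 0) g) g :=
      (((H.smooth_g v hv).differentiableOn (by norm_num) g hg.le).hasDerivWithinAt).hasDerivAt hn
    have e2 : deriv (fun g' => ((gin - g') / σE) * p v g') g = -(1/σE) * p v g + (gin - g)/σE * derivWithin (p v) (Ici 0) g := by
      have hJ : HasDerivAt (fun g' => (gin - g') / σE) (-(1/σE)) g := by
        have := ((hasDerivAt_id g).const_sub gin).div_const σE
        refine this.congr_deriv ?_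
        ring
      exact (hJ.mul hpd).deriv
    have e3 : deriv (deriv (fun g' => p v g')) g = derivWithin (derivWithin (p v) (Ici 0)) (Ici 0) g := by
      rw [derivWithin_of_mem_nhds hn]
      apply Filter.EventuallyEq.deriv_eq
      filter_upwards [Ioi_mem_nhds hg] with x hx
      exact (derivWithin_of_mem_nhds (Ici_mem_nhds hx)).symm
    rw [e1, e2, e3] at hpde
    rw [ph_eq (hcl v hv) hg.le, phg_eq hv hg.le]
    have : (gin - g)/σE = -(1/σE * (g - gin)) := by ring
    rw [this] at hpde
    linarith
  · intro v hv
    have hb := H.bc_g v hv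
    have hp := hpos v hv 0 (le_refl (0:ℝ))
    have hne : deriv (fun g' => p v g') 0 ≠ 0 := by
      intro h0; rw [h0] at hb
      have : 0 < gin * p v 0 := by positivity
      linarith
    have hdd := differentiableAt_of_deriv_ne_zero hne
    rw [ph_eq (hcl v hv) le_rfl, phg_eq hv le_rfl]
    have e : derivWithin (p v) (Ici 0) 0 = deriv (fun g' => p v g') 0 := hdd.derivWithin (uniqueDiffOn_Ici 0 0 (mem_Ici.2 le_rfl))
    rw [e]
    have : a * deriv (fun g' => p v g') 0 = gin * p v 0 := by linarith
    rw [div_mul_eq_mul_div, this]; ring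

lemma p_int (H : StatSol VF VE gL gin a σE p) {v : ℝ} (hv : v ∈ Ioo 0 VF) : IntegrableOn (p v) (Ioi 0) := by
  obtain ⟨G, hG⟩ := H.decay 1 one_pos
  set K := max G 1
  have hK1 : 1 ≤ K := le_max_right _ _
  have hKG : G ≤ K := le_max_left _ _
  have hK0 : 0 < K := by linarith
  have hc : ContinuousOn (p v) (Ici 0) := (H.smooth_g v hv).continuousOn
  have h1 : IntegrableOn (p v) (Ioc 0 K) := ((hc.mono Icc_subset_Ici_self).integrableOn_Icc).mono_set Ioc_subset_Icc_self
  have h2 : IntegrableOn (p v) (Ioi K) := by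
    refine Integrable.mono' (integrableOn_Ioi_rpow_of_lt (a := -2) (by norm_num) hK0)
      ((hc.mono (Ioi_subset_Ici hK0.le)).aestronglyMeasurable measurableSet_Ioi) ?_
    refine (ae_restrict_iff' measurableSet_Ioi).2 (Eventually.of_forall fun g hg => ?_)
    have hgK : K < g := hg
    have hg0 : 0 < g := by linarith
    rw [Real.norm_eq_abs, abs_of_nonneg (H.nonneg v hv g hg0.le), rpow_neg hg0.le, ← one_div, le_div_iff₀ (by positivity)]
    have := (hG g (by simp only [mem_Ici]; linarith) v hv).2.1
    have e : g ^ (2:ℝ) = g^2 := by norm_cast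
    rw [e]; linarith
  rw [← Ioc_union_Ioi_eq_Ioi hK0.le]
  exact h1.union h2

lemma ph_bdy (hVF : 0 < VF) (hVE : VF < VE) (hgL : 0 < gL) (H : StatSol VF VE gL gin a σE p) : Bdy VF VE gL (ph VF p) := by
  have h0m : (0:ℝ) ∈ Icc 0 VF := ⟨le_rfl, hVF.le⟩
  have hFm : VF ∈ Icc 0 VF := ⟨hVF.le, le_rfl⟩
  have hVV : 0 < VE - VF := by linarith
  refine ⟨?_, ?_, ?_⟩
  · have hm : Measurable (fun x : ℝ × ℝ => ph VF p x.1 x.2) := ph_meas hVF H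
    refine ⟨hm.aestronglyMeasurable, ?_⟩
    rw [hasFiniteIntegral_iff_ofReal (Eventually.of_forall fun x => ph_nonneg hVF H _ _)]
    have hint : IntegrableOn (fun v => ∫ g in Ioi (0:ℝ), p v g) (Ioo 0 VF) := by
      by_contra hcon
      have := integral_undef hcon
      have h2 := H.normalized
      rw [this] at h2; norm_num at h2
    rw [Measure.volume_eq_prod, ← Measure.prod_restrict, lintegral_prod _ hm.ennreal_ofReal.aemeasurable]
    have e : ∫⁻ v in Ioo 0 VF, ∫⁻ g in Ioi (0:ℝ), ENNReal.ofReal (ph VF p v g) = ∫⁻ v in Ioo 0 VF, ENNReal.ofReal (∫ g in Ioi (0:ℝ), p v g) := by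
      refine setLIntegral_congr_fun measurableSet_Ioo fun v hv => ?_
      beta_reduce
      rw [ofReal_integral_eq_lintegral_ofReal (p_int H hv) ((ae_restrict_iff' measurableSet_Ioi).2 (Eventually.of_forall fun g hg => H.nonneg v hv g (mem_Ici.2 (le_of_lt hg))))]
      refine setLIntegral_congr_fun measurableSet_Ioi fun g hg => ?_
      beta_reduce
      rw [ph_eq ⟨hv.1.le, hv.2.le⟩ (le_of_lt hg)]
    simp only at e ⊢
    rw [e, ← hasFiniteIntegral_iff_ofReal]
    · exact hint.2
    · exact (ae_restrict_iff' measurableSet_Ioo).2 (Eventually.of_forall fun v hv => setIntegral_nonneg measurableSet_Ioi fun g hg => H.nonneg v hv g (mem_Ici.2 (le_of_lt hg)))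
  · intro g hg
    rw [ph_eq h0m hg.le, ph_eq hFm hg.le]
    rcases lt_or_ge g (gL * VF / (VE - VF)) with h | h
    · have := H.bc_v_low g ⟨hg, h⟩
      rw [this.1, this.2]
    · exact (H.bc_v_high g h).symm
  · intro g hg hgF
    unfold gJ at hgF
    have := H.bc_v_low g ⟨hg, hgF⟩
    rw [ph_eq h0m hg.le, ph_eq hFm hg.le]
    rw [lt_div_iff₀ hVV] at hgF
    constructor
    · refine (mul_eq_zero.1 this.1).resolve_left ?_
      unfold Jflux
      have : 0 < g * VE := mul_pos hg (by linarith)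
      intro h; linarith
    · refine (mul_eq_zero.1 this.2).resolve_left ?_
      unfold Jflux
      intro h; linarith
end

/-- the gain-of-integrability step `d_{βq} ≤ C q^β (d_q)^β` for
`1 < β < 4/3`, with `C` independent of `q`. -/
theorem stmt12 (VF VE gL gin a σE : ℝ)
    (hVF : 0 < VF) (hVE : VF < VE) (hgL : 0 < gL) (hgin : 0 < gin)
    (ha : 0 < a) (hσE : 0 < σE)
    (β : ℝ) (hβ1 : 1 < β) (hβ2 : β < 4 / 3) :
    ∃ C : ℝ, ∀ (p : ℝ → ℝ → ℝ), StatSol VF VE gL gin a σE p →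
      (∀ v ∈ Ioo 0 VF, ∀ g ∈ Ici (0:ℝ), 0 < p v g) →
      ∀ q : ℝ, 4 / 3 ≤ q →
      (∫⁻ x in (Ioo (0:ℝ) VF) ×ˢ (Ioi (0:ℝ)),
        ENNReal.ofReal ((x.2 + gL) ^ 2 * (p x.1 x.2) ^ q) < ⊤) →
      (∀ ε > 0, ∃ G : ℝ, ∀ g ∈ Ici G, ∀ v ∈ Ioo 0 VF,
        (p v g) ^ q < ε ∧ g ^ 2 * (p v g) ^ q < ε ∧
          |deriv (fun g' => (p v g') ^ q) g| < ε) →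
      (∫⁻ x in (Ioo (0:ℝ) VF) ×ˢ (Ioi (0:ℝ)),
          ENNReal.ofReal ((x.2 + gL) ^ 2 * (p x.1 x.2) ^ (β * q))) ≤
        ENNReal.ofReal (C * q ^ β) *
          (∫⁻ x in (Ioo (0:ℝ) VF) ×ˢ (Ioi (0:ℝ)),
            ENNReal.ofReal ((x.2 + gL) ^ 2 * (p x.1 x.2) ^ q)) ^ β := by
  refine ⟨Cfin VF VE gL gin (a/σE) (1/σE) β, fun p H hpos q hq hfin _ => ?_⟩
  have S := ph_sys hVF hVE hgL hgin ha hσE H hpos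
  have Y := ph_bdy hVF hVE hgL H
  have hR : MeasurableSet (Ioo 0 VF ×ˢ Ioi (0:ℝ)) := measurableSet_Ioo.prod measurableSet_Ioi
  have heq : ∀ r : ℝ, ∫⁻ x in (Ioo (0:ℝ) VF) ×ˢ (Ioi (0:ℝ)), ENNReal.ofReal ((x.2 + gL) ^ 2 * (p x.1 x.2) ^ r) =
      ∫⁻ x in (Ioo (0:ℝ) VF) ×ˢ (Ioi (0:ℝ)), ENNReal.ofReal ((x.2 + gL) ^ 2 * (ph VF p x.1 x.2) ^ r) := fun r => by
    refine setLIntegral_congr_fun hR fun x hx => ?_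
    beta_reduce
    rw [ph_eq ⟨hx.1.1.le, hx.1.2.le⟩ (le_of_lt hx.2)]
  rw [heq q] at hfin ⊢
  rw [heq (β * q)]
  have hwn : ∀ x : ℝ × ℝ, 0 ≤ Wd gL q (ph VF p) x := fun x => mul_nonneg (sq_nonneg _) (rpow_nonneg (S.nonneg _ _) _)
  have hm : Measurable (fun x : ℝ × ℝ => ph VF p x.1 x.2) := S.meas
  have hd : IntegrableOn (Wd gL q (ph VF p)) (Ioo 0 VF ×ˢ Ioi (0:ℝ)) := by
    refine ⟨?_, ?_⟩
    · unfold Wd; apply Measurable.aestronglyMeasurable; fun_prop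
    · rw [hasFiniteIntegral_iff_ofReal (Eventually.of_forall hwn)]
      exact hfin
  have h := gain S Y hq hβ1 hβ2 hd
  rw [ofReal_integral_eq_lintegral_ofReal hd (Eventually.of_forall hwn)] at h
  exact h
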